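/- For every δ > 1 and ε > 0 there is a constant C(δ, ε) such that for all squarefree q ≥ 1, all z > 0, and every finite set S of pairwise SL₂(ℤ)-inequivalent x ∈ V̂_ℤ with |Disc(x)| > q⁸·z, one has Σ_{x∈S} (|Φ̂_q(x)|/#Stab(x))·(|Disc(x)|/q⁸)^{−δ} ≤ C(δ, ε)·q^{1+ε}·z^{1−δ}. Moreover, for every δ ∈ (0,1) and ε > 0 there is C(δ, ε) such that the same bound Σ_{x∈S} (|Φ̂_q(x)|/#Stab(x))·(|Disc(x)|/q⁸)^{−δ} ≤ C(δ, ε)·q^{1+ε}·z^{1−δ} holds for every finite set S of pairwise SL₂(ℤ)-inequivalent x ∈ V̂_ℤ with 0 < |Disc(x)| < q⁸·z. -/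

import Mathlib

open scoped Classical

noncomputable section

/-- An integral binary cubic form `a u³ + b u²v + c uv² + d v³`, recorded by its
coefficient quadruple `(a, b, c, d)`. -/
abbrev BCF := ℤ × ℤ × ℤ × ℤ

namespace BCF

/-- The discriminant of a binary cubic form. -/
def disc (f : BCF) : ℤ :=
  f.2.1 ^ 2 * f.2.2.1 ^ 2 - 4 * f.1 * f.2.2.1 ^ 3 - 4 * f.2.1 ^ 3 * f.2.2.2
    - 27 * f.1 ^ 2 * f.2.2.2 ^ 2 + 18 * f.1 * f.2.1 * f.2.2.1 * f.2.2.2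

/-- The (twisted) action of a matrix `γ` with `det γ = ±1` on binary cubic forms:
`(γ·f)(u,v) = (det γ)⁻¹ · f((u,v)·γ)`, written out on coefficients (for `det γ = ±1`,
dividing by the determinant is the same as multiplying by it). -/
def act (γ : Matrix (Fin 2) (Fin 2) ℤ) (f : BCF) : BCF :=
  let a := f.1; let b := f.2.1; let c := f.2.2.1; let d := f.2.2.2
  let α := γ 0 0; let β := γ 1 0; let g := γ 0 1; let δ := γ 1 1
  (γ.det * (a * α ^ 3 + b * α ^ 2 * g + c * α * g ^ 2 + d * g ^ 3),
   γ.det * (3 * a * α ^ 2 * β + b * (α ^ 2 * δ + 2 * α * β * g)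
      + c * (2 * α * g * δ + β * g ^ 2) + 3 * d * g ^ 2 * δ),
   γ.det * (3 * a * α * β ^ 2 + b * (2 * α * β * δ + β ^ 2 * g)
      + c * (α * δ ^ 2 + 2 * β * g * δ) + 3 * d * g * δ ^ 2),
   γ.det * (a * β ^ 3 + b * β ^ 2 * δ + c * β * δ ^ 2 + d * δ ^ 3))

/-- `SL₂(ℤ)`-equivalence of binary cubic forms. -/
def SLeq (f g : BCF) : Prop := ∃ γ : Matrix (Fin 2) (Fin 2) ℤ, γ.det = 1 ∧ act γ f = g

/-- `GL₂(ℤ)`-equivalence of binary cubic forms. -/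
def GLeq (f g : BCF) : Prop :=
  ∃ γ : Matrix (Fin 2) (Fin 2) ℤ, (γ.det = 1 ∨ γ.det = -1) ∧ act γ f = g

/-- The Davenport–Heilbronn set `U_p`: `f` is not a multiple of `p`, and no
`GL₂(ℤ)`-transform of `f` has leading coefficient divisible by `p²` and second
coefficient divisible by `p`. -/
def inUp (p : ℕ) (f : BCF) : Prop :=
  (¬ ((p:ℤ) ∣ f.1 ∧ (p:ℤ) ∣ f.2.1 ∧ (p:ℤ) ∣ f.2.2.1 ∧ (p:ℤ) ∣ f.2.2.2)) ∧
  ∀ γ : Matrix (Fin 2) (Fin 2) ℤ, (γ.det = 1 ∨ γ.det = -1) →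
    ¬ ((p:ℤ) ^ 2 ∣ (act γ f).1 ∧ (p:ℤ) ∣ (act γ f).2.1)

/-- Membership in the dual lattice `V̂_ℤ`: the middle coefficients are divisible by 3. -/
def inDual (x : BCF) : Prop := (3:ℤ) ∣ x.2.1 ∧ (3:ℤ) ∣ x.2.2.1

/-- The pairing `[x, y] = x₄y₁ − x₃y₂/3 + x₂y₃/3 − x₁y₄` (an integer for `x ∈ V̂_ℤ`). -/
def pairQ (x y : BCF) : ℚ :=
  (x.2.2.2 * y.1 : ℤ) - ((x.2.2.1 * y.2.1 : ℤ) : ℚ) / 3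
    + ((x.2.1 * y.2.2.1 : ℤ) : ℚ) / 3 - (x.1 * y.2.2.2 : ℤ)

/-- `Φ_q`, the characteristic function of forms nonmaximal at every prime `p | q`. -/
def nonmaxAll (q : ℕ) (f : BCF) : Prop := ∀ p : ℕ, p.Prime → p ∣ q → ¬ inUp p f

/-- The cubic Gauss sum `Φ̂_q(x) = q⁻⁸ Σ_y Φ_q(y) exp(2πi [x,y]/q²)`, the sum running
over forms `y` with coefficients in `{0, …, q² − 1}`. -/
noncomputable def PhiHat (q : ℕ) (x : BCF) : ℂ :=
  ((q : ℂ) ^ 8)⁻¹ *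
    ∑ y1 ∈ Finset.range (q ^ 2), ∑ y2 ∈ Finset.range (q ^ 2),
    ∑ y3 ∈ Finset.range (q ^ 2), ∑ y4 ∈ Finset.range (q ^ 2),
      (if nonmaxAll q ((y1 : ℤ), (y2 : ℤ), (y3 : ℤ), (y4 : ℤ)) then 1 else 0) *
        Complex.exp (2 * Real.pi * Complex.I *
          ((pairQ x ((y1 : ℤ), (y2 : ℤ), (y3 : ℤ), (y4 : ℤ)) : ℚ) : ℂ) / (q : ℂ) ^ 2)

/-- The order of the stabilizer of `x` in `SL₂(ℤ)`. -/
noncomputable def stabCard (x : BCF) : ℕ :=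
  Nat.card {γ : Matrix (Fin 2) (Fin 2) ℤ // γ.det = 1 ∧ act γ x = x}

end BCF

noncomputable section
namespace DW

/-- dual form `(a, 3·b, 3·c, d)` -/
@[ext] structure CF where
  a : ℤ
  b : ℤ
  c : ℤ
  d : ℤ

namespace CF

def act (p q r s : ℤ) (w : CF) : CF where
  a := w.a*p^3 + 3*w.b*p^2*q + 3*w.c*p*q^2 + w.d*q^3
  b := w.a*p^2*r + w.b*(p^2*s+2*p*q*r) + w.c*(2*p*q*s+q^2*r) + w.d*q^2*s
  c := w.a*p*r^2 + w.b*(2*p*r*s+q*r^2) + w.c*(p*s^2+2*q*r*s) + w.d*q*s^2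
  d := w.a*r^3 + 3*w.b*r^2*s + 3*w.c*r*s^2 + w.d*s^3

def hA (w : CF) : ℤ := w.b^2 - w.a*w.c
def hB (w : CF) : ℤ := w.b*w.c - w.a*w.d
def hC (w : CF) : ℤ := w.c^2 - w.b*w.d
def Δ (w : CF) : ℤ := w.hB^2 - 4*w.hA*w.hC

def Eqv (w w' : CF) : Prop := ∃ p q r s : ℤ, p*s-q*r = 1 ∧ act p q r s w = w'

lemma act_one (w : CF) : act 1 0 0 1 w = w := by
  ext <;> simp [act]

lemma act_act (p q r s p' q' r' s' : ℤ) (w : CF) :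
    act p q r s (act p' q' r' s' w) =
      act (p*p'+q*r') (p*q'+q*s') (r*p'+s*r') (r*q'+s*s') w := by
  ext <;> simp only [act] <;> ring

lemma Eqv.refl (w : CF) : Eqv w w := ⟨1,0,0,1, by norm_num, act_one w⟩

lemma Eqv.symm {w w' : CF} (h : Eqv w w') : Eqv w' w := by
  obtain ⟨p,q,r,s,h1,rfl⟩ := h
  refine ⟨s,-q,-r,p, by linarith, ?_⟩
  rw [act_act]
  have e1 : s*p + -q*r = 1 := by linarith
  have e2 : s*q + -q*s = 0 := by ring
  have e3 : -r*p+p*r = 0 := by ring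
  have e4 : -r*q+p*s = 1 := by linarith
  rw [e1,e2,e3,e4, act_one]

lemma Eqv.trans {w w' w'' : CF} (h : Eqv w w') (h' : Eqv w' w'') : Eqv w w'' := by
  obtain ⟨p,q,r,s,h1,rfl⟩ := h
  obtain ⟨p',q',r',s',h1',rfl⟩ := h'
  refine ⟨_,_,_,_,?_,(act_act ..).symm⟩
  linear_combination (p' * s' - q' * r')*h1 + h1'

lemma hA_act (p q r s : ℤ) (w : CF) : (act p q r s w).hA =
    (p*s-q*r)^2*(w.hA*p^2+w.hB*p*q+w.hC*q^2) := by
  simp only [act, hA, hB, hC]; ring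
lemma hB_act (p q r s : ℤ) (w : CF) : (act p q r s w).hB =
    (p*s-q*r)^2*(2*w.hA*p*r+w.hB*(p*s+q*r)+2*w.hC*q*s) := by
  simp only [act, hA, hB, hC]; ring
lemma hC_act (p q r s : ℤ) (w : CF) : (act p q r s w).hC =
    (p*s-q*r)^2*(w.hA*r^2+w.hB*r*s+w.hC*s^2) := by
  simp only [act, hA, hB, hC]; ring
lemma Δ_act (p q r s : ℤ) (w : CF) : (act p q r s w).Δ = (p*s-q*r)^6*w.Δ := by
  simp only [Δ, hA_act, hB_act, hC_act]; ring

lemma Eqv.Δ_eq {w w' : CF} (h : Eqv w w') : w'.Δ = w.Δ := by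
  obtain ⟨p,q,r,s,h1,rfl⟩ := h
  rw [Δ_act, h1]; ring

/-- content divisibility -/
def dvdW (m : ℤ) (w : CF) : Prop := m ∣ w.a ∧ m ∣ w.b ∧ m ∣ w.c ∧ m ∣ w.d
def dvdH (m : ℤ) (w : CF) : Prop := m ∣ w.hA ∧ m ∣ w.hB ∧ m ∣ w.hC

lemma dvdW_act {m : ℤ} {w : CF} (h : dvdW m w) (p q r s : ℤ) : dvdW m (act p q r s w) := by
  obtain ⟨⟨a,ha⟩,⟨b,hb⟩,⟨c,hc⟩,⟨d,hd⟩⟩ := h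
  have : act p q r s w = act p q r s ⟨m*a,m*b,m*c,m*d⟩ := by
    congr 1; ext <;> assumption
  rw [this]
  refine ⟨⟨(act p q r s ⟨a,b,c,d⟩).a, ?_⟩, ⟨(act p q r s ⟨a,b,c,d⟩).b, ?_⟩,
    ⟨(act p q r s ⟨a,b,c,d⟩).c, ?_⟩, ⟨(act p q r s ⟨a,b,c,d⟩).d, ?_⟩⟩ <;>
  simp only [act] <;> ring

lemma dvdH_act {m : ℤ} {w : CF} (h : dvdH m w) (p q r s : ℤ) : dvdH m (act p q r s w) := by
  obtain ⟨⟨a,ha⟩,⟨b,hb⟩,⟨c,hc⟩⟩ := h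
  refine ⟨?_, ?_, ?_⟩
  · rw [hA_act, ha, hb, hc]
    exact ⟨(p*s-q*r)^2*(a*p^2+b*p*q+c*q^2), by ring⟩
  · rw [hB_act, ha, hb, hc]
    exact ⟨(p*s-q*r)^2*(2*a*p*r+b*(p*s+q*r)+2*c*q*s), by ring⟩
  · rw [hC_act, ha, hb, hc]
    exact ⟨(p*s-q*r)^2*(a*r^2+b*r*s+c*s^2), by ring⟩

lemma Eqv.dvdW_iff {w w' : CF} (h : Eqv w w') (m : ℤ) : dvdW m w ↔ dvdW m w' := by
  constructor
  · obtain ⟨p,q,r,s,h1,rfl⟩ := h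
    intro h; exact dvdW_act h ..
  · obtain ⟨p,q,r,s,h1,rfl⟩ := h.symm
    intro h; exact dvdW_act h ..

lemma Eqv.dvdH_iff {w w' : CF} (h : Eqv w w') (m : ℤ) : dvdH m w ↔ dvdH m w' := by
  constructor
  · obtain ⟨p,q,r,s,h1,rfl⟩ := h
    intro h; exact dvdH_act h ..
  · obtain ⟨p,q,r,s,h1,rfl⟩ := h.symm
    intro h; exact dvdH_act h ..

/-- pairwise inequivalent -/
def Ineq (S : Finset CF) : Prop := ∀ x ∈ S, ∀ y ∈ S, Eqv x y → x = y

lemma Ineq.mono {S T : Finset CF} (h : Ineq S) (hT : T ⊆ S) : Ineq T :=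
  fun x hx y hy e => h x (hT hx) y (hT hy) e

/-- transport along a class-injective map -/
lemma Ineq.image {S : Finset CF} (hS : Ineq S) (φ : CF → CF)
    (hφ : ∀ x ∈ S, ∀ y ∈ S, Eqv (φ x) (φ y) → Eqv x y) :
    Ineq (S.image φ) ∧ Set.InjOn φ (S : Set CF) := by
  constructor
  · intro x hx y hy e
    simp only [Finset.mem_image] at hx hy
    obtain ⟨x', hx', rfl⟩ := hx
    obtain ⟨y', hy', rfl⟩ := hy
    rw [hS x' hx' y' hy' (hφ x' hx' y' hy' e)]
  · intro x hx y hy e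
    exact hS x hx y hy (hφ x hx y hy (by rw [e]; exact Eqv.refl _))

lemma Ineq.sum_le {S : Finset CF} (hS : Ineq S) (φ : CF → CF)
    (hφ : ∀ x ∈ S, ∀ y ∈ S, Eqv (φ x) (φ y) → Eqv x y) (f f' : CF → ℝ)
    (hf : ∀ x ∈ S, f x ≤ f' (φ x)) :
    ∑ x ∈ S, f x ≤ ∑ x ∈ S.image φ, f' x := by
  rw [Finset.sum_image (hS.image φ hφ).2]
  exact Finset.sum_le_sum hf

/-- replacing by representatives -/
lemma Ineq.reps {S : Finset CF} (hS : Ineq S) (φ : CF → CF)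
    (hφ : ∀ x ∈ S, Eqv x (φ x)) :
    Ineq (S.image φ) ∧ Set.InjOn φ (S : Set CF) :=
  hS.image φ fun x hx y hy e => (hφ x hx).trans (e.trans (hφ y hy).symm)

end CF
end DW
end

noncomputable section
namespace DW
namespace CF

lemma syz1 (w : CF) : w.a*w.hC - w.b*w.hB + w.c*w.hA = 0 := by simp only [hA,hB,hC]; ring
lemma syz2 (w : CF) : w.b*w.hC - w.c*w.hB + w.d*w.hA = 0 := by simp only [hA,hB,hC]; ring
lemma syzQ (w : CF) : (2*w.b*w.hA - w.a*w.hB)^2 - w.Δ*w.a^2 = 4*w.hA^3 := by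
  simp only [hA,hB,hC,Δ]; ring

lemma exists_hA_ne (w : CF) (h : w.Δ ≠ 0) : ∃ w', Eqv w w' ∧ w'.hA ≠ 0 := by
  by_cases hA0 : w.hA = 0
  · by_cases hC0 : w.hC = 0
    · refine ⟨act 1 1 0 1 w, ⟨1,1,0,1, by norm_num, rfl⟩, ?_⟩
      rw [hA_act]
      intro h0
      apply h
      have : w.hB = 0 := by rw [hA0, hC0] at h0; linarith
      simp [Δ, this, hA0]
    · refine ⟨act 0 1 (-1) 0 w, ⟨0,1,-1,0, by norm_num, rfl⟩, ?_⟩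
      rw [hA_act]
      simpa using hC0
  · exact ⟨w, Eqv.refl w, hA0⟩

lemma red_neg (w : CF) (h : w.Δ < 0) : ∃ w', Eqv w w' ∧ w'.a^4 ≤ 65536*|w.Δ| ∧
    w'.hA^2 ≤ 65536*|w.Δ| := by
  -- minimal |hA|
  have hex : ∃ n : ℕ, ∃ w', Eqv w w' ∧ w'.hA.natAbs = n := ⟨_, w, Eqv.refl w, rfl⟩
  obtain ⟨w1, he1, hn⟩ := Nat.find_spec hex
  have hmin : ∀ w', Eqv w w' → |w1.hA| ≤ |w'.hA| := by
    intro w' hw'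
    have := Nat.find_min' hex ⟨w', hw', rfl⟩
    rw [← hn] at this
    rw [Int.abs_eq_natAbs, Int.abs_eq_natAbs]
    exact_mod_cast this
  have hΔ1 := he1.Δ_eq
  have hA1 : w1.hA ≠ 0 := by
    intro h0
    have : w1.Δ = w1.hB^2 := by simp [Δ, h0]
    nlinarith [sq_nonneg w1.hB]
  -- translate
  obtain ⟨r, hr⟩ : ∃ r : ℤ, |w1.hB + 2*w1.hA*r| ≤ |w1.hA| := by
    have h2 : (0:ℤ) < 2*|w1.hA| := by positivity
    have key := Int.emod_nonneg (w1.hB + |w1.hA|) h2.ne'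
    have key2 := Int.emod_lt_of_pos (w1.hB + |w1.hA|) h2
    have key3 := Int.emod_add_mul_ediv (w1.hB + |w1.hA|) (2*|w1.hA|)
    rcases abs_choice w1.hA with h' | h'
    · refine ⟨-((w1.hB + |w1.hA|)/(2*|w1.hA|)), ?_⟩
      rw [abs_le]
      generalize (w1.hB + |w1.hA|)/(2*|w1.hA|) = k at *
      generalize (w1.hB + |w1.hA|)%(2*|w1.hA|) = e at *
      rw [h'] at *
      constructor <;> nlinarith
    · refine ⟨((w1.hB + |w1.hA|)/(2*|w1.hA|)), ?_⟩
      rw [abs_le]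
      generalize (w1.hB + |w1.hA|)/(2*|w1.hA|) = k at *
      generalize (w1.hB + |w1.hA|)%(2*|w1.hA|) = e at *
      rw [h'] at *
      constructor <;> nlinarith
  set w2 := act 1 0 r 1 w1 with hw2
  have he2 : Eqv w w2 := he1.trans ⟨1,0,r,1, by norm_num, rfl⟩
  have hA2 : w2.hA = w1.hA := by rw [hw2, hA_act]; ring
  have hB2 : w2.hB = w1.hB + 2*w1.hA*r := by rw [hw2, hB_act]; ring
  have hC2 : |w2.hA| ≤ |w2.hC| := by
    have := hmin (act 0 1 (-1) 0 w2) (he2.trans ⟨0,1,-1,0, by norm_num, rfl⟩)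
    rw [hA_act] at this
    rw [hA2]; simpa using this
  rw [← hB2, ← hA2] at hr
  rw [← hA2] at hA1
  have hΔ2 := he2.Δ_eq
  have hD : w2.Δ = w2.hB^2 - 4*w2.hA*w2.hC := rfl
  have hQ := w2.syzQ
  refine ⟨w2, he2, ?_⟩
  rw [← hΔ2, abs_of_neg (by omega)]
  set A := w2.hA
  set B := w2.hB
  set C := w2.hC
  have hBA : B^2 ≤ A^2 := sq_le_sq.mpr hr
  have hpos : 0 < A*C := by nlinarith [sq_nonneg B]
  have hAC : A^2 ≤ A*C := by
    rw [← abs_of_pos hpos, abs_mul, ← sq_abs, sq]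
    exact mul_le_mul_of_nonneg_left hC2 (abs_nonneg _)
  have h3 : 3*A^2 ≤ -w2.Δ := by nlinarith
  have ha : w2.a^2 * (-w2.Δ) ≤ 4*A^3 := by nlinarith [sq_nonneg (2*w2.b*A - w2.a*B)]
  have hX : 0 < -w2.Δ := by omega
  set X := -w2.Δ
  constructor
  · have h0 : 0 ≤ w2.a^2 * X := by positivity
    have h1 : (w2.a^2*X)^2 ≤ (4*A^3)^2 := by gcongr
    have h2 : (3*A^2)^3 ≤ X^3 := by gcongr
    have h5 : w2.a^4 * X^2 ≤ X * X^2 := by nlinarith [pow_pos hX 3]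
    have := le_of_mul_le_mul_right h5 (by positivity)
    linarith
  · nlinarith [sq_nonneg A]

/-- Minkowski-type lemma through Dirichlet approximation. -/
lemma small_vec_aux (l1 m1 l2 m2 W : ℝ) (hW : 0 < W) (hd : |l1*m2-l2*m1| = W^2)
    (hl : |l2| ≤ |l1|) :
    ∃ p q : ℤ, IsCoprime p q ∧ |l1*p+m1*q| ≤ 2*W ∧ |l2*p+m2*q| ≤ 2*W := by
  by_cases hs : |l1| < W
  · refine ⟨1, 0, isCoprime_one_left, ?_, ?_⟩
    · simp; linarith
    · simp; linarith
  push Not at hs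
  have hl1 : 0 < |l1| := lt_of_lt_of_le hW hs
  have hl1' : l1 ≠ 0 := by simpa using hl1
  set n := ⌊|l1|/W⌋₊ with hn
  have hn1 : 0 < n := by
    rw [hn, Nat.floor_pos]; rw [le_div_iff₀ hW]; linarith
  obtain ⟨j, k, hk0, hkn, hjk⟩ := Real.exists_int_int_abs_mul_sub_le (-m1/l1) hn1
  have b1 : |l1*j+m1*k| ≤ W := by
    have : l1*j+m1*k = -l1*(k*(-m1/l1) - j) := by field_simp; ring
    rw [this, abs_mul, abs_neg]
    have hn2 : |l1|/W < n+1 := Nat.lt_floor_add_one _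
    calc |l1| * |(k*(-m1/l1) - j:ℝ)| ≤ |l1| * (1/(n+1)) := by gcongr
      _ ≤ W := by
        rw [div_lt_iff₀ hW] at hn2
        rw [mul_one_div, div_le_iff₀ (by positivity)]
        linarith
  have hnW : (n:ℝ)*W ≤ |l1| := by
    have := Nat.floor_le (show 0 ≤ |l1|/W by positivity)
    rw [le_div_iff₀ hW] at this
    exact this
  have hkn' : (k:ℝ) ≤ n := by exact_mod_cast hkn
  have hk0' : (0:ℝ) < k := by exact_mod_cast hk0
  have b2 : |l2*j+m2*k| ≤ 2*W := by
    have : l2*j+m2*k = (l2/l1)*(l1*j+m1*k) + k*((l1*m2-l2*m1)/l1) := by field_simp; ring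
    rw [this]
    refine (abs_add_le _ _).trans ?_
    rw [abs_mul, abs_mul, abs_div, abs_div, hd, abs_of_pos hk0']
    have e1 : |l2|/|l1| ≤ 1 := by rw [div_le_one hl1]; exact hl
    have e2 : |l2|/|l1| * |l1*j+m1*k| ≤ 1 * W := by gcongr
    have e3 : (k:ℝ) * (W^2/|l1|) ≤ W := by
      rw [mul_div_assoc', div_le_iff₀ hl1]
      nlinarith
    linarith
  -- divide by gcd
  have hg : 0 < Int.gcd j k := Int.gcd_pos_of_ne_zero_right _ hk0.ne'
  obtain ⟨p, hp⟩ := Int.gcd_dvd_left (a := j) (b := k)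
  obtain ⟨q, hq⟩ := Int.gcd_dvd_right (a := j) (b := k)
  set g := Int.gcd j k with hgdef
  have hg' : (1:ℝ) ≤ (g:ℝ) := by exact_mod_cast hg
  have cop : IsCoprime p q := by
    rw [Int.isCoprime_iff_gcd_eq_one]
    have : Int.gcd j k = g * Int.gcd p q := by
      conv_lhs => rw [hp, hq]
      rw [Int.gcd_mul_left]; simp
    rw [← hgdef] at this
    have h2 : g * 1 = g * Int.gcd p q := by omega
    exact (Nat.eq_of_mul_eq_mul_left hg h2).symm
  have hpr : (j:ℝ) = g * p := by exact_mod_cast hp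
  have hqr : (k:ℝ) = g * q := by exact_mod_cast hq
  have gen : ∀ l m : ℝ, |l*j+m*k| ≤ 2*W → |l*p+m*q| ≤ 2*W := by
    intro l m h
    have : l*j+m*k = g*(l*p+m*q) := by rw [hpr, hqr]; ring
    rw [this, abs_mul, abs_of_nonneg (by positivity)] at h
    nlinarith [abs_nonneg (l*p+m*q)]
  exact ⟨p, q, cop, gen _ _ (by linarith), gen _ _ b2⟩

lemma small_vec (l1 m1 l2 m2 W : ℝ) (hW : 0 < W) (hd : |l1*m2-l2*m1| = W^2) :
    ∃ p q : ℤ, IsCoprime p q ∧ |l1*p+m1*q| ≤ 2*W ∧ |l2*p+m2*q| ≤ 2*W := by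
  rcases le_total |l2| |l1| with h | h
  · exact small_vec_aux _ _ _ _ _ hW hd h
  · obtain ⟨p,q,h1,h2,h3⟩ := small_vec_aux l2 m2 l1 m1 W hW (by rw [← hd, ← abs_neg]; ring_nf) h
    exact ⟨p,q,h1,h3,h2⟩

lemma exists_cbrt (k : ℝ) : ∃ l : ℝ, l^3 = k := by
  rcases le_total 0 k with h | h
  · exact ⟨k^((1:ℝ)/3), by rw [← Real.rpow_natCast, ← Real.rpow_mul h]; norm_num⟩
  · refine ⟨-((-k)^((1:ℝ)/3)), ?_⟩
    have : ((-k)^((1:ℝ)/3))^3 = -k := by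
      rw [← Real.rpow_natCast, ← Real.rpow_mul (by linarith)]; norm_num
    rw [Odd.neg_pow (by decide), this]; ring

set_option maxHeartbeats 1000000 in
lemma red_pos (w : CF) (h : 0 < w.Δ) : ∃ w', Eqv w w' ∧ w'.a^4 ≤ 65536*|w.Δ| ∧
    w'.hA^2 ≤ 65536*|w.Δ| := by
  obtain ⟨w1, he1, hA0⟩ := exists_hA_ne w h.ne'
  have hΔ := he1.Δ_eq
  rw [← hΔ] at h ⊢
  suffices H : ∃ w', Eqv w1 w' ∧ w'.a^4 ≤ 65536*|w1.Δ| ∧ w'.hA^2 ≤ 65536*|w1.Δ| by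
    obtain ⟨w', e, h1⟩ := H
    exact ⟨w', he1.trans e, h1⟩
  have z1 := w1.syz1
  have z2 := w1.syz2
  have hAd : w1.hA = w1.b^2 - w1.a*w1.c := rfl
  have hDd : w1.Δ = w1.hB^2 - 4*w1.hA*w1.hC := rfl
  have z1r : (w1.a:ℝ)*w1.hC - w1.b*w1.hB + w1.c*w1.hA = 0 := by exact_mod_cast z1
  have z2r : (w1.b:ℝ)*w1.hC - w1.c*w1.hB + w1.d*w1.hA = 0 := by exact_mod_cast z2
  have hA0r : (w1.hA : ℝ) ≠ 0 := by exact_mod_cast hA0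
  have hX0 : (0:ℝ) < w1.Δ := by exact_mod_cast h
  set a : ℝ := (w1.a:ℝ) with ha
  set b : ℝ := (w1.b:ℝ) with hb
  set c : ℝ := (w1.c:ℝ) with hc
  set d : ℝ := (w1.d:ℝ) with hd
  set A : ℝ := (w1.hA:ℝ) with hAdef
  set B : ℝ := (w1.hB:ℝ) with hBdef
  set C : ℝ := (w1.hC:ℝ) with hCdef
  have hAr : A = b^2 - a*c := by rw [hAdef, hAd]; push_cast; rfl
  set X : ℝ := (w1.Δ:ℝ) with hX
  have hDr : X = B^2 - 4*A*C := by rw [hX, hDd]; push_cast; rfl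
  obtain ⟨s, hs0, hs⟩ : ∃ s : ℝ, 0 < s ∧ s^2 = X := ⟨√X, by positivity, Real.sq_sqrt hX0.le⟩
  obtain ⟨t1, ht1⟩ : ∃ t1, t1 = (-B+s)/(2*A) := ⟨_, rfl⟩
  obtain ⟨t2, ht2⟩ : ∃ t2, t2 = (-B-s)/(2*A) := ⟨_, rfl⟩
  have hB2 : B = -A*(t1+t2) := by rw [ht1, ht2]; field_simp; ring
  have hC2 : C = A*(t1*t2) := by
    rw [ht1, ht2]; field_simp; linear_combination hs + hDr
  have hs2 : s = A*(t1-t2) := by rw [ht1, ht2]; field_simp; ring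
  have ht : t1 - t2 ≠ 0 := by
    intro h0; rw [h0] at hs2; simp at hs2; linarith
  obtain ⟨k1, hk1⟩ : ∃ k1, k1 = -(b+a*t2)/(t1-t2) := ⟨_, rfl⟩
  obtain ⟨k2, hk2⟩ : ∃ k2, k2 = (b+a*t1)/(t1-t2) := ⟨_, rfl⟩
  have ea : a = k1+k2 := by rw [hk1, hk2]; field_simp; ring
  have eb : b = -(k1*t1+k2*t2) := by rw [hk1, hk2]; field_simp; ring
  have ec : c = k1*t1^2+k2*t2^2 := by
    have : A*c = A*(k1*t1^2+k2*t2^2) := by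
      have : A*c = b*B - a*C := by linarith
      rw [this, hB2, hC2, ea, eb]; ring
    exact mul_left_cancel₀ hA0r this
  have ed : d = -(k1*t1^3+k2*t2^3) := by
    have : A*d = A*(-(k1*t1^3+k2*t2^3)) := by
      have : A*d = c*B - b*C := by linarith
      rw [this, hB2, hC2, ec, eb]; ring
    exact mul_left_cancel₀ hA0r this
  have eA : A = -(k1*k2*(t1-t2)^2) := by rw [hAr, ea, eb, ec]; ring
  obtain ⟨l1, hl1⟩ := exists_cbrt k1
  obtain ⟨l2, hl2⟩ := exists_cbrt k2
  obtain ⟨V, hV⟩ : ∃ V, V = l1*l2*(t1-t2) := ⟨_, rfl⟩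
  have hXV : X = V^6 := by
    rw [← hs, hs2, eA, ← hl1, ← hl2, hV]; ring
  have hV0 : V ≠ 0 := by intro h0; rw [h0] at hXV; norm_num at hXV; linarith
  have hV1 : 0 < |V| := abs_pos.mpr hV0
  obtain ⟨W, hW0, hW⟩ : ∃ W : ℝ, 0 < W ∧ W^2 = |V| := ⟨√|V|, by positivity, Real.sq_sqrt hV1.le⟩
  obtain ⟨p, q, hpq, hp1, hp2⟩ := small_vec l1 (-l1*t1) l2 (-l2*t2) W hW0 (by
    rw [hW, hV]; congr 1; ring)
  obtain ⟨s', r', hrs⟩ := hpq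
  refine ⟨act p q (-r') s' w1, ⟨p, q, -r', s', by linarith, rfl⟩, ?_⟩
  set L1 := l1*p + -l1*t1*q with hL1
  set L2 := l2*p + -l2*t2*q with hL2
  have hXW : X = W^12 := by
    rw [hXV, show W^12 = (W^2)^6 by ring, hW]; exact (Even.pow_abs (by decide) V).symm
  have eaa : ((act p q (-r') s' w1).a : ℝ) = L1^3+L2^3 := by
    simp only [act]; push_cast
    rw [← ha, ← hb, ← hc, ← hd, ea, eb, ec, ed, ← hl1, ← hl2]; ring
  have eAA : ((act p q (-r') s' w1).hA : ℝ) = -(L1*L2*V^2) := by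
    rw [hA_act, show p*s'-q*(-r') = 1 by linarith]; push_cast
    rw [← hAdef, ← hBdef, ← hCdef, hB2, hC2, eA, ← hl1, ← hl2, hV]; ring
  have absX : (|w1.Δ| : ℝ) = X := by rw [abs_of_pos hX0]
  constructor
  · have : (((act p q (-r') s' w1).a : ℝ))^4 ≤ 65536*|(w1.Δ:ℝ)| := by
      rw [absX, eaa, hXW]
      have h3 : |L1^3+L2^3| ≤ 16*W^3 := by
        refine (abs_add_le _ _).trans ?_
        rw [abs_pow, abs_pow]
        have e1 := pow_le_pow_left₀ (abs_nonneg L1) hp1 3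
        have e2 := pow_le_pow_left₀ (abs_nonneg L2) hp2 3
        calc |L1|^3+|L2|^3 ≤ (2*W)^3+(2*W)^3 := add_le_add e1 e2
          _ = 16*W^3 := by ring
      have := pow_le_pow_left₀ (abs_nonneg _) h3 4
      rw [Even.pow_abs (by decide)] at this
      exact this.trans_eq (by ring)
    exact_mod_cast this
  · have : (((act p q (-r') s' w1).hA : ℝ))^2 ≤ 65536*|(w1.Δ:ℝ)| := by
      rw [absX, eAA, hXW]
      have h1 : L1^2 ≤ (2*W)^2 := sq_le_sq' (by linarith [abs_le.mp hp1]) (abs_le.mp hp1).2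
      have h2 : L2^2 ≤ (2*W)^2 := sq_le_sq' (by linarith [abs_le.mp hp2]) (abs_le.mp hp2).2
      have h3 : L1^2*L2^2 ≤ (2*W)^2*(2*W)^2 := by gcongr
      have h4 : V^4 = W^8 := by
        rw [show W^8 = (W^2)^4 by ring, hW]; exact (Even.pow_abs (by decide) V).symm
      calc (-(L1*L2*V^2))^2 = (L1^2*L2^2)*V^4 := by ring
        _ ≤ ((2*W)^2*(2*W)^2)*V^4 := by gcongr
        _ = 16*W^12 := by rw [h4]; ring
        _ ≤ _ := by have := pow_pos hW0 12; linarith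
    exact_mod_cast this

lemma red (w : CF) (h : w.Δ ≠ 0) : ∃ w', Eqv w w' ∧ w'.a^4 ≤ 65536*|w.Δ| ∧
    w'.hA^2 ≤ 65536*|w.Δ| := by
  rcases lt_or_gt_of_ne h with h | h
  · exact red_neg w h
  · exact red_pos w h

/-- full reduction -/
def Red (w : CF) : Prop := w.a^4 ≤ 65536*|w.Δ| ∧ w.hA^2 ≤ 65536*|w.Δ| ∧
  (w.a ≠ 0 → 0 ≤ w.b ∧ w.b < |w.a|) ∧ (w.a = 0 → w.b ≠ 0 ∧ 0 ≤ w.c ∧ w.c < 2*|w.b|)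

lemma exists_mod (x m : ℤ) (hm : m ≠ 0) : ∃ r, 0 ≤ x + m*r ∧ x + m*r < |m| := by
  refine ⟨-(x/m), ?_, ?_⟩
  · have := Int.emod_nonneg x hm
    have := Int.emod_add_mul_ediv x m
    linarith
  · have := Int.emod_lt_abs x hm
    have := Int.emod_add_mul_ediv x m
    linarith

lemma exists_Red (w : CF) (h : w.Δ ≠ 0) : ∃ w', Eqv w w' ∧ Red w' := by
  obtain ⟨w1, he, h1, h2⟩ := red w h
  rw [← he.Δ_eq] at h1 h2 h
  have key : ∀ r, Eqv w (act 1 0 r 1 w1) := fun r => he.trans ⟨1,0,r,1, by norm_num, rfl⟩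
  have ka : ∀ r, (act 1 0 r 1 w1).a = w1.a := fun r => by simp [act]
  have kA : ∀ r, (act 1 0 r 1 w1).hA = w1.hA := fun r => by rw [hA_act]; ring
  have kD : ∀ r, (act 1 0 r 1 w1).Δ = w1.Δ := fun r => by rw [Δ_act]; ring
  by_cases ha : w1.a = 0
  · have hb : w1.b ≠ 0 := by
      intro hb; apply h; simp [Δ, hA, hB, hC, ha, hb]
    obtain ⟨r, hr1, hr2⟩ := exists_mod w1.c (2*w1.b) (by simpa using hb)
    refine ⟨act 1 0 r 1 w1, key r, by rw [ka, kD]; exact h1, by rw [kA, kD]; exact h2, ?_, ?_⟩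
    · rw [ka]; intro h0; exact absurd ha h0
    · intro _
      have e1 : (act 1 0 r 1 w1).b = w1.b := by simp [act, ha]
      have e2 : (act 1 0 r 1 w1).c = w1.c + 2*w1.b*r := by simp [act, ha]; ring
      rw [e1, e2]
      refine ⟨hb, hr1, ?_⟩
      rwa [abs_mul, abs_of_pos (by norm_num : (0:ℤ) < 2)] at hr2
  · obtain ⟨r, hr1, hr2⟩ := exists_mod w1.b (w1.a) ha
    refine ⟨act 1 0 r 1 w1, key r, by rw [ka, kD]; exact h1, by rw [kA, kD]; exact h2, ?_, ?_⟩
    · intro _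
      have e1 : (act 1 0 r 1 w1).b = w1.b+w1.a*r := by simp [act]; ring
      rw [ka, e1]; exact ⟨hr1, hr2⟩
    · rw [ka]; intro h0; exact absurd h0 ha

end CF
end DW
end

noncomputable section
namespace DW

lemma card_le_fib {α β : Type*} (S : Finset α) (f : α → β) (t : Finset β) (g : β → ℝ)
    (hm : ∀ x ∈ S, f x ∈ t) (hg : ∀ i ∈ t, ∀ F : Finset α, F ⊆ S →
      (∀ x ∈ F, f x = i) → (F.card : ℝ) ≤ g i) :
    (S.card : ℝ) ≤ ∑ i ∈ t, g i := by
  rw [Finset.card_eq_sum_card_fiberwise (f := f) (t := t) (fun x hx => hm x hx)]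
  push_cast
  exact Finset.sum_le_sum fun i hi => hg i hi _ (Finset.filter_subset _ _)
    fun x hx => (Finset.mem_filter.mp hx).2

lemma card_le_of_diff (D : Finset ℤ) (L : ℝ) (hL : 0 ≤ L)
    (h : ∀ x ∈ D, ∀ y ∈ D, x ≤ y → ((y:ℝ) - x) ≤ L) : (D.card : ℝ) ≤ 1 + L := by
  rcases D.eq_empty_or_nonempty with rfl | hne
  · simp; linarith
  · have hsub : D ⊆ Finset.Icc (D.min' hne) (D.max' hne) := fun x hx =>
      Finset.mem_Icc.mpr ⟨D.min'_le x hx, D.le_max' x hx⟩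
    have h1 := Finset.card_le_card hsub
    rw [Int.card_Icc] at h1
    have hle : D.min' hne ≤ D.max' hne := D.min'_le_max' hne
    have h2 := h _ (D.min'_mem hne) _ (D.max'_mem hne) hle
    have h3 : ((D.card:ℤ)) ≤ D.max' hne + 1 - D.min' hne := by omega
    have h4 : ((D.card:ℝ)) ≤ D.max' hne + 1 - D.min' hne := by exact_mod_cast h3
    linarith

lemma spread (v1 v2 E T : ℝ) (h0 : 0 ≤ v1) (h12 : v1 ≤ v2) (h1 : |v1^2-E| ≤ T)
    (h2 : |v2^2-E| ≤ T) : (v2-v1)^2 ≤ 2*T ∧ (v2-v1)^4*|E| ≤ 6*T^3 := by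
  obtain ⟨h1a, h1b⟩ := abs_le.mp h1
  obtain ⟨h2a, h2b⟩ := abs_le.mp h2
  have hT : 0 ≤ T := (abs_nonneg _).trans h1
  obtain ⟨s, hs⟩ : ∃ s, s = v2 - v1 := ⟨_, rfl⟩
  obtain ⟨R, hR⟩ : ∃ R, R = v2 + v1 := ⟨_, rfl⟩
  have hs0 : 0 ≤ s := by linarith
  have hsR : s ≤ R := by linarith
  have hprod : s*R ≤ 2*T := by rw [hs, hR]; nlinarith
  have hsq : s^2 ≤ 2*T := by nlinarith
  rw [← hs]
  refine ⟨hsq, ?_⟩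
  have h4 : s^4 ≤ 4*T^2 := by
    have := pow_le_pow_left₀ (sq_nonneg s) hsq 2
    nlinarith
  rcases le_total 0 E with hE | hE
  · rw [abs_of_nonneg hE]
    have hE2 : E ≤ R^2/4 + T := by nlinarith
    have h5 : (s*R)^2 ≤ (2*T)^2 := pow_le_pow_left₀ (by nlinarith) hprod 2
    have h6 : s^4*E ≤ s^4*(R^2/4+T) := by gcongr
    have h7 : s^2*(s*R)^2 ≤ (2*T)*(2*T)^2 := by gcongr
    have h8 : s^4*T ≤ 4*T^2*T := by gcongr
    nlinarith
  · rw [abs_of_nonpos hE]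
    have : -E ≤ T := by nlinarith
    have h6 : s^4*(-E) ≤ (4*T^2)*T := by gcongr; linarith
    nlinarith [pow_nonneg hT 3]

lemma dcount (D : Finset ℤ) (m k E T L : ℝ) (hm : 0 < m) (hL : 0 ≤ L)
    (h : ∀ d ∈ D, |(m*d+k)^2-E| ≤ T)
    (hs : ∀ s : ℝ, 0 ≤ s → s^2 ≤ 2*T → s^4*|E| ≤ 6*T^3 → s ≤ m*L) :
    (D.card : ℝ) ≤ 2 + 2*L := by
  have key : ∀ D' : Finset ℤ, D' ⊆ D →
      ((∀ d ∈ D', 0 ≤ m*d+k) ∨ (∀ d ∈ D', m*d+k ≤ 0)) → (D'.card : ℝ) ≤ 1 + L := by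
    intro D' hD' hsg
    apply card_le_of_diff D' L hL
    intro x hx y hy hxy
    have hxy' : (x:ℝ) ≤ y := by exact_mod_cast hxy
    have hmxy : m*x ≤ m*y := by gcongr
    have : m*y - m*x ≤ m*L := by
      rcases hsg with hsg | hsg
      · have := spread (m*x+k) (m*y+k) E T (hsg x hx) (by linarith) (h x (hD' hx)) (h y (hD' hy))
        rw [show m*y+k-(m*x+k) = m*y - m*x by ring] at this
        exact hs _ (by linarith) this.1 this.2
      · have := spread (-(m*y+k)) (-(m*x+k)) E T (by linarith [hsg y hy]) (by linarith)
          (by rw [neg_sq]; exact h y (hD' hy)) (by rw [neg_sq]; exact h x (hD' hx))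
        rw [show -(m*x+k)-(-(m*y+k)) = m*y - m*x by ring] at this
        exact hs _ (by linarith) this.1 this.2
    nlinarith
  have h1 := key (D.filter (fun d => 0 ≤ m*d+k)) (Finset.filter_subset _ _)
    (Or.inl fun d hd => (Finset.mem_filter.mp hd).2)
  have h2 := key (D.filter (fun d => ¬ 0 ≤ m*d+k)) (Finset.filter_subset _ _)
    (Or.inr fun d hd => by have := (Finset.mem_filter.mp hd).2; linarith)
  have h3 := Finset.card_filter_add_card_filter_not (s := D) (fun d : ℤ => 0 ≤ m*d+k)
  have h4 : ((D.filter (fun d : ℤ => 0 ≤ m*d+k)).card : ℝ) +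
    (D.filter (fun d : ℤ => ¬ 0 ≤ m*d+k)).card = D.card := by exact_mod_cast h3
  linarith

lemma sum_inv_sqrt (N : ℕ) : ∑ n ∈ Finset.Icc 1 N, 1/√(n:ℝ) ≤ 2*√(N:ℝ) := by
  induction N with
  | zero => simp
  | succ N ih =>
    rw [Finset.sum_Icc_succ_top (by omega)]
    have h1 : (√((N+1:ℕ):ℝ))^2 = N+1 := by rw [Real.sq_sqrt (by positivity)]; push_cast; ring
    have h2 : (√(N:ℝ))^2 = N := Real.sq_sqrt (by positivity)
    have h3 : 0 < √((N+1:ℕ):ℝ) := by positivity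
    have h4 : 0 ≤ √(N:ℝ) := by positivity
    set x := √((N+1:ℕ):ℝ)
    set y := √(N:ℝ)
    have : 1/x ≤ 2*(x-y) := by
      rw [div_le_iff₀ h3]; nlinarith [sq_nonneg (x-y)]
    linarith

lemma sum_inv_qq (N : ℕ) : ∑ n ∈ Finset.Icc 1 N, 1/(√√(n:ℝ))^3 ≤ 4*√√(N:ℝ) := by
  induction N with
  | zero => simp
  | succ N ih =>
    rw [Finset.sum_Icc_succ_top (by omega)]
    have h1 : (√√((N+1:ℕ):ℝ))^4 = N+1 := by
      rw [show (√√((N+1:ℕ):ℝ))^4 = ((√√((N+1:ℕ):ℝ))^2)^2 by ring, Real.sq_sqrt (by positivity),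
        Real.sq_sqrt (by positivity)]; push_cast; ring
    have h2 : (√√(N:ℝ))^4 = N := by
      rw [show (√√(N:ℝ))^4 = ((√√(N:ℝ))^2)^2 by ring, Real.sq_sqrt (by positivity),
        Real.sq_sqrt (by positivity)]
    have h3 : 0 < √√((N+1:ℕ):ℝ) := by positivity
    have h4 : 0 ≤ √√(N:ℝ) := by positivity
    have h5 : √√(N:ℝ) ≤ √√((N+1:ℕ):ℝ) := by
      apply Real.sqrt_le_sqrt; apply Real.sqrt_le_sqrt; push_cast; linarith
    set x := √√((N+1:ℕ):ℝ)
    set y := √√(N:ℝ)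
    have : 1/x^3 ≤ 4*(x-y) := by
      rw [div_le_iff₀ (by positivity)]
      have e : (x-y)*(x^3+x^2*y+x*y^2+y^3) = 1 := by linear_combination h1 - h2
      have e2 : x^3+x^2*y+x*y^2+y^3 ≤ 4*x^3 := by
        have a1 : x^2*y ≤ x^2*x := by gcongr
        have a2 : x*y^2 ≤ x*x^2 := by gcongr
        have a3 : y^3 ≤ x^3 := by gcongr
        nlinarith
      nlinarith [mul_le_mul_of_nonneg_left e2 (by linarith : 0 ≤ x - y)]
    linarith

lemma sum_inv_sq (N : ℕ) : ∑ n ∈ Finset.Icc 1 N, 1/(n:ℝ)^2 ≤ 2 := by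
  suffices h : ∑ n ∈ Finset.Icc 1 N, 1/(n:ℝ)^2 ≤ 2 - 1/(N:ℝ) by
    have : 0 ≤ 1/(N:ℝ) := by positivity
    linarith
  induction N with
  | zero => simp
  | succ N ih =>
    rw [Finset.sum_Icc_succ_top (by omega)]
    rcases Nat.eq_zero_or_pos N with rfl | hN
    · norm_num
    have hN' : (0:ℝ) < N := by exact_mod_cast hN
    have : 1/((N+1:ℕ):ℝ)^2 ≤ 1/(N:ℝ) - 1/((N+1:ℕ):ℝ) := by
      push_cast
      rw [div_sub_div _ _ (by positivity) (by positivity), div_le_div_iff₀ (by positivity) (by positivity)]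
      nlinarith
    linarith

namespace CF

/-- fibre bound with fixed `a, b, hA` -/
lemma fib_abA (S : Finset CF) (a b A : ℤ) (ha : a ≠ 0) (Y L : ℝ) (hL : 0 ≤ L)
    (h : ∀ w ∈ S, w.a = a ∧ w.b = b ∧ w.hA = A ∧ (|w.Δ| : ℝ) ≤ Y)
    (hs : ∀ s : ℝ, 0 ≤ s → s^2 ≤ 2*((a:ℝ)^2*Y) → s^4*|4*(A:ℝ)^3| ≤ 6*((a:ℝ)^2*Y)^3 →
      s ≤ (a:ℝ)^2*L) : (S.card : ℝ) ≤ 2 + 2*L := by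
  have hc : ∀ w ∈ S, ∀ w' ∈ S, w.c = w'.c := by
    intro w hw w' hw'
    obtain ⟨h1,h2,h3,-⟩ := h w hw
    obtain ⟨h1',h2',h3',-⟩ := h w' hw'
    have : a*w.c = a*w'.c := by
      have e1 : w.hA = w.b^2 - w.a*w.c := rfl
      have e2 : w'.hA = w'.b^2 - w'.a*w'.c := rfl
      rw [h1,h2,h3] at e1; rw [h1',h2',h3'] at e2; linarith
    exact mul_left_cancel₀ ha this
  have hinj : Set.InjOn CF.d (S : Set CF) := by
    intro w hw w' hw' e
    obtain ⟨h1,h2,h3,-⟩ := h w hw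
    obtain ⟨h1',h2',h3',-⟩ := h w' hw'
    ext
    · rw [h1,h1']
    · rw [h2,h2']
    · exact hc w hw w' hw'
    · exact e
  rw [← Finset.card_image_of_injOn hinj]
  rcases S.eq_empty_or_nonempty with rfl | ⟨w0, hw0⟩
  · simp; linarith
  apply dcount _ ((a:ℝ)^2) (2*b^3-3*a*b*w0.c) (4*(A:ℝ)^3) ((a:ℝ)^2*Y) L
  · have : (a:ℝ) ≠ 0 := by exact_mod_cast ha
    positivity
  · exact hL
  · intro d hd
    obtain ⟨w, hw, rfl⟩ := Finset.mem_image.mp hd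
    obtain ⟨h1,h2,h3,h4⟩ := h w hw
    have hcc := hc w hw w0 hw0
    have e := w.syzQ
    have e2 : 2*w.b*w.hA - w.a*w.hB = w.a^2*w.d+(2*w.b^3-3*w.a*w.b*w.c) := by
      simp only [hA, hB]; ring
    rw [e2, h1, h2, h3, hcc] at e
    have e3 : ((a:ℝ)^2*w.d+(2*b^3-3*a*b*w0.c))^2 - 4*(A:ℝ)^3 = w.Δ*a^2 := by
      have : ((a:ℝ)^2*w.d+(2*b^3-3*a*b*w0.c))^2 - w.Δ*a^2 = 4*(A:ℝ)^3 := by exact_mod_cast e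
      linarith
    rw [e3, abs_mul, abs_of_nonneg (sq_nonneg (a:ℝ)), mul_comm]
    gcongr
  · exact hs

lemma fourth_le {x y : ℝ} (hy : 0 ≤ y) (h : x^4 ≤ y^4) : x ≤ y :=
  le_of_pow_le_pow_left₀ (n := 4) (by norm_num) hy h

/-- bound for fixed `a`, `b`, sign of `hA` -/
lemma fib_ab (S : Finset CF) (a b : ℤ) (ha : a ≠ 0) (sg : Prop) (y : ℝ) (hy : 1 ≤ y)
    (h : ∀ w ∈ S, w.a = a ∧ w.b = b ∧ (0 ≤ w.hA ↔ sg) ∧ (|w.Δ| : ℝ) ≤ y^4 ∧ |(w.hA:ℝ)| ≤ 256*y^2) :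
    (S.card : ℝ) ≤ 2 + 515*y^2/|(a:ℝ)| + 64*y^3*√y/(√√|(a:ℝ)|)^6 := by
  have haR : (a:ℝ) ≠ 0 := by exact_mod_cast ha
  have ha0 : 0 < |(a:ℝ)| := abs_pos.mpr haR
  set n := a.natAbs with hn
  have hnR : (n:ℝ) = |(a:ℝ)| := by rw [hn, Nat.cast_natAbs]; push_cast; rfl
  have hn0 : 0 < n := by omega
  set al := √√|(a:ℝ)| with hal
  have hal0 : 0 < al := by positivity
  have hal4 : al^4 = |(a:ℝ)| := by
    rw [hal, show (√√|(a:ℝ)|)^4 = ((√√|(a:ℝ)|)^2)^2 by ring, Real.sq_sqrt (by positivity),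
      Real.sq_sqrt (by positivity)]
  set M := ⌊256*y^2/|(a:ℝ)|⌋₊ with hM
  have hMle : (M:ℝ) ≤ 256*y^2/|(a:ℝ)| := Nat.floor_le (by positivity)
  set g : ℕ → ℝ := fun k => if k = 0 then 2 + 2*(√2*y^2/|(a:ℝ)|) else
    2 + 2*(2*y^3/al^5*(1/(√√(k:ℝ))^3)) with hg
  have h1 : (S.card : ℝ) ≤ ∑ k ∈ Finset.range (M+1), g k := by
    apply card_le_fib S (fun w => w.hA.natAbs / n)
    · intro w hw
      obtain ⟨-,-,-,-,hA1⟩ := h w hw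
      rw [Finset.mem_range, Nat.lt_succ_iff, hM]
      apply Nat.le_floor
      rw [le_div_iff₀ ha0, ← hnR]
      refine le_trans ?_ hA1
      have : w.hA.natAbs / n * n ≤ w.hA.natAbs := Nat.div_mul_le_self _ _
      calc ((w.hA.natAbs/n : ℕ):ℝ)*n ≤ (w.hA.natAbs:ℝ) := by exact_mod_cast this
        _ = |(w.hA:ℝ)| := by rw [Nat.cast_natAbs]; push_cast; rfl
    · intro k _ F hFS hFk
      rcases F.eq_empty_or_nonempty with rfl | ⟨w0, hw0⟩
      · simp only [Finset.card_empty, Nat.cast_zero, hg]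
        split_ifs <;> positivity
      have hAeq : ∀ w ∈ F, w.hA = w0.hA := by
        intro w hw
        have hw := And.intro (hFS hw) (hFk w hw)
        have hw0 := And.intro (hFS hw0) (hFk w0 hw0)
        obtain ⟨p1,p2,p3,-⟩ := h w hw.1
        obtain ⟨q1,q2,q3,-⟩ := h w0 hw0.1
        have hd1 : a ∣ w.hA - w0.hA := by
          have e1 : w.hA = w.b^2 - w.a*w.c := rfl
          have e2 : w0.hA = w0.b^2 - w0.a*w0.c := rfl
          rw [e1,e2,p1,p2,q1,q2]
          exact ⟨w0.c - w.c, by ring⟩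
        have b1 := Nat.div_mul_le_self w.hA.natAbs n
        have b2 := Nat.lt_div_mul_add (a := w.hA.natAbs) hn0
        have b3 := Nat.div_mul_le_self w0.hA.natAbs n
        have b4 := Nat.lt_div_mul_add (a := w0.hA.natAbs) hn0
        rw [hw.2] at b1 b2
        rw [hw0.2] at b3 b4
        have hlt : |w.hA - w0.hA| < a.natAbs := by
          have hsgn := p3.trans q3.symm
          rw [← hn]
          generalize k*n = kn at *
          rw [abs_lt]
          by_cases hp : 0 ≤ w.hA
          · have := hsgn.mp hp
            omega
          · have : ¬ 0 ≤ w0.hA := fun h' => hp (hsgn.mpr h')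
            omega
        have := Int.eq_zero_of_abs_lt_dvd (m := (a.natAbs:ℤ)) (Int.natAbs_dvd.mpr hd1) hlt
        omega
      have base : ∀ L : ℝ, 0 ≤ L → (∀ s : ℝ, 0 ≤ s → s^2 ≤ 2*((a:ℝ)^2*y^4) →
          s^4*|4*(w0.hA:ℝ)^3| ≤ 6*((a:ℝ)^2*y^4)^3 → s ≤ (a:ℝ)^2*L) →
          (F.card : ℝ) ≤ 2 + 2*L := by
        intro L hL hs
        apply fib_abA _ a b w0.hA ha (y^4) L hL _ hs
        intro w hw
        obtain ⟨p1,p2,p3,p4,-⟩ := h w (hFS hw)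
        exact ⟨p1,p2,hAeq w hw, p4⟩
      simp only [hg]
      split_ifs with hk
      · apply base _ (by positivity)
        intro s hs0 hs1 _
        rw [← sq_abs (a:ℝ)] at hs1 ⊢
        have e : |(a:ℝ)|^2*(√2*y^2/|(a:ℝ)|) = √2*y^2*|(a:ℝ)| := by field_simp
        rw [e]
        apply le_of_sq_le_sq _ (by positivity)
        have : (√2:ℝ)^2 = 2 := Real.sq_sqrt (by norm_num)
        calc s^2 ≤ 2*(|(a:ℝ)|^2*y^4) := hs1
          _ = (√2)^2*(|(a:ℝ)|^2*y^4) := by rw [this]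
          _ = _ := by ring
      · have hk0 : 0 < (k:ℝ) := by exact_mod_cast Nat.pos_of_ne_zero hk
        set ka := √√(k:ℝ) with hka
        have hka0 : 0 < ka := by positivity
        have hka4 : ka^4 = k := by
          rw [hka, show (√√(k:ℝ))^4 = ((√√(k:ℝ))^2)^2 by ring, Real.sq_sqrt (by positivity),
            Real.sq_sqrt (by positivity)]
        apply base _ (by positivity)
        intro s hs0 _ hs2
        have hAk : (k:ℝ)*|(a:ℝ)| ≤ |(w0.hA:ℝ)| := by
          have hw0' := hFk w0 hw0
          have b3 := Nat.div_mul_le_self w0.hA.natAbs n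
          rw [hw0'] at b3
          rw [← hnR]
          calc (k:ℝ)*n ≤ (w0.hA.natAbs:ℝ) := by exact_mod_cast b3
            _ = |(w0.hA:ℝ)| := by rw [Nat.cast_natAbs]; push_cast; rfl
        rw [← sq_abs (a:ℝ), ← hal4] at hs2 ⊢
        rw [← hal4, ← hka4] at hAk
        have e : (al^4)^2*(2*y^3/al^5*(1/ka^3)) = 2*y^3*al^3/ka^3 := by field_simp
        rw [e, le_div_iff₀ (by positivity)]
        apply fourth_le (by positivity)
        have h3 : (ka^4*al^4)^3 ≤ |(w0.hA:ℝ)|^3 := by gcongr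
        rw [abs_mul, abs_pow, abs_of_pos (by norm_num : (0:ℝ)<4)] at hs2
        have h4 : s^4*(4*(ka^4*al^4)^3) ≤ 6*((al^4)^2*y^4)^3 := le_trans (by gcongr) hs2
        have h5 : (s*ka^3)^4*4*al^12 ≤ (6*(y^3*al^3)^4)*al^12 := by
          calc _ = s^4*(4*(ka^4*al^4)^3) := by ring
            _ ≤ _ := h4
            _ = _ := by ring
        have h6 := le_of_mul_le_mul_right h5 (by positivity)
        have h7 : 0 ≤ (y^3*al^3)^4 := by positivity
        calc (s*ka^3)^4 ≤ 16*(y^3*al^3)^4 := by linarith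
          _ = _ := by ring
  have h2 : ∑ k ∈ Finset.range (M+1), g k = g 0 + ∑ k ∈ Finset.Icc 1 M, g k := by
    rw [Finset.range_eq_Ico, Finset.sum_eq_sum_Ico_succ_bot (by omega)]
    congr 1
  have h3 : ∑ k ∈ Finset.Icc 1 M, g k = 2*M + 4*y^3/al^5 * ∑ k ∈ Finset.Icc 1 M, 1/(√√(k:ℝ))^3 := by
    rw [Finset.mul_sum]
    have : ∀ k ∈ Finset.Icc 1 M, g k = 2 + 4*y^3/al^5*(1/(√√(k:ℝ))^3) := by
      intro k hk
      have : k ≠ 0 := by have := (Finset.mem_Icc.mp hk).1; omega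
      simp only [hg, this, if_false]; ring
    rw [Finset.sum_congr rfl this, Finset.sum_add_distrib]
    simp; ring
  have h4 := sum_inv_qq M
  have h5 : √√(M:ℝ) ≤ 4*√y/al := by
    apply fourth_le (by positivity)
    have e1 : (√√(M:ℝ))^4 = M := by
      rw [show (√√(M:ℝ))^4 = ((√√(M:ℝ))^2)^2 by ring, Real.sq_sqrt (by positivity),
            Real.sq_sqrt (by positivity)]
    have e2 : (√y)^4 = y^2 := by
      rw [show (√y)^4 = ((√y)^2)^2 by ring, Real.sq_sqrt (by positivity)]
    rw [e1, div_pow, mul_pow, e2, hal4]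
    refine hMle.trans_eq (by norm_num)
  have h6 : 4*y^3/al^5 * ∑ k ∈ Finset.Icc 1 M, 1/(√√(k:ℝ))^3 ≤ 4*y^3/al^5*(4*(4*√y/al)) := by
    gcongr
    linarith
  have h7 : 4*y^3/al^5*(4*(4*√y/al)) = 64*y^3*√y/al^6 := by field_simp; norm_num
  have h8 : g 0 = 2 + 2*√2*(y^2/|(a:ℝ)|) := by simp only [hg, if_true]; ring
  have h9 : √2 ≤ 3/2 := by rw [Real.sqrt_le_left (by norm_num)]; norm_num
  have h10 : 2*√2*(y^2/|(a:ℝ)|) ≤ 3*(y^2/|(a:ℝ)|) := by gcongr; linarith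
  have h11 : 2*(M:ℝ) ≤ 512*(y^2/|(a:ℝ)|) := by
    calc 2*(M:ℝ) ≤ 2*(256*y^2/|(a:ℝ)|) := by gcongr
      _ = _ := by ring
  have h12 : 515*y^2/|(a:ℝ)| = 515*(y^2/|(a:ℝ)|) := by ring
  rw [h12]
  linarith

end CF
end DW
end

noncomputable section
namespace DW
namespace CF

lemma count_a0 (S : Finset CF) (y : ℝ) (hy : 1 ≤ y)
    (h : ∀ w ∈ S, Red w ∧ (|w.Δ| : ℝ) ≤ y^4 ∧ w.a = 0) : (S.card : ℝ) ≤ 2000*y^4 := by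
  set N := ⌊16*y⌋₊ with hN
  have hNle : (N:ℝ) ≤ 16*y := Nat.floor_le (by positivity)
  have h1 : (S.card : ℝ) ≤ ∑ i ∈ (Finset.univ : Finset Bool) ×ˢ Finset.Icc 1 N,
      (2*(i.2:ℝ) + y^4*(1/(i.2:ℝ)^2)) := by
    apply card_le_fib S (fun w => (decide (0 < w.b), w.b.natAbs))
    · intro w hw
      obtain ⟨⟨r1,r2,r3,r4⟩,hD,ha⟩ := h w hw
      simp only [Finset.mem_product, Finset.mem_univ, true_and, Finset.mem_Icc]
      refine ⟨by have := (r4 ha).1; omega, ?_⟩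
      rw [hN]
      apply Nat.le_floor
      rw [Nat.cast_natAbs]
      push_cast
      apply fourth_le (by positivity)
      have e : w.hA = w.b^2 := by simp [hA, ha]
      rw [e] at r2
      have : ((w.b:ℝ)^2)^2 ≤ 65536*|(w.Δ:ℝ)| := by exact_mod_cast r2
      rw [Even.pow_abs (by decide)]
      nlinarith
    · rintro ⟨sg, n⟩ hi F hFS hF
      simp only [Finset.mem_product, Finset.mem_univ, true_and, Finset.mem_Icc] at hi
      have hn0 : (0:ℝ) < n := by exact_mod_cast hi.1
      have h2 : (F.card : ℝ) ≤ ∑ c ∈ Finset.range (2*n), (1+y^4/(2*(n:ℝ)^3)) := by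
        apply card_le_fib F (fun w => w.c.toNat)
        · intro w hw
          obtain ⟨⟨r1,r2,r3,r4⟩,hD,ha⟩ := h w (hFS hw)
          have := r4 ha
          have e := hF w hw
          simp only [Prod.mk.injEq] at e
          rw [Finset.mem_range]
          have := Int.abs_eq_natAbs w.b
          omega
        · intro c _ G hGF hG
          rcases G.eq_empty_or_nonempty with rfl | ⟨w0, hw0⟩
          · simp; positivity
          have heq : ∀ w ∈ G, w.b = w0.b ∧ w.c = w0.c ∧ w.a = 0 := by
            intro w hw
            have e1 := hF w (hGF hw)
            have e2 := hF w0 (hGF hw0)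
            have e3 := hG w hw
            have e4 := hG w0 hw0
            obtain ⟨⟨r1,r2,r3,r4⟩,hD,ha⟩ := h w (hFS (hGF hw))
            obtain ⟨⟨r1',r2',r3',r4'⟩,hD',ha'⟩ := h w0 (hFS (hGF hw0))
            have k1 := r4 ha
            have k2 := r4' ha'
            simp only [Prod.mk.injEq] at e1 e2
            have e5 : (0 < w.b) ↔ (0 < w0.b) := by
              rw [← decide_eq_decide]; rw [e1.1, e2.1]
            refine ⟨by omega, by omega, ha⟩
          have hinj : Set.InjOn CF.d (G : Set CF) := by
            intro w hw w' hw' e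
            have a1 := heq w hw
            have a2 := heq w' hw'
            ext
            · rw [a1.2.2, a2.2.2]
            · rw [a1.1, a2.1]
            · rw [a1.2.1, a2.2.1]
            · exact e
          rw [← Finset.card_image_of_injOn hinj]
          apply card_le_of_diff _ _ (by positivity)
          intro x hx y' hy' hxy
          obtain ⟨w, hw, rfl⟩ := Finset.mem_image.mp hx
          obtain ⟨w', hw', rfl⟩ := Finset.mem_image.mp hy'
          have key : ∀ v ∈ G, |4*(w0.b:ℝ)^3*v.d - 3*w0.b^2*w0.c^2| ≤ y^4 := by
            intro v hv
            have a1 := heq v hv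
            have e : v.Δ = 4*w0.b^3*v.d - 3*w0.b^2*w0.c^2 := by
              simp only [Δ, hA, hB, hC, a1.1, a1.2.1, a1.2.2]; ring
            have hD := (h v (hFS (hGF hv))).2.1
            rw [e] at hD
            exact_mod_cast hD
          have k1 := abs_le.mp (key w hw)
          have k2 := abs_le.mp (key w' hw')
          have k3 : |4*(w0.b:ℝ)^3*(w'.d - w.d)| ≤ 2*y^4 := by
            rw [abs_le]; constructor <;> nlinarith
          have hb : |(w0.b:ℝ)| = n := by
            have e := hF w0 (hGF hw0)
            simp only [Prod.mk.injEq] at e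
            rw [← e.2, Nat.cast_natAbs]; push_cast; rfl
          have hxy' : (w.d:ℝ) ≤ w'.d := by exact_mod_cast hxy
          rw [abs_mul, abs_mul, abs_pow, hb, abs_of_nonneg (by linarith : 0 ≤ (w'.d:ℝ) - w.d),
            abs_of_pos (by norm_num : (0:ℝ) < 4)] at k3
          rw [le_div_iff₀ (by positivity)]
          linarith
      rw [Finset.sum_const, Finset.card_range] at h2
      refine h2.trans (le_of_eq ?_)
      simp only [nsmul_eq_mul]
      push_cast
      field_simp
  rw [Finset.sum_product] at h1
  have h3 : ∑ n ∈ Finset.Icc 1 N, (2*(n:ℝ) + y^4*(1/(n:ℝ)^2)) ≤ 2*(16*y)*(16*y) + y^4*2 := by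
    rw [Finset.sum_add_distrib, ← Finset.mul_sum _ _ (y^4)]
    have := sum_inv_sq N
    have h4 : ∑ n ∈ Finset.Icc 1 N, 2*(n:ℝ) ≤ ∑ n ∈ Finset.Icc 1 N, 2*(16*y) := by
      apply Finset.sum_le_sum
      intro n hn
      have : (n:ℝ) ≤ N := by exact_mod_cast (Finset.mem_Icc.mp hn).2
      linarith
    simp only [Finset.sum_const, Nat.card_Icc, nsmul_eq_mul] at h4
    have h5 : ((N+1-1:ℕ):ℝ) = N := by simp
    rw [h5] at h4
    have : y^4*∑ n ∈ Finset.Icc 1 N, 1/(n:ℝ)^2 ≤ y^4*2 := by gcongr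
    nlinarith
  simp only [Finset.sum_const, Finset.card_univ, Fintype.card_bool, nsmul_eq_mul] at h1
  have : y^2 ≤ y^4 := pow_le_pow_right₀ hy (by norm_num)
  push_cast at h1
  nlinarith

lemma count_a1 (S : Finset CF) (y : ℝ) (hy : 1 ≤ y)
    (h : ∀ w ∈ S, Red w ∧ (|w.Δ| : ℝ) ≤ y^4 ∧ w.a ≠ 0) : (S.card : ℝ) ≤ 80000*y^4 := by
  set N := ⌊16*y⌋₊ with hN
  have hNle : (N:ℝ) ≤ 16*y := Nat.floor_le (by positivity)
  have h1 : (S.card : ℝ) ≤ ∑ i ∈ (Finset.univ : Finset Bool) ×ˢ Finset.Icc 1 N,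
      (4*(i.2:ℝ) + 1030*y^2 + 128*y^3*√y*(1/√(i.2:ℝ))) := by
    apply card_le_fib S (fun w => (decide (0 < w.a), w.a.natAbs))
    · intro w hw
      obtain ⟨⟨r1,r2,r3,r4⟩,hD,ha⟩ := h w hw
      simp only [Finset.mem_product, Finset.mem_univ, true_and, Finset.mem_Icc]
      refine ⟨by omega, ?_⟩
      rw [hN]
      apply Nat.le_floor
      rw [Nat.cast_natAbs]
      push_cast
      apply fourth_le (by positivity)
      have : (w.a:ℝ)^4 ≤ 65536*|(w.Δ:ℝ)| := by exact_mod_cast r1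
      rw [Even.pow_abs (by decide)]
      nlinarith
    · rintro ⟨sg, n⟩ hi F hFS hF
      simp only [Finset.mem_product, Finset.mem_univ, true_and, Finset.mem_Icc] at hi
      have hn0 : (0:ℝ) < n := by exact_mod_cast hi.1
      have h2 : (F.card : ℝ) ≤ ∑ c ∈ Finset.range n ×ˢ (Finset.univ : Finset Bool),
          (2 + 515*y^2/(n:ℝ) + 64*y^3*√y/(√√(n:ℝ))^6) := by
        apply card_le_fib F (fun w => (w.b.toNat, decide (0 ≤ w.hA)))
        · intro w hw
          obtain ⟨⟨r1,r2,r3,r4⟩,hD,ha⟩ := h w (hFS hw)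
          have k := r3 ha
          have e := hF w hw
          simp only [Prod.mk.injEq] at e
          simp only [Finset.mem_product, Finset.mem_univ, and_true, Finset.mem_range]
          have := Int.abs_eq_natAbs w.a
          omega
        · rintro ⟨b, sg'⟩ _ G hGF hG
          rcases G.eq_empty_or_nonempty with rfl | ⟨w0, hw0⟩
          · simp; positivity
          have hFa : ∀ w ∈ G, w.a = w0.a := by
            intro w hw
            have e1 := hF w (hGF hw)
            have e2 := hF w0 (hGF hw0)
            have ha := (h w (hFS (hGF hw))).2.2
            have ha' := (h w0 (hFS (hGF hw0))).2.2
            simp only [Prod.mk.injEq] at e1 e2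
            have e5 : (0 < w.a) ↔ (0 < w0.a) := by
              rw [← decide_eq_decide]; rw [e1.1, e2.1]
            omega
          have hna : (n:ℝ) = |(w0.a:ℝ)| := by
            have e := hF w0 (hGF hw0)
            simp only [Prod.mk.injEq] at e
            rw [← e.2, Nat.cast_natAbs]; push_cast; rfl
          rw [hna]
          apply fib_ab G w0.a b (h w0 (hFS (hGF hw0))).2.2 (sg' = true) y hy
          intro w hw
          obtain ⟨⟨r1,r2,r3,r4⟩,hD,ha⟩ := h w (hFS (hGF hw))
          have e := hG w hw
          simp only [Prod.mk.injEq] at e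
          refine ⟨hFa w hw, by have := r3 ha; omega, by rw [← e.2]; simp, hD, ?_⟩
          have : (w.hA:ℝ)^2 ≤ 65536*|(w.Δ:ℝ)| := by exact_mod_cast r2
          apply abs_le_of_sq_le_sq _ (by positivity)
          nlinarith
      rw [Finset.sum_const, Finset.card_product, Finset.card_range, Finset.card_univ,
        Fintype.card_bool] at h2
      refine h2.trans (le_of_eq ?_)
      simp only [nsmul_eq_mul]
      push_cast
      have e1 : (√√(n:ℝ))^6 = n*√(n:ℝ) := by
        rw [show (√√(n:ℝ))^6 = ((√√(n:ℝ))^2)^2*(√√(n:ℝ))^2 by ring, Real.sq_sqrt (by positivity),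
          Real.sq_sqrt (by positivity)]
      rw [e1]
      have : 0 < √(n:ℝ) := by positivity
      field_simp
      ring
  rw [Finset.sum_product] at h1
  have h3 : ∑ n ∈ Finset.Icc 1 N, (4*(n:ℝ) + 1030*y^2 + 128*y^3*√y*(1/√(n:ℝ))) ≤
      (4*(16*y)+1030*y^2)*(16*y) + 128*y^3*√y*(2*(4*√y)) := by
    rw [Finset.sum_add_distrib, ← Finset.mul_sum]
    have s1 := sum_inv_sqrt N
    have s2 : √(N:ℝ) ≤ 4*√y := by
      rw [Real.sqrt_le_left (by positivity), mul_pow, Real.sq_sqrt (by positivity)]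
      linarith
    have h4 : ∑ n ∈ Finset.Icc 1 N, (4*(n:ℝ)+1030*y^2) ≤ ∑ n ∈ Finset.Icc 1 N, (4*(16*y)+1030*y^2) := by
      apply Finset.sum_le_sum
      intro n hn
      have : (n:ℝ) ≤ N := by exact_mod_cast (Finset.mem_Icc.mp hn).2
      linarith
    rw [Finset.sum_const (s := Finset.Icc 1 N)] at h4
    simp only [Nat.card_Icc, nsmul_eq_mul] at h4
    have h5 : ((N+1-1:ℕ):ℝ) = N := by simp
    rw [h5] at h4
    have e1 : 128*y^3*√y*∑ n ∈ Finset.Icc 1 N, 1/√(n:ℝ) ≤ 128*y^3*√y*(2*(4*√y)) := by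
      gcongr; linarith
    have e2 : (N:ℝ)*(4*(16*y)+1030*y^2) ≤ (16*y)*(4*(16*y)+1030*y^2) := by gcongr
    linarith
  simp only [Finset.sum_const, Finset.card_univ, Fintype.card_bool, nsmul_eq_mul] at h1
  have p1 : y^2 ≤ y^4 := pow_le_pow_right₀ hy (by norm_num)
  have p2 : y^3 ≤ y^4 := pow_le_pow_right₀ hy (by norm_num)
  have p3 : √y*√y = y := Real.mul_self_sqrt (by linarith)
  have p4 : 128*y^3*√y*(2*(4*√y)) = 1024*y^4 := by linear_combination 1024*y^3*p3
  rw [p4] at h3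
  push_cast at h1
  nlinarith

theorem davenport (S : Finset CF) (hS : Ineq S) (Y : ℝ) (hY : 0 ≤ Y)
    (h : ∀ w ∈ S, w.Δ ≠ 0 ∧ (|w.Δ| : ℝ) ≤ Y) : (S.card : ℝ) ≤ 82000*Y := by
  rcases lt_or_ge Y 1 with hY1 | hY1
  · have : S = ∅ := by
      rw [Finset.eq_empty_iff_forall_notMem]
      intro w hw
      obtain ⟨h1,h2⟩ := h w hw
      have : (1:ℝ) ≤ |(w.Δ:ℝ)| := by exact_mod_cast Int.one_le_abs h1
      linarith
    rw [this]; simp; linarith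
  have hex : ∀ w : CF, ∃ w', w.Δ ≠ 0 → (Eqv w w' ∧ Red w') := by
    intro w
    by_cases hw : w.Δ ≠ 0
    · obtain ⟨w', h'⟩ := exists_Red w hw
      exact ⟨w', fun _ => h'⟩
    · exact ⟨w, fun h' => absurd h' hw⟩
  choose φ hφ using hex
  obtain ⟨-, hinj⟩ := hS.reps φ (fun x hx => (hφ x (h x hx).1).1)
  rw [← Finset.card_image_of_injOn hinj]
  set T := S.image φ
  set y := √√Y
  have hy4 : y^4 = Y := by
    rw [show (√√Y)^4 = ((√√Y)^2)^2 by ring, Real.sq_sqrt (by positivity), Real.sq_sqrt (by positivity)]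
  have hy1 : 1 ≤ y := by
    rw [Real.one_le_sqrt, Real.one_le_sqrt]; exact hY1
  have hT : ∀ w ∈ T, Red w ∧ (|w.Δ|:ℝ) ≤ y^4 := by
    intro w hw
    obtain ⟨x, hx, rfl⟩ := Finset.mem_image.mp hw
    obtain ⟨e, r⟩ := hφ x (h x hx).1
    refine ⟨r, ?_⟩
    rw [hy4, e.Δ_eq]; exact (h x hx).2
  have c0 := count_a0 (T.filter (fun w => w.a = 0)) y hy1 (fun w hw => by
    rw [Finset.mem_filter] at hw; exact ⟨(hT w hw.1).1, (hT w hw.1).2, hw.2⟩)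
  have c1 := count_a1 (T.filter (fun w => ¬ w.a = 0)) y hy1 (fun w hw => by
    rw [Finset.mem_filter] at hw; exact ⟨(hT w hw.1).1, (hT w hw.1).2, hw.2⟩)
  have h3 := Finset.card_filter_add_card_filter_not (s := T) (fun w => w.a = 0)
  have h4 : ((T.filter (fun w => w.a = 0)).card : ℝ) +
    (T.filter (fun w => ¬ w.a = 0)).card = T.card := by exact_mod_cast h3
  rw [hy4] at c0 c1
  linarith

end CF
end DW
end

noncomputable section
namespace DW
open Submodule

abbrev KD (D : ℤ) := QuadraticAlgebra ℚ (D:ℚ) 0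
section
variable {D : ℤ}

def cj : KD D →ₐ[ℤ] KD D := (starRingEnd (KD D)).toIntAlgHom
def cM (I : Submodule ℤ (KD D)) : Submodule ℤ (KD D) := I.map (cj : KD D →ₐ[ℤ] KD D).toLinearMap
lemma cM_mul (I J : Submodule ℤ (KD D)) : cM (I*J) = cM I * cM J := Submodule.map_mul _ _ _
lemma cM_pair (x y : KD D) : cM (span ℤ {x,y}) = span ℤ {star x, star y} := by
  simp only [cM, Submodule.map_span, Set.image_pair]
  rfl
lemma cM_one (x : KD D) : cM (span ℤ {x}) = span ℤ {star x} := by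
  simp only [cM, Submodule.map_span, Set.image_singleton]
  rfl
lemma mem_pair {x y z : KD D} : z ∈ span ℤ {x,y} ↔ ∃ m n : ℤ, z = m*x+n*y := by
  rw [Submodule.mem_span_pair]
  constructor
  · rintro ⟨m,n,h⟩
    exact ⟨m,n, by rw [← h]; simp⟩
  · rintro ⟨m,n,h⟩
    exact ⟨m,n, by rw [h]; simp⟩

def om (D : ℤ) : KD D := ⟨(D:ℚ)/2, 1/2⟩
def eM (D : ℤ) : Submodule ℤ (KD D) := span ℤ {1, om D}
def nm (x : KD D) : ℚ := x.re^2 - D*x.im^2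
def tau (x : KD D) : ℚ := 2*x.im
/-- rational scalars -/
def sc (D : ℤ) (t : ℚ) : KD D := ⟨t, 0⟩

lemma nm_mul (x y : KD D) : nm (x*y) = nm x * nm y := by
  simp [nm]; ring
lemma nm_star (x : KD D) : nm (star x) = nm x := by simp [nm]
lemma mul_star' (x : KD D) : x * star x = sc D (nm x) := by
  ext <;> simp [nm, sc] <;> ring
lemma sc_mul (s t : ℚ) : sc D s * sc D t = sc D (s*t) := by
  ext <;> simp [sc]
lemma sc_int (n : ℤ) : sc D n = (n : KD D) := by ext <;> simp [sc]
lemma sc_one : sc D 1 = 1 := by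
  have := sc_int (D := D) 1
  simpa using this
lemma nm_sc (t : ℚ) : nm (sc D t) = t^2 := by simp [nm, sc]
lemma star_sc (t : ℚ) : star (sc D t) = sc D t := by ext <;> simp [sc]

lemma exists_inv {x : KD D} (h : nm x ≠ 0) : ∃ y : KD D, x*y = 1 ∧ nm y = (nm x)⁻¹ := by
  refine ⟨star x * sc D (nm x)⁻¹, ?_, ?_⟩
  · rw [← mul_assoc, mul_star', sc_mul, mul_inv_cancel₀ h, sc_one]
  · rw [nm_mul, nm_star, nm_sc]; field_simp

lemma cancel_nm {x y z : KD D} (h : nm x ≠ 0) (e : x*y = x*z) : y = z := by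
  obtain ⟨u, hu, -⟩ := exists_inv h
  calc y = u*(x*y) := by linear_combination (-y)*hu
    _ = z := by rw [e]; linear_combination z*hu

lemma span1_mul (x y : KD D) : span ℤ {x} * span ℤ {y} = span ℤ {x*y} := by
  rw [Submodule.span_mul_span, Set.singleton_mul_singleton]
lemma span1_pair (x y z : KD D) : span ℤ {x} * span ℤ {y,z} = span ℤ {x*y, x*z} := by
  rw [Submodule.span_mul_span]; congr 1
  ext t; simp [Set.mem_mul, Set.singleton_mul]
  constructor
  · rintro (h|h) <;> simp [h]
  · rintro (h|h) <;> simp [h]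
lemma span_unit {M N : Submodule ℤ (KD D)} {x : KD D} (h : nm x ≠ 0)
    (e : span ℤ {x} * M = span ℤ {x} * N) : M = N := by
  obtain ⟨u, hu, -⟩ := exists_inv h
  have : ∀ M : Submodule ℤ (KD D), span ℤ {u} * (span ℤ {x} * M) = M := by
    intro M
    rw [← mul_assoc, span1_mul, mul_comm u x, hu]
    rw [← Submodule.one_eq_span, one_mul]
  rw [← this M, e, this N]

lemma om_mul (hD : (4:ℤ) ∣ D^2-D) : ∃ k : ℤ, D^2 - D = 4*k ∧ om D * om D = D*om D - k := by
  obtain ⟨k, hk⟩ := hD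
  refine ⟨k, hk, ?_⟩
  have : (D:ℚ)^2 - D = 4*k := by exact_mod_cast hk
  ext <;> simp [om]
  · linear_combination (-1/4)*this
  · ring

lemma star_om : star (om D) = D - om D := by
  ext <;> simp [om]; ring

lemma cM_e : cM (eM D) = eM D := by
  rw [eM, cM_pair]
  apply le_antisymm
  · rw [Submodule.span_le]
    rintro x (h|h)
    · simp only [h]; exact mem_pair.2 ⟨1,0,by simp⟩
    · simp only [Set.mem_singleton_iff] at h; rw [h]; exact mem_pair.2 ⟨D,-1,by rw [star_om]; simp; ring⟩
  · rw [Submodule.span_le]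
    rintro x (h|h)
    · simp only [h]; exact mem_pair.2 ⟨1,0,by simp⟩
    · simp only [Set.mem_singleton_iff] at h; rw [h]; exact mem_pair.2 ⟨D,-1,by rw [star_om]; simp⟩

lemma e_one : (1 : KD D) ∈ eM D := mem_pair.2 ⟨1,0,by simp⟩
lemma e_om : om D ∈ eM D := mem_pair.2 ⟨0,1,by simp⟩
lemma e_int (n : ℤ) : (n : KD D) ∈ eM D := mem_pair.2 ⟨n,0,by simp⟩

lemma e_mul (hD : (4:ℤ) ∣ D^2-D) : eM D * eM D = eM D := by
  obtain ⟨k, -, hk⟩ := om_mul hD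
  apply le_antisymm
  · rw [Submodule.mul_le]
    intro x hx y hy
    obtain ⟨m,n,rfl⟩ := mem_pair.1 hx
    obtain ⟨m',n',rfl⟩ := mem_pair.1 hy
    refine mem_pair.2 ⟨m*m'-n*n'*k, m*n'+n*m'+n*n'*D, ?_⟩
    push_cast
    linear_combination (n*n' : KD D)*hk
  · intro x hx
    rw [← one_mul x]
    exact Submodule.mul_mem_mul e_one hx

lemma tau_e {x : KD D} (h : x ∈ eM D) : ∃ n : ℤ, tau x = n := by
  obtain ⟨m,n,rfl⟩ := mem_pair.1 h
  exact ⟨n, by simp [tau, om]; ring⟩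

/-- Lemma L -/
lemma lemL {α β : KD D} {r : ℚ}
    (h : span ℤ {α, β} * span ℤ {star α, star β} = span ℤ {sc D r} * eM D) :
    tau (α * star β) = r ∨ tau (α * star β) = -r := by
  have h1 : α * star β ∈ span ℤ {sc D r} * eM D := by
    rw [← h]
    exact Submodule.mul_mem_mul (subset_span (by simp)) (subset_span (by simp))
  have key : ∀ x ∈ span ℤ {α, β} * span ℤ {star α, star β}, ∃ m : ℤ, tau x = m * tau (α * star β) := by
    intro x hx
    induction hx using Submodule.mul_induction_on' with
    | mem_mul_mem x hx y hy =>
      obtain ⟨m,n,rfl⟩ := mem_pair.1 hx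
      obtain ⟨m',n',rfl⟩ := mem_pair.1 hy
      refine ⟨m*n'-n*m', ?_⟩
      simp [tau]; ring
    | add x hx y hy hx' hy' =>
      obtain ⟨m, hm⟩ := hx'
      obtain ⟨n, hn⟩ := hy'
      refine ⟨m+n, ?_⟩
      have : tau (x+y) = tau x + tau y := by simp [tau]; ring
      rw [this, hm, hn]; push_cast; ring
  rw [eM, span1_pair, mem_pair] at h1
  obtain ⟨m,n,h1⟩ := h1
  have h2 : tau (α * star β) = n*r := by rw [h1]; simp [tau, om, sc]; ring
  obtain ⟨k, hk⟩ := key (sc D r * om D) (by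
    rw [h]; exact Submodule.mul_mem_mul (subset_span (by simp)) e_om)
  have h3 : r = k * tau (α * star β) := by
    rw [← hk]; simp [tau, om, sc]; ring
  by_cases hr : r = 0
  · left; rw [h2, hr]; simp
  · have : (k:ℚ)*n = 1 := by
      rw [h2] at h3
      have : r * (k*n-1) = 0 := by linear_combination -h3
      rcases mul_eq_zero.1 this with h|h
      · exact absurd h hr
      · linarith
    have : k*n = 1 := by exact_mod_cast this
    rcases Int.eq_one_or_neg_one_of_mul_eq_one' this with ⟨-,h⟩|⟨-,h⟩
    · left; rw [h2, h]; simp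
    · right; rw [h2, h]; simp

lemma sub_zmul (M : AddSubgroup ℤ) : ∃ g : ℤ, 0 ≤ g ∧ ∀ x, x ∈ M ↔ g ∣ x := by
  obtain ⟨g, hg⟩ := Int.subgroup_cyclic M
  refine ⟨|g|, abs_nonneg _, fun x => ?_⟩
  rw [hg, AddSubgroup.mem_closure_singleton, abs_dvd]
  constructor
  · rintro ⟨n, rfl⟩; exact ⟨n, by simp; ring⟩
  · rintro ⟨n, rfl⟩; exact ⟨n, by simp; ring⟩

/-- Hermite normal form -/
lemma hermite (M : Submodule ℤ (KD D)) (hM : M ≤ eM D) :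
    ∃ g b h : ℤ, 0 ≤ g ∧ 0 ≤ h ∧ M = span ℤ {(g : KD D), b + h*om D} := by
  let G : AddSubgroup ℤ :=
    { carrier := {x | (x : KD D) ∈ M}
      zero_mem' := by simp
      add_mem' := by
        intro a b ha hb
        simp only [Set.mem_ofPred_eq] at *
        push_cast; exact M.add_mem ha hb
      neg_mem' := by
        intro a ha
        simp only [Set.mem_ofPred_eq] at *
        push_cast; exact M.neg_mem ha }
  let H : AddSubgroup ℤ :=
    { carrier := {x | ∃ b : ℤ, (b + x*om D : KD D) ∈ M}
      zero_mem' := ⟨0, by simp⟩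
      add_mem' := by
        rintro a b ⟨u,ha⟩ ⟨v,hb⟩
        refine ⟨u+v, ?_⟩
        have := M.add_mem ha hb
        convert this using 1; push_cast; ring
      neg_mem' := by
        rintro a ⟨u,ha⟩
        refine ⟨-u, ?_⟩
        have := M.neg_mem ha
        convert this using 1; push_cast; ring }
  obtain ⟨g, hg0, hg⟩ := sub_zmul G
  obtain ⟨h, hh0, hh⟩ := sub_zmul H
  obtain ⟨b, hb⟩ : ∃ b : ℤ, (b + h*om D : KD D) ∈ M := (hh h).2 dvd_rfl
  have hgm : (g : KD D) ∈ M := (hg g).2 dvd_rfl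
  have hmul : ∀ (n : ℤ) {x : KD D}, x ∈ M → (n*x : KD D) ∈ M := by
    intro n x hx
    have := M.smul_mem n hx
    simpa using this
  refine ⟨g, b, h, hg0, hh0, le_antisymm ?_ ?_⟩
  · intro x hx
    obtain ⟨m,n,rfl⟩ := mem_pair.1 (hM hx)
    obtain ⟨k, rfl⟩ := (hh n).1 ⟨m, by simpa using hx⟩
    have : ((m - k*b : ℤ) : KD D) ∈ M := by
      have := M.sub_mem hx (hmul k hb)
      convert this using 1; push_cast; ring
    obtain ⟨l, hl⟩ := (hg _).1 this
    refine mem_pair.2 ⟨l, k, ?_⟩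
    have hl' : (m:KD D) - k*b = g*l := by exact_mod_cast hl
    push_cast
    linear_combination hl'
  · rw [Submodule.span_le]
    rintro x (hx|hx)
    · rw [hx]; exact hgm
    · rw [Set.mem_singleton_iff] at hx; rw [hx]; exact hb

def IsForm (w : CF) (ν α β : KD D) : Prop :=
  (w.a:ℚ) = tau (ν*α^3) ∧ (w.b:ℚ) = tau (ν*α^2*β) ∧ (w.c:ℚ) = tau (ν*α*β^2) ∧ (w.d:ℚ) = tau (ν*β^3)

lemma tau_add (x y : KD D) : tau (x+y) = tau x + tau y := by simp [tau]; ring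
lemma tau_imul (n : ℤ) (x : KD D) : tau ((n:KD D)*x) = (n:ℚ)*tau x := by simp [tau]; ring

lemma IsForm.act_form {w : CF} {ν α β : KD D} (h : IsForm w ν α β) (p q r s : ℤ) :
    IsForm (CF.act p q r s w) ν (p*α+q*β) (r*α+s*β) := by
  obtain ⟨h1,h2,h3,h4⟩ := h
  have key : ∀ (k l m n : ℤ), tau ((k:KD D)*(ν*α^3)+(l:KD D)*(ν*α^2*β)+(m:KD D)*(ν*α*β^2)+(n:KD D)*(ν*β^3)) =
      k*w.a+l*w.b+m*w.c+n*w.d := by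
    intro k l m n
    rw [tau_add, tau_add, tau_add, tau_imul, tau_imul, tau_imul, tau_imul, h1,h2,h3,h4]
  refine ⟨?_,?_,?_,?_⟩
  · have := key (p^3) (3*p^2*q) (3*p*q^2) (q^3)
    push_cast at this
    simp only [IsForm, CF.act]; push_cast
    rw [show ν*(p*α+q*β)^3 = (p^3:KD D)*(ν*α^3)+3*p^2*q*(ν*α^2*β)+3*p*q^2*(ν*α*β^2)+q^3*(ν*β^3) by ring]
    rw [this]; ring
  · have := key (p^2*r) (p^2*s+2*p*q*r) (2*p*q*s+q^2*r) (q^2*s)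
    push_cast at this
    simp only [IsForm, CF.act]; push_cast
    rw [show ν*(p*α+q*β)^2*(r*α+s*β) = (p^2*r:KD D)*(ν*α^3)+(p^2*s+2*p*q*r)*(ν*α^2*β)+(2*p*q*s+q^2*r)*(ν*α*β^2)+(q^2*s)*(ν*β^3) by ring]
    rw [this]; ring
  · have := key (p*r^2) (2*p*r*s+q*r^2) (p*s^2+2*q*r*s) (q*s^2)
    push_cast at this
    simp only [IsForm, CF.act]; push_cast
    rw [show ν*(p*α+q*β)*(r*α+s*β)^2 = (p*r^2:KD D)*(ν*α^3)+(2*p*r*s+q*r^2)*(ν*α^2*β)+(p*s^2+2*q*r*s)*(ν*α*β^2)+(q*s^2)*(ν*β^3) by ring]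
    rw [this]; ring
  · have := key (r^3) (3*r^2*s) (3*r*s^2) (s^3)
    push_cast at this
    simp only [IsForm, CF.act]; push_cast
    rw [show ν*(r*α+s*β)^3 = (r^3:KD D)*(ν*α^3)+3*r^2*s*(ν*α^2*β)+3*r*s^2*(ν*α*β^2)+s^3*(ν*β^3) by ring]
    rw [this]; ring
end
end DW

noncomputable section
namespace DW
open Submodule
section
variable {D : ℤ}

lemma nm_pow (x : KD D) (n : ℕ) : nm (x^n) = nm x^n := by
  induction n with
  | zero => rw [pow_zero, pow_zero, ← sc_one, nm_sc]; norm_num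
  | succ n ih => rw [pow_succ, nm_mul, ih, pow_succ]

lemma form_hA {w : CF} {ν α β : KD D} (h : IsForm w ν α β) :
    (w.hA:ℚ) = nm ν * tau (α*star β)^2 * nm α := by
  obtain ⟨h1,h2,h3,h4⟩ := h
  simp only [CF.hA]; push_cast
  rw [h1,h2,h3]
  simp [tau, nm, pow_succ]; ring
lemma form_hB {w : CF} {ν α β : KD D} (h : IsForm w ν α β) :
    (w.hB:ℚ) = nm ν * tau (α*star β)^2 * (2*(α*star β).re) := by
  obtain ⟨h1,h2,h3,h4⟩ := h
  simp only [CF.hB]; push_cast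
  rw [h1,h2,h3,h4]
  simp [tau, nm, pow_succ]; ring
lemma form_hC {w : CF} {ν α β : KD D} (h : IsForm w ν α β) :
    (w.hC:ℚ) = nm ν * tau (α*star β)^2 * nm β := by
  obtain ⟨h1,h2,h3,h4⟩ := h
  simp only [CF.hC]; push_cast
  rw [h2,h3,h4]
  simp [tau, nm, pow_succ]; ring
lemma form_Δ {w : CF} {ν α β : KD D} (h : IsForm w ν α β) :
    (w.Δ:ℚ) = (nm ν * tau (α*star β)^3)^2 * D := by
  simp only [CF.Δ]; push_cast
  rw [form_hA h, form_hB h, form_hC h]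
  have : (2*(α*star β).re)^2 - 4*nm α * nm β = D*tau (α*star β)^2 := by
    simp [tau, nm]; ring
  linear_combination (nm ν * tau (α*star β)^2)^2*this
lemma form_mu {w : CF} {ν α β : KD D} (h : IsForm w ν α β) (hW : nm ν * tau (α*star β)^3 = -1) :
    ν*α^3 = ⟨(2*w.b*w.hA - w.a*w.hB)/2, w.a/2⟩ ∧
    ν*α^2*β = ⟨(2*w.c*w.hA - w.b*w.hB)/2, w.b/2⟩ := by
  have hA := form_hA h
  have hB := form_hB h
  obtain ⟨h1,h2,h3,h4⟩ := h
  constructor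
  · ext
    · simp only
      rw [hA, hB, h1, h2]
      have : 2*tau (ν*α^2*β)*(nm ν * tau (α*star β)^2 * nm α) - tau (ν*α^3)*(nm ν * tau (α*star β)^2 * (2*(α*star β).re)) = -(nm ν * tau (α*star β)^3)*(2*(ν*α^3).re) := by
        simp [tau, nm, pow_succ]; ring
      rw [this, hW]; ring
    · simp only
      rw [h1]; simp [tau]
  · ext
    · simp only
      rw [hA, hB, h2, h3]
      have : 2*tau (ν*α*β^2)*(nm ν * tau (α*star β)^2 * nm α) - tau (ν*α^2*β)*(nm ν * tau (α*star β)^2 * (2*(α*star β).re)) = -(nm ν * tau (α*star β)^3)*(2*(ν*α^2*β).re) := by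
        simp [tau, nm, pow_succ]; ring
      rw [this, hW]; ring
    · simp only
      rw [h2]; simp [tau]

structure Dt (D n : ℤ) (J : Submodule ℤ (KD D)) (w : CF) (ν α β : KD D) (A : ℤ) : Prop where
  hform : IsForm w ν α β
  hle : span ℤ {α,β} ≤ eM D
  he : span ℤ {α,β} * eM D = span ℤ {α,β}
  hI : span ℤ {α,β} * span ℤ {star α, star β} = span ℤ {(A:KD D)} * eM D
  hτ : tau (α*star β) = -A
  hA : A ≠ 0
  hν : nm ν * A^3 = n
  hJ : span ℤ {ν} * span ℤ {α,β}^3 = J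

lemma span_pow (x : KD D) (n : ℕ) : span ℤ {x}^n = span ℤ {x^n} := by
  rw [Submodule.span_pow, Set.singleton_pow]

lemma Dt.JJ {n : ℤ} {J : Submodule ℤ (KD D)} {w : CF} {ν α β : KD D} {A : ℤ}
    (hD : (4:ℤ) ∣ D^2-D) (h : Dt D n J w ν α β A) : J * cM J = span ℤ {(n:KD D)} * eM D := by
  have hJ := h.hJ
  have h2 : cM J = span ℤ {star ν} * span ℤ {star α, star β}^3 := by
    rw [← hJ, cM_mul, cM_one, pow_succ, pow_succ, pow_one, cM_mul, cM_mul, cM_pair]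
    ring
  rw [h2, ← hJ]
  calc span ℤ {ν} * span ℤ {α,β}^3 * (span ℤ {star ν} * span ℤ {star α, star β}^3)
      = (span ℤ {ν} * span ℤ {star ν}) * (span ℤ {α,β} * span ℤ {star α, star β})^3 := by ring
    _ = (span ℤ {ν} * span ℤ {star ν}) * span ℤ {(A:KD D)}^3 * (eM D * eM D * eM D) := by
        rw [h.hI]; ring
    _ = _ := by
        rw [e_mul hD, e_mul hD, span1_mul, span_pow, span1_mul, mul_star']
        congr 3
        have := h.hν
        rw [← sc_int n, ← this, ← sc_mul]
        congr 1
        rw [show (A:ℚ)^3 = ((A^3:ℤ):ℚ) by push_cast; ring, sc_int]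
        push_cast; ring

lemma eJ {n : ℤ} {J : Submodule ℤ (KD D)} {w : CF} {ν α β : KD D} {A : ℤ}
    (h : Dt D n J w ν α β A) : J * eM D = J := by
  rw [← h.hJ]
  calc span ℤ {ν} * span ℤ {α,β}^3 * eM D = span ℤ {ν} * span ℤ {α,β}^2 * (span ℤ {α,β} * eM D) := by ring
    _ = _ := by rw [h.he]; ring

lemma cube_mem {I : Submodule ℤ (KD D)} {x y z u : KD D} (hx : x ∈ I) (hy : y ∈ I) (hz : z ∈ I) :
    u*(x*y*z) ∈ span ℤ {u} * I^3 := by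
  refine Submodule.mul_mem_mul (subset_span (by simp)) ?_
  rw [pow_succ, pow_succ, pow_one]
  exact Submodule.mul_mem_mul (Submodule.mul_mem_mul hx hy) hz

lemma comp {n : ℤ} {J : Submodule ℤ (KD D)} {w1 w2 : CF} {ν1 α1 β1 ν2 α2 β2 : KD D} {A1 A2 : ℤ}
    (hD : (4:ℤ) ∣ D^2-D) (hn : n ≠ 0)
    (h1 : Dt D n J w1 ν1 α1 β1 A1) (h2 : Dt D n J w2 ν2 α2 β2 A2) :
    ∃ (z : CF) (ν α β : KD D), IsForm z ν α β ∧ z.Δ = D ∧ nm ν * tau (α*star β)^3 = -1 ∧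
      tau (α * star β) = -(A1*A2) ∧ span ℤ {α,β} = span ℤ {α2,β2} * span ℤ {star α1, star β1} ∧
      nm α ≠ 0 ∧ ν * n = ν2 * star ν1 := by
  have hnQ : (n:ℚ) ≠ 0 := by exact_mod_cast hn
  have hA1 : (A1:ℚ) ≠ 0 := by exact_mod_cast h1.hA
  have hA2 : (A2:ℚ) ≠ 0 := by exact_mod_cast h2.hA
  obtain ⟨ν, hν⟩ : ∃ ν, ν = ν2 * star ν1 * sc D (n:ℚ)⁻¹ := ⟨_, rfl⟩
  have hνn : ν * n = ν2 * star ν1 := by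
    rw [hν, ← sc_int n, mul_assoc, sc_mul, inv_mul_cancel₀ hnQ, sc_one, mul_one]
  obtain ⟨I, hI⟩ : ∃ I, I = span ℤ {α2,β2} * span ℤ {star α1, star β1} := ⟨_, rfl⟩
  have hIe : I ≤ eM D := by
    rw [hI, ← e_mul hD]
    refine mul_le_mul' h2.hle ?_
    rw [← cM_pair, ← cM_e]
    exact Submodule.map_mono h1.hle
  have hcI : cM I = span ℤ {star α2, star β2} * span ℤ {α1, β1} := by
    rw [hI, cM_mul, cM_pair, cM_pair, star_star, star_star]
  have hII : I * cM I = span ℤ {sc D (A1*A2:ℚ)} * eM D := by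
    rw [hcI, hI]
    calc _ = (span ℤ {α2,β2} * span ℤ {star α2, star β2})*(span ℤ {α1,β1} * span ℤ {star α1, star β1}) := by ring
      _ = span ℤ {(A1:KD D)} * span ℤ {(A2:KD D)} * (eM D * eM D) := by rw [h1.hI, h2.hI]; ring
      _ = _ := by
        rw [e_mul hD, span1_mul, ← sc_int A1, ← sc_int A2, sc_mul]
  have hνI : span ℤ {ν} * I^3 = eM D := by
    have hJJ := h2.JJ hD
    apply span_unit (x := (n:KD D)) (by rw [← sc_int, nm_sc]; positivity)
    rw [← hJJ]
    rw [← mul_assoc, span1_mul, mul_comm (n:KD D), hνn, ← span1_mul]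
    have h3 : cM J = span ℤ {star ν1} * span ℤ {star α1, star β1}^3 := by
      rw [← h1.hJ, cM_mul, cM_one, pow_succ, pow_succ, pow_one, cM_mul, cM_mul, cM_pair]
      ring
    rw [h3, ← h2.hJ, hI]; ring
  have hnmν : nm ν * (A1*A2:ℚ)^3 = 1 := by
    have e1 := h1.hν
    have e2 := h2.hν
    rw [hν, nm_mul, nm_mul, nm_star, nm_sc]
    have : nm ν2 * nm ν1 * (A1*A2:ℚ)^3 = n*n := by
      rw [← e1]; nth_rewrite 2 [e1]; rw [← e2]; ring
    calc _ = (nm ν2 * nm ν1 * (A1*A2:ℚ)^3) * (n:ℚ)⁻¹^2 := by ring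
      _ = 1 := by rw [this]; field_simp
  obtain ⟨g, b, h, hg0, hh0, hgen⟩ := hermite I hIe
  -- choose sign
  obtain ⟨β, hβ, hW⟩ : ∃ β, I = span ℤ {(g:KD D), β} ∧ tau ((g:KD D) * star β) = -(A1*A2) := by
    have hL : span ℤ {(g:KD D), b + h*om D} * span ℤ {star (g:KD D), star (b + h*om D : KD D)} =
        span ℤ {sc D (A1*A2:ℚ)} * eM D := by
      rw [← cM_pair, ← hgen, hII]
    rcases lemL hL with hw | hw
    · refine ⟨-(b + h*om D), ?_, ?_⟩
      · rw [hgen]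
        apply le_antisymm
        · rw [Submodule.span_le]
          rintro x (hx|hx)
          · rw [hx]; exact subset_span (by simp)
          · rw [Set.mem_singleton_iff] at hx; rw [hx]; exact mem_pair.2 ⟨0,-1, by push_cast; ring⟩
        · rw [Submodule.span_le]
          rintro x (hx|hx)
          · rw [hx]; exact subset_span (by simp)
          · rw [Set.mem_singleton_iff] at hx; rw [hx]; exact mem_pair.2 ⟨0,-1, by push_cast; ring⟩
      · rw [← hw, star_neg, mul_neg]
        simp [tau]
    · exact ⟨_, hgen, hw⟩
  have hα : nm (g:KD D) ≠ 0 := by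
    rw [← sc_int, nm_sc]
    have : (g:ℚ) ≠ 0 := by
      intro h0
      have h0' : g = 0 := by exact_mod_cast h0
      rw [h0'] at hW
      simp [tau] at hW
      rcases hW with h|h
      · exact h1.hA h
      · exact h2.hA h
    positivity
  have hgI : (g:KD D) ∈ I := by rw [hβ]; exact subset_span (by simp)
  have hbI : β ∈ I := by rw [hβ]; exact subset_span (by simp)
  have mem : ∀ x ∈ I, ∀ y ∈ I, ∀ z ∈ I, ∃ m : ℤ, tau (ν*(x*y*z)) = m := by
    intro x hx y hy z hz
    apply tau_e
    rw [← hνI]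
    exact cube_mem hx hy hz
  obtain ⟨za, hza⟩ := mem _ hgI _ hgI _ hgI
  obtain ⟨zb, hzb⟩ := mem _ hgI _ hgI _ hbI
  obtain ⟨zc, hzc⟩ := mem _ hgI _ hbI _ hbI
  obtain ⟨zd, hzd⟩ := mem _ hbI _ hbI _ hbI
  have hF : IsForm (⟨za,zb,zc,zd⟩ : CF) ν (g:KD D) β := by
    refine ⟨?_,?_,?_,?_⟩
    · simp only; rw [← hza]; congr 1; ring
    · simp only; rw [← hzb]; congr 1; ring
    · simp only; rw [← hzc]; congr 1; ring
    · simp only; rw [← hzd]; congr 1; ring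
  have hW3 : nm ν * tau ((g:KD D) * star β)^3 = -1 := by
    rw [hW]; linear_combination -hnmν
  refine ⟨_, ν, g, β, hF, ?_, hW3, hW, by rw [← hβ, hI], hα, hνn⟩
  have := form_Δ hF
  rw [hW3] at this
  have h2 : ((⟨za,zb,zc,zd⟩ : CF).Δ : ℚ) = D := by rw [this]; ring
  exact_mod_cast h2

lemma comp_inj {n : ℤ} {J : Submodule ℤ (KD D)} {w1 w2 w3 z2 z3 : CF}
    {ν1 α1 β1 ν2 α2 β2 ν3 α3 β3 μ2 γ2 δ2 μ3 γ3 δ3 : KD D} {A1 A2 A3 : ℤ}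
    (hn : n ≠ 0)
    (h1 : Dt D n J w1 ν1 α1 β1 A1) (h2 : Dt D n J w2 ν2 α2 β2 A2) (h3 : Dt D n J w3 ν3 α3 β3 A3)
    (k2 : IsForm z2 μ2 γ2 δ2) (k2W : nm μ2 * tau (γ2*star δ2)^3 = -1)
    (k2w : tau (γ2 * star δ2) = -(A1*A2))
    (k2I : span ℤ {γ2,δ2} = span ℤ {α2,β2} * span ℤ {star α1, star β1})
    (k2ν : μ2 * n = ν2 * star ν1)
    (k3 : IsForm z3 μ3 γ3 δ3) (k3W : nm μ3 * tau (γ3*star δ3)^3 = -1)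
    (k3w : tau (γ3 * star δ3) = -(A1*A3))
    (k3I : span ℤ {γ3,δ3} = span ℤ {α3,β3} * span ℤ {star α1, star β1})
    (k3n : nm γ3 ≠ 0) (k3ν : μ3 * n = ν3 * star ν1)
    (hE : CF.Eqv z2 z3) : CF.Eqv w2 w3 := by
  have hnQ : (n:ℚ) ≠ 0 := by exact_mod_cast hn
  have hA1 : (A1:ℚ) ≠ 0 := by exact_mod_cast h1.hA
  have hA2 : (A2:ℚ) ≠ 0 := by exact_mod_cast h2.hA
  have hA3 : (A3:ℚ) ≠ 0 := by exact_mod_cast h3.hA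
  obtain ⟨p,q,r,s,hdet,rfl⟩ := hE
  have hdetQ : (p:ℚ)*s-q*r = 1 := by exact_mod_cast hdet
  have hdetK : (p:KD D)*s-q*r = 1 := by exact_mod_cast hdet
  have k4 := k2.act_form p q r s
  obtain ⟨γ, hγ⟩ : ∃ γ : KD D, γ = p*γ2+q*δ2 := ⟨_, rfl⟩
  obtain ⟨δ, hδ⟩ : ∃ δ : KD D, δ = r*γ2+s*δ2 := ⟨_, rfl⟩
  rw [← hγ, ← hδ] at k4
  have hτ : tau (γ * star δ) = tau (γ2 * star δ2) := by
    rw [hγ, hδ]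
    have : tau (((p:KD D)*γ2+(q:KD D)*δ2) * star ((r:KD D)*γ2+(s:KD D)*δ2)) = ((p:ℚ)*s-q*r)*tau (γ2*star δ2) := by
      simp [tau]; ring
    rw [this, hdetQ, one_mul]
  have hspan : span ℤ {γ,δ} = span ℤ {γ2,δ2} := by
    apply le_antisymm
    · rw [Submodule.span_le]
      rintro x (hx|hx)
      · rw [hx, hγ]; exact mem_pair.2 ⟨p,q,rfl⟩
      · rw [Set.mem_singleton_iff] at hx; rw [hx, hδ]; exact mem_pair.2 ⟨r,s,rfl⟩
    · rw [Submodule.span_le]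
      rintro x (hx|hx)
      · rw [hx]; refine mem_pair.2 ⟨s,-q,?_⟩
        rw [hγ, hδ]; push_cast; linear_combination (-γ2)*hdetK
      · rw [Set.mem_singleton_iff] at hx; rw [hx]; refine mem_pair.2 ⟨-r,p,?_⟩
        rw [hγ, hδ]; push_cast; linear_combination (-δ2)*hdetK
  have k4W : nm μ2 * tau (γ*star δ)^3 = -1 := by rw [hτ, k2W]
  obtain ⟨m0, m1⟩ := form_mu k4 k4W
  obtain ⟨m0', m1'⟩ := form_mu k3 k3W
  rw [← m0'] at m0
  rw [← m1'] at m1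
  have nμ3 : nm μ3 ≠ 0 := by intro h; rw [h] at k3W; simp at k3W
  have nμ2 : nm μ2 ≠ 0 := by intro h; rw [h] at k2W; simp at k2W
  have nγ : nm γ ≠ 0 := by
    intro h
    have := congrArg nm m0
    rw [nm_mul, nm_mul, nm_pow, nm_pow, h] at this
    simp [nμ3, k3n] at this
  obtain ⟨γi, hγi, hγin⟩ := exists_inv nγ
  obtain ⟨κ, hκ⟩ : ∃ κ, κ = γ3*γi := ⟨_, rfl⟩
  have hκγ : γ3 = κ*γ := by rw [hκ]; linear_combination (-γ3)*hγi
  have nκ : nm κ ≠ 0 := by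
    intro h; rw [hκγ, nm_mul, h, zero_mul] at k3n; exact k3n rfl
  have hμ : μ2 = κ^3*μ3 := by
    have : γ^3 * μ2 = γ^3*(κ^3*μ3) := by
      rw [hκγ] at m0; linear_combination m0
    exact cancel_nm (x := γ^3) (by rw [pow_succ, pow_succ, pow_one, nm_mul, nm_mul]; positivity) this
  have hδ3 : δ3 = κ*δ := by
    have : (μ3*γ3^2)*δ3 = (μ3*γ3^2)*(κ*δ) := by
      rw [← m1, hμ, hκγ]; ring
    exact cancel_nm (x := μ3*γ3^2) (by rw [pow_succ, pow_one, nm_mul, nm_mul]; positivity) this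
  have hν : ν2 = κ^3*ν3 := by
    have nν1 : nm (star ν1) ≠ 0 := by
      rw [nm_star]; intro h; have := h1.hν; rw [h] at this; simp at this; exact hnQ this.symm
    apply cancel_nm nν1
    linear_combination (n:KD D)*hμ - k2ν + κ^3*k3ν
  have hAκ : (A3:ℚ) = nm κ * A2 := by
    have : tau (γ3*star δ3) = nm κ * tau (γ*star δ) := by
      rw [hκγ, hδ3]
      simp [tau, nm]; ring
    rw [k3w, hτ, k2w] at this
    have h' : (A1:ℚ)*(A3 - nm κ*A2) = 0 := by linear_combination -this
    rcases mul_eq_zero.1 h' with h|h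
    · exact absurd h hA1
    · linarith
  have hI : span ℤ {α3,β3} = span ℤ {κ} * span ℤ {α2,β2} := by
    have e1 : span ℤ {α3,β3} * span ℤ {star α1, star β1} = span ℤ {κ} * (span ℤ {α2,β2} * span ℤ {star α1, star β1}) := by
      rw [← k3I, ← k2I, ← hspan, span1_pair, hκγ, hδ3]
    apply span_unit (x := (A1:KD D)) (by rw [← sc_int, nm_sc]; positivity)
    have e2 := congrArg (fun M => M * span ℤ {α1,β1}) e1
    beta_reduce at e2
    calc span ℤ {(A1:KD D)} * span ℤ {α3,β3} = (span ℤ {(A1:KD D)} * eM D) * span ℤ {α3,β3} := by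
          nth_rewrite 1 [← h3.he]; ring
      _ = span ℤ {α3,β3} * span ℤ {star α1, star β1} * span ℤ {α1,β1} := by rw [← h1.hI]; ring
      _ = _ := e2
      _ = span ℤ {κ} * span ℤ {α2,β2} * (span ℤ {α1,β1} * span ℤ {star α1, star β1}) := by ring
      _ = span ℤ {(A1:KD D)} * (span ℤ {κ} * (span ℤ {α2,β2} * eM D)) := by rw [h1.hI]; ring
      _ = _ := by rw [h2.he]
  rw [span1_pair] at hI
  obtain ⟨P,Q,hP⟩ := mem_pair.1 (show α3 ∈ span ℤ {κ*α2, κ*β2} by rw [← hI]; exact subset_span (by simp))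
  obtain ⟨R,S,hR⟩ := mem_pair.1 (show β3 ∈ span ℤ {κ*α2, κ*β2} by rw [← hI]; exact subset_span (by simp))
  have hd : P*S-Q*R = 1 := by
    have : tau (α3*star β3) = nm κ * (P*S-Q*R)*tau (α2*star β2) := by
      rw [hP, hR]
      simp [tau, nm]; ring
    rw [h3.hτ, h2.hτ, hAκ] at this
    have h' : (nm κ * A2)*(((P:ℚ)*S-Q*R) - 1) = 0 := by linear_combination this
    rcases mul_eq_zero.1 h' with h|h
    · exact absurd h (mul_ne_zero nκ hA2)
    · have : (P:ℚ)*S-Q*R = 1 := by linarith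
      exact_mod_cast this
  refine ⟨P,Q,R,S,hd,?_⟩
  obtain ⟨a1,a2,a3,a4⟩ := h2.hform.act_form P Q R S
  obtain ⟨b1,b2,b3,b4⟩ := h3.hform
  ext
  · have : ((CF.act P Q R S w2).a:ℚ) = w3.a := by
      rw [a1, b1]; congr 1; rw [hν, hP]; ring
    exact_mod_cast this
  · have : ((CF.act P Q R S w2).b:ℚ) = w3.b := by
      rw [a2, b2]; congr 1; rw [hν, hP, hR]; ring
    exact_mod_cast this
  · have : ((CF.act P Q R S w2).c:ℚ) = w3.c := by
      rw [a3, b3]; congr 1; rw [hν, hP, hR]; ring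
    exact_mod_cast this
  · have : ((CF.act P Q R S w2).d:ℚ) = w3.d := by
      rw [a4, b4]; congr 1; rw [hν, hR]; ring
    exact_mod_cast this

/-- classes with fixed `n, D, J` inject into classes of discriminant `D`. -/
lemma fixedJ {n : ℤ} {J : Submodule ℤ (KD D)} (hD : (4:ℤ) ∣ D^2-D) (hn : n ≠ 0)
    (S : Finset CF) (hS : CF.Ineq S) (h : ∀ w ∈ S, ∃ ν α β A, Dt D n J w ν α β A) :
    ∃ T : Finset CF, CF.Ineq T ∧ (∀ z ∈ T, z.Δ = D) ∧ T.card = S.card := by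
  rcases S.eq_empty_or_nonempty with rfl | ⟨w1, hw1⟩
  · exact ⟨∅, hS, by simp, rfl⟩
  obtain ⟨ν1,α1,β1,A1,h1⟩ := h w1 hw1
  have : ∀ w : CF, ∃ z : CF, w ∈ S → z.Δ = D ∧ ∃ ν2 α2 β2 A2 ν α β, Dt D n J w ν2 α2 β2 A2 ∧
      IsForm z ν α β ∧ nm ν * tau (α*star β)^3 = -1 ∧
      tau (α * star β) = -(A1*A2) ∧ span ℤ {α,β} = span ℤ {α2,β2} * span ℤ {star α1, star β1} ∧
      nm α ≠ 0 ∧ ν * n = ν2 * star ν1 := by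
    intro w
    by_cases hw : w ∈ S
    · obtain ⟨ν2,α2,β2,A2,h2⟩ := h w hw
      obtain ⟨z,ν,α,β,e1,e2,e3,e4,e5,e6,e7⟩ := comp hD hn h1 h2
      exact ⟨z, fun _ => ⟨e2,ν2,α2,β2,A2,ν,α,β,h2,e1,e3,e4,e5,e6,e7⟩⟩
    · exact ⟨w, fun h => absurd h hw⟩
  choose φ hφ using this
  obtain ⟨i1,i2⟩ := hS.image φ (by
    intro x hx y hy hxy
    obtain ⟨-,ν2,α2,β2,A2,ν,α,β,h2,e1,e3,e4,e5,e6,e7⟩ := hφ x hx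
    obtain ⟨-,ν3,α3,β3,A3,ν',α',β',h3,f1,f3,f4,f5,f6,f7⟩ := hφ y hy
    exact comp_inj hn h1 h2 h3 e1 e3 e4 e5 e7 f1 f3 f4 f5 f6 f7 hxy)
  refine ⟨S.image φ, i1, ?_, Finset.card_image_of_injOn i2⟩
  intro z hz
  obtain ⟨x,hx,rfl⟩ := Finset.mem_image.1 hz
  exact (hφ x hx).1
end
end DW

noncomputable section
namespace DW
open Submodule
section

lemma exDt (w : CF) (n A B C D : ℤ) (hn : 0 < n) (hA : w.hA = n*A) (hB : w.hB = n*B)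
    (hC : w.hC = n*C) (hA0 : A ≠ 0) (hD : D = B^2-4*A*C) (hg : ∃ x y z : ℤ, x*A+y*B+z*C = 1) :
    ∃ (J : Submodule ℤ (KD D)) (ν α β : KD D), Dt D n J w ν α β A ∧ J ≤ eM D := by
  have hnQ : (n:ℚ) ≠ 0 := by exact_mod_cast hn.ne'
  have hn0 := hn.ne'
  have hAQ : (A:ℚ) ≠ 0 := by exact_mod_cast hA0
  have s1 : w.a*C - w.b*B+w.c*A = 0 := by
    have := w.syz1; rw [hA,hB,hC] at this
    have h : n*(w.a*C - w.b*B+w.c*A) = 0 := by linear_combination this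
    exact (mul_eq_zero.1 h).resolve_left hn0
  have s2 : w.b*C - w.c*B+w.d*A = 0 := by
    have := w.syz2; rw [hA,hB,hC] at this
    have h : n*(w.b*C - w.c*B+w.d*A) = 0 := by linear_combination this
    exact (mul_eq_zero.1 h).resolve_left hn0
  have s3 : w.b^2*A - w.a*w.b*B+w.a^2*C = n*A^2 := by
    have h : n*(w.b^2*A - w.a*w.b*B+w.a^2*C - n*A^2) = 0 := by
      have : w.b^2*w.hA - w.a*w.b*w.hB+w.a^2*w.hC = w.hA^2 := by
        simp only [CF.hA, CF.hB, CF.hC]; ring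
      rw [hA,hB,hC] at this
      linear_combination this
    have := (mul_eq_zero.1 h).resolve_left hn0
    linarith
  have hDQ : (D:ℚ) = B^2-4*A*C := by exact_mod_cast hD
  have s1Q : (w.a:ℚ)*C - w.b*B+w.c*A = 0 := by exact_mod_cast s1
  have s2Q : (w.b:ℚ)*C - w.c*B+w.d*A = 0 := by exact_mod_cast s2
  have s3Q : (w.b:ℚ)^2*A - w.a*w.b*B+w.a^2*C = n*A^2 := by exact_mod_cast s3
  obtain ⟨β, hβ⟩ : ∃ β : KD D, β = ⟨(B:ℚ)/2, 1/2⟩ := ⟨_, rfl⟩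
  obtain ⟨ν, hν⟩ : ∃ ν : KD D, ν = (w.b*A - w.a*star β) * sc D ((A:ℚ)^3)⁻¹ := ⟨_, rfl⟩
  have bb : β * star β = (A:KD D)*C := by
    rw [hβ]; ext
    · simp; linear_combination (-1/4)*hDQ
    · simp; ring
  have bs : star β = B - β := by
    rw [hβ]; ext <;> simp; ring
  have hA3 : sc D ((A:ℚ)^3)⁻¹ * (A:KD D)^3 = 1 := by
    have : (A:KD D)^3 = sc D ((A:ℚ)^3) := by
      rw [show (A:ℚ)^3 = ((A^3:ℤ):ℚ) by push_cast; ring, sc_int]; push_cast; ring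
    rw [this, sc_mul, inv_mul_cancel₀ (by positivity), sc_one]
  have nA : nm (A:KD D) ≠ 0 := by rw [← sc_int, nm_sc]; positivity
  have s1K : (w.a:KD D)*C - w.b*B+w.c*A = 0 := by exact_mod_cast s1
  have s2K : (w.b:KD D)*C - w.c*B+w.d*A = 0 := by exact_mod_cast s2
  have m0 : ν*(A:KD D)^3 = w.b*A - w.a*star β := by
    rw [hν, mul_assoc, hA3, mul_one]
  have m1 : ν*(A:KD D)^2*β = w.c*A - w.b*star β := by
    apply cancel_nm nA
    linear_combination β*m0 - (w.a:KD D)*bb + (w.b*A:KD D)*bs - (A:KD D)*s1K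
  have m2 : ν*(A:KD D)*β^2 = w.d*A - w.c*star β := by
    apply cancel_nm nA
    linear_combination β*m1 - (w.b:KD D)*bb + (w.c*A:KD D)*bs - (A:KD D)*s2K
  have m3 : ν*β^3 = w.d*β - w.c*C := by
    apply cancel_nm nA
    linear_combination β*m2 - (w.c:KD D)*bb
  obtain ⟨k, hk⟩ : ∃ k : ℤ, B - D = 2*k := by
    have : (2:ℤ) ∣ B - D := by
      rw [hD, show B - (B^2-4*A*C) = 2*(2*A*C) - (B-1)*B by ring]
      apply dvd_sub (dvd_mul_right _ _)
      have := Int.even_mul_pred_self B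
      rw [mul_comm]; exact this.two_dvd
    exact this
  have hkQ : (B:ℚ) - D = 2*k := by exact_mod_cast hk
  have bo : β = k + om D := by
    rw [hβ]; ext
    · simp [om]; linarith
    · simp [om]
  have hle : span ℤ {(A:KD D), β} ≤ eM D := by
    rw [Submodule.span_le]
    rintro x (hx|hx)
    · rw [hx]; exact e_int A
    · rw [Set.mem_singleton_iff] at hx; rw [hx, bo]; exact mem_pair.2 ⟨k,1, by simp⟩
  have bmem : β ∈ eM D := hle (subset_span (by simp))
  have bsmem : star β ∈ eM D := by
    rw [bs, bo]; exact mem_pair.2 ⟨B-k,-1, by push_cast; ring⟩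
  have imul : ∀ (n : ℤ) {x : KD D}, x ∈ eM D → (n:KD D)*x ∈ eM D := by
    intro n x hx; have := (eM D).smul_mem n hx; simpa using this
  refine ⟨span ℤ {ν} * span ℤ {(A:KD D), β}^3, ν, A, β, ⟨?_, hle, ?_, ?_, ?_, hA0, ?_, rfl⟩, ?_⟩
  · refine ⟨?_,?_,?_,?_⟩
    · rw [m0, hβ]; simp [tau]; ring
    · rw [m1, hβ]; simp [tau]; ring
    · rw [m2, hβ]; simp [tau]; ring
    · rw [m3, hβ]; simp [tau]; ring
  · apply le_antisymm
    · rw [Submodule.mul_le]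
      intro x hx y hy
      obtain ⟨m,l,rfl⟩ := mem_pair.1 hx
      obtain ⟨m',l',rfl⟩ := mem_pair.1 hy
      have h1 : om D = β - k := by rw [bo]; ring
      have h2 : β*β = B*β - A*C := by linear_combination β*bs - bb
      refine mem_pair.2 ⟨m*m' - m*l'*k - l*l'*C, l*m' + m*l'*A +l*l'*(B-k), ?_⟩
      rw [h1]; push_cast
      linear_combination ((l:KD D)*l')*h2
    · intro x hx
      rw [← mul_one x]
      exact Submodule.mul_mem_mul hx e_one
  · apply le_antisymm
    · rw [Submodule.mul_le]
      intro x hx y hy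
      obtain ⟨m,l,rfl⟩ := mem_pair.1 hx
      obtain ⟨m',l',rfl⟩ := mem_pair.1 hy
      have : (m*A+l*β)*((m':KD D)*star (A:KD D)+l'*star β) = A*((m*m'*A + l*l'*C + m*l'*B : ℤ) + (l*m'-m*l' : ℤ)*β) := by
        rw [show star (A:KD D) = A by simp, bs]; push_cast
        rw [bs] at bb
        linear_combination ((l:KD D)*l')*bb
      rw [this]
      exact Submodule.mul_mem_mul (subset_span (by simp)) ((eM D).add_mem (e_int _) (imul _ bmem))
    · rw [eM, span1_pair, Submodule.span_le]
      obtain ⟨x,y,z,hxyz⟩ := hg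
      have hxK : (x:KD D)*A+y*B+z*C=1 := by exact_mod_cast hxyz
      obtain ⟨P, hP⟩ : ∃ P, P = span ℤ {(A:KD D), β} * span ℤ {star (A:KD D), star β} := ⟨_, rfl⟩
      have pmul : ∀ (n : ℤ) {x : KD D}, x ∈ P → (n:KD D)*x ∈ P := by
        intro n x hx; have := P.smul_mem n hx; simpa using this
      have p1 : (A:KD D)*A ∈ P := by
        rw [hP]
        have : (A:KD D) = star (A:KD D) := by simp
        nth_rewrite 2 [this]
        exact Submodule.mul_mem_mul (subset_span (by simp)) (subset_span (by simp))
      have p2 : (A:KD D)*star β ∈ P := by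
        rw [hP]
        exact Submodule.mul_mem_mul (subset_span (by simp)) (subset_span (by simp))
      have p3 : β*A ∈ P := by
        rw [hP]
        have : (A:KD D) = star (A:KD D) := by simp
        nth_rewrite 1 [this]
        exact Submodule.mul_mem_mul (subset_span (by simp)) (subset_span (by simp))
      have p4 : β*star β ∈ P := by
        rw [hP]
        exact Submodule.mul_mem_mul (subset_span (by simp)) (subset_span (by simp))
      have pA : (A:KD D) ∈ P := by
        have := P.add_mem (P.add_mem (pmul x p1) (pmul y (P.add_mem p2 p3))) (pmul z p4)
        have e : (A:KD D) = x*(A*A) + y*(A*star β + β*A)+z*(β*star β) := by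
          rw [bb]; linear_combination (-(A:KD D))*hxK - (y:KD D)*A*bs
        rw [e]; exact this
      rw [← hP]
      rintro t (ht|ht)
      · rw [ht, mul_one]; exact pA
      · rw [Set.mem_singleton_iff] at ht; rw [ht]
        have := P.sub_mem p3 (pmul k pA)
        rw [show (A:KD D)*om D = β*A - k*A by rw [bo]; ring]
        exact this
  · rw [hβ]; simp [tau]; ring
  · rw [hν, nm_mul, nm_sc]
    have : nm ((w.b:KD D)*(A:KD D) - (w.a:KD D)*star β) = (n:ℚ)*A^3 := by
      rw [hβ]; simp [nm]
      linear_combination (-(w.a:ℚ)^2/4)*hDQ + A*s3Q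
    rw [this]; field_simp
  · have hmu : ∀ u ∈ ({ν*(A:KD D)^3, ν*(A:KD D)^2*β, ν*(A:KD D)*β^2, ν*β^3} : Set (KD D)), u ∈ eM D := by
      rintro u (h|h|h|h)
      · rw [h, m0]; exact (eM D).sub_mem (imul _ (e_int A)) (imul _ bsmem)
      · rw [h, m1]; exact (eM D).sub_mem (imul _ (e_int A)) (imul _ bsmem)
      · rw [h, m2]; exact (eM D).sub_mem (imul _ (e_int A)) (imul _ bsmem)
      · rw [Set.mem_singleton_iff] at h
        rw [h, m3]; exact (eM D).sub_mem (imul _ bmem) (imul _ (e_int C))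
    simp only [Set.mem_insert_iff, Set.mem_singleton_iff] at hmu
    rw [pow_succ, pow_succ, pow_one, Submodule.span_mul_span, Submodule.span_mul_span, Submodule.span_mul_span, Submodule.span_le]
    rintro x ⟨u, hu, v, ⟨y, ⟨z, hz, z', hz', rfl⟩, z'', hz'', rfl⟩, rfl⟩
    simp only [Set.mem_insert_iff, Set.mem_singleton_iff] at hu hz hz' hz''
    apply hmu
    rcases hz with rfl|rfl <;> rcases hz' with rfl|rfl <;> rcases hz'' with rfl|rfl <;> rw [hu] <;> simp only
    · left; ring
    · right; left; ring
    · right; left; ring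
    · right; right; left; ring
    · right; left; ring
    · right; right; left; ring
    · right; right; left; ring
    · right; right; right; ring

lemma Jform {D n : ℤ} {J : Submodule ℤ (KD D)} (hn : 0 < n) (hD : (4:ℤ) ∣ D^2-D)
    (hJ : J ≤ eM D) (he : J * eM D = J) (hJJ : J * cM J = span ℤ {(n:KD D)} * eM D) :
    ∃ e0 m t : ℤ, 0 < e0 ∧ 0 < m ∧ n = e0^2*m ∧ 0 ≤ t ∧ t < m ∧ m ∣ t^2+D*t+(D^2-D)/4 ∧
      J = span ℤ {((e0*m:ℤ):KD D), (e0:KD D)*(t+om D)} := by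
  obtain ⟨k, hk4, hk⟩ := om_mul hD
  have hk' : (D^2-D)/4 = k := by rw [hk4]; simp
  rw [hk']
  obtain ⟨g,b,h,hg0,hh0,hJ2⟩ := hermite J hJ
  have hcoef : ∀ {x y x' y' : ℤ}, (x:KD D)+y*om D = x'+y'*om D → x = x' ∧ y = y' := by
    intro x y x' y' h
    have h1 := congrArg QuadraticAlgebra.im h
    have h2 := congrArg QuadraticAlgebra.re h
    simp [om] at h1 h2
    rw [h1] at h2
    simp at h2
    exact ⟨h2, h1⟩
  have hL : tau ((g:KD D) * star (b+h*om D:KD D)) = n ∨ tau ((g:KD D) * star (b+h*om D:KD D)) = -n := by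
    apply lemL
    rw [← cM_pair, ← hJ2, hJJ, sc_int]
  have hgh : g*h = n := by
    have : tau ((g:KD D) * star (b+h*om D:KD D)) = -(g*h:ℤ) := by simp [tau, om]; ring
    rw [this] at hL
    have hL' : -(g*h) = n ∨ -(g*h) = -n := by exact_mod_cast hL
    have := mul_nonneg hg0 hh0
    omega
  have hh : 0 < h := lt_of_le_of_ne hh0 (by rintro rfl; simp at hgh; omega)
  have hg : 0 < g := lt_of_le_of_ne hg0 (by rintro rfl; simp at hgh; omega)
  -- h ∣ g
  have d1 : h ∣ g := by
    have : (g:KD D)*om D ∈ J := by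
      rw [← he]
      exact Submodule.mul_mem_mul (by rw [hJ2]; exact subset_span (by simp)) e_om
    rw [hJ2] at this
    obtain ⟨x,y,hxy⟩ := mem_pair.1 this
    have := hcoef (x := 0) (y := g) (x' := x*g+y*b) (y' := y*h) (by push_cast; linear_combination hxy)
    exact ⟨y, by rw [this.2]; ring⟩
  have d2 : h ∣ b := by
    have : (b+h*om D:KD D)*om D ∈ J := by
      rw [← he]
      exact Submodule.mul_mem_mul (by rw [hJ2]; exact subset_span (by simp)) e_om
    rw [hJ2] at this
    obtain ⟨x,y,hxy⟩ := mem_pair.1 this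
    have := hcoef (x := -h*k) (y := b+h*D) (x' := x*g+y*b) (y' := y*h)
      (by push_cast; linear_combination hxy - (h:KD D)*hk)
    exact ⟨y-D, by linear_combination this.2⟩
  obtain ⟨m, rfl⟩ := d1
  obtain ⟨t, rfl⟩ := d2
  have hm : 0 < m := by
    by_contra hm; push Not at hm; nlinarith
  have hn2 : n = h^2*m := by rw [← hgh]; ring
  have hdv : m ∣ t^2+D*t+k := by
    have : ((h*t:ℤ)+h*om D:KD D)*star ((h*t:ℤ)+h*om D:KD D) ∈ J * cM J := by
      refine Submodule.mul_mem_mul (by rw [hJ2]; exact subset_span (by simp)) ?_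
      rw [hJ2, cM_pair]; exact subset_span (by simp)
    rw [hJJ, eM, span1_pair] at this
    obtain ⟨x,y,hxy⟩ := mem_pair.1 this
    have e : ((h*t:ℤ)+h*om D:KD D)*star ((h*t:ℤ)+h*om D:KD D) = ((h^2*(t^2+D*t+k):ℤ):KD D) := by
      rw [star_add, star_mul, star_om, show star ((h*t:ℤ):KD D) = ((h*t:ℤ):KD D) by simp, show star (h:KD D) = h by simp]
      push_cast
      linear_combination (-(h:KD D)^2)*hk
    rw [e] at hxy
    have := hcoef (x := h^2*(t^2+D*t+k)) (y := 0) (x' := x*n) (y' := y*n)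
      (by push_cast at hxy ⊢; linear_combination hxy)
    refine ⟨x, ?_⟩
    have h3 : h^2*(t^2+D*t+k - m*x) = 0 := by
      have := this.1; rw [hn2] at this; linear_combination this
    rcases mul_eq_zero.1 h3 with h4|h4
    · exact absurd h4 (by positivity)
    · linarith
  have hemod := Int.emod_add_mul_ediv t m
  refine ⟨h, m, t % m, hh, hm, hn2, Int.emod_nonneg _ hm.ne', Int.emod_lt_of_pos _ hm, ?_, ?_⟩
  · obtain ⟨c, hc⟩ : ∃ c, c = t/m := ⟨_, rfl⟩
    rw [← hc] at hemod
    have : t % m = t - m*c := by linarith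
    rw [this, show (t-m*c)^2+D*(t-m*c)+k = (t^2+D*t+k) + m*(-2*t*c+m*c^2-D*c) by ring]
    exact dvd_add hdv (dvd_mul_right _ _)
  · obtain ⟨c, hc⟩ : ∃ c, c = t/m := ⟨_, rfl⟩
    rw [← hc] at hemod
    have e : ((t % m : ℤ):KD D) = t - m*c := by
      have : t % m = t - m*c := by linarith
      rw [this]; push_cast; ring
    rw [hJ2, e]
    apply le_antisymm
    · rw [Submodule.span_le]
      rintro x (hx|hx)
      · rw [hx]; exact subset_span (by simp)
      · rw [Set.mem_singleton_iff] at hx; rw [hx]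
        exact mem_pair.2 ⟨c, 1, by push_cast; ring⟩
    · rw [Submodule.span_le]
      rintro x (hx|hx)
      · rw [hx]; exact subset_span (by simp)
      · rw [Set.mem_singleton_iff] at hx; rw [hx]
        exact mem_pair.2 ⟨-c, 1, by push_cast; ring⟩
end
end DW

noncomputable section
namespace DW

def sqd (n : ℕ) : ℕ := ((Finset.range (n+1)).filter (fun g => g^2 ∣ n)).sup id

lemma le_sqd {n g : ℕ} (hn : 0 < n) (h : g^2 ∣ n) : g ≤ sqd n := by
  have hg : g ≤ n := by
    have := Nat.le_of_dvd hn h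
    nlinarith
  exact Finset.le_sup (f := id) (Finset.mem_filter.2 ⟨Finset.mem_range.2 (by omega), h⟩)

lemma sqd_sq_dvd {n : ℕ} : (sqd n)^2 ∣ n := by
  have hne : ((Finset.range (n+1)).filter (fun g => g^2 ∣ n)).Nonempty := by
    rcases Nat.eq_zero_or_pos n with rfl|h
    · exact ⟨0, by simp⟩
    · exact ⟨1, by simp; omega⟩
  obtain ⟨g, hg, e⟩ := Finset.exists_mem_eq_sup _ hne id
  unfold sqd
  rw [e]
  exact (Finset.mem_filter.1 hg).2

lemma sqd_mono {m n : ℕ} (hn : 0 < n) (h : m ∣ n) : sqd m ≤ sqd n :=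
  le_sqd hn (sqd_sq_dvd.trans h)

/-- numbers below `L*g` in one residue class mod `L`. -/
lemma card_class (F : Finset ℕ) (L g : ℕ) (hL : 0 < L) (h1 : ∀ t ∈ F, t < L*g)
    (h2 : ∀ t ∈ F, ∀ t' ∈ F, t % L = t' % L) : F.card ≤ g := by
  rw [← Finset.card_range g]
  refine Finset.card_le_card_of_injOn (fun t => t / L) ?_ ?_
  · intro t ht
    simp only [Finset.coe_range, Set.mem_Iio]
    exact Nat.div_lt_of_lt_mul (h1 t ht)
  · intro t ht t' ht' e
    simp only at e
    have := h2 t ht t' ht'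
    rw [← Nat.div_add_mod t L, ← Nat.div_add_mod t' L, e, this]

lemma rho_bound (m : ℕ) (hm : 0 < m) (D k : ℤ) (R : Finset ℕ)
    (hR : ∀ t ∈ R, t < m ∧ (m:ℤ) ∣ (t:ℤ)^2+D*t+k) : (R.card : ℝ) ≤ m.divisors.card * sqd m := by
  rcases R.eq_empty_or_nonempty with rfl | ⟨t0, ht0⟩
  · simp; positivity
  have := card_le_fib R (fun t => Int.gcd ((t:ℤ)-t0) m) m.divisors (fun _ => (sqd m:ℝ))
    (by
      intro t ht
      rw [Nat.mem_divisors]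
      refine ⟨?_, hm.ne'⟩
      have := Int.gcd_dvd_right ((t:ℤ)-t0) (m:ℤ)
      exact_mod_cast this)
    (by
      intro d hd F hF hFd
      have hdm := (Nat.mem_divisors.1 hd).1
      obtain ⟨m', rfl⟩ := hdm
      have hd0 : 0 < d := Nat.pos_of_mul_pos_right hm |> fun h => by
        rcases Nat.eq_zero_or_pos d with rfl|h
        · simp at hm
        · exact h
      have hm0 : 0 < m' := by
        rcases Nat.eq_zero_or_pos m' with rfl|h
        · simp at hm
        · exact h
      have hL : 0 < Nat.lcm d m' := Nat.lcm_pos hd0 hm0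
      have key := card_class F (Nat.lcm d m') (Nat.gcd d m') hL
        (by
          intro t ht
          rw [mul_comm, Nat.gcd_mul_lcm]
          exact (hR t (hF ht)).1)
        (by
          intro t ht t' ht'
          have c1 : ∀ t ∈ F, (d:ℤ) ∣ (t:ℤ) - t0 ∧ (m':ℤ) ∣ (t:ℤ)+t0+D := by
            intro t ht
            have e := hFd t ht
            have h1 : (d:ℤ) ∣ (t:ℤ) - t0 := by
              rw [← e]; exact Int.gcd_dvd_left _ _
            refine ⟨h1, ?_⟩
            have h2 : ((d*m':ℕ):ℤ) ∣ ((t:ℤ)-t0)*((t:ℤ)+t0+D) := by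
              have := dvd_sub (hR t (hF ht)).2 (hR t0 ht0).2
              rw [show ((t:ℤ)-t0)*((t:ℤ)+t0+D) = ((t:ℤ)^2+D*t+k) - ((t0:ℤ)^2+D*t0+k) by ring]
              exact this
            obtain ⟨u, hu⟩ := h1
            have hco : Int.gcd u m' = 1 := by
              rw [hu] at e
              push_cast at e
              rw [Int.gcd_mul_left] at e
              simp only [Int.natAbs_natCast] at e
              have e' : d * u.gcd m' = d * 1 := by omega
              exact Nat.eq_of_mul_eq_mul_left hd0 e'
            rw [hu] at h2
            push_cast at h2
            rw [mul_assoc] at h2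
            have h3 := Int.dvd_of_mul_dvd_mul_left (by exact_mod_cast hd0.ne') h2
            exact Int.dvd_of_dvd_mul_right_of_gcd_one h3 (by rw [Int.gcd_comm]; exact hco)
          have a := c1 t ht
          have b := c1 t' ht'
          have x1 : (d:ℤ) ∣ (t:ℤ) - t' := by
            have := dvd_sub a.1 b.1; simpa using this
          have x2 : (m':ℤ) ∣ (t:ℤ) - t' := by
            have := dvd_sub a.2 b.2
            rw [show (t:ℤ)-t' = (t+t0+D) - (t'+t0+D) by ring]; exact this
          have y1 : t' ≡ t [MOD d] := (Nat.modEq_iff_dvd).2 x1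
          have y2 : t' ≡ t [MOD m'] := (Nat.modEq_iff_dvd).2 x2
          have := Nat.mod_lcm y1 y2
          exact this.symm)
      have : F.card ≤ sqd (d*m') := key.trans (le_sqd hm (by
        rw [sq]; exact Nat.mul_dvd_mul (Nat.gcd_dvd_left _ _) (Nat.gcd_dvd_right _ _)))
      exact_mod_cast this)
  rw [Finset.sum_const, nsmul_eq_mul] at this
  exact this

def ND (D : ℤ) : ℕ := sSup {k | ∃ T : Finset CF, CF.Ineq T ∧ (∀ z ∈ T, z.Δ = D) ∧ T.card = k}

lemma ND_bdd {D : ℤ} (hD : D ≠ 0) :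
    BddAbove {k | ∃ T : Finset CF, CF.Ineq T ∧ (∀ z ∈ T, z.Δ = D) ∧ T.card = k} := by
  refine ⟨⌊(82000*|(D:ℝ)|)⌋₊, ?_⟩
  rintro k ⟨T, hT, hz, rfl⟩
  apply Nat.le_floor
  apply CF.davenport T hT _ (abs_nonneg _)
  intro w hw
  rw [hz w hw]
  exact ⟨hD, le_refl _⟩

lemma le_ND {D : ℤ} (hD : D ≠ 0) {T : Finset CF} (hT : CF.Ineq T) (hz : ∀ z ∈ T, z.Δ = D) :
    T.card ≤ ND D := le_csSup (ND_bdd hD) ⟨T, hT, hz, rfl⟩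

lemma ND_att {D : ℤ} (hD : D ≠ 0) : ∃ T : Finset CF, CF.Ineq T ∧ (∀ z ∈ T, z.Δ = D) ∧ T.card = ND D :=
  Nat.sSup_mem (s := {k | ∃ T : Finset CF, CF.Ineq T ∧ (∀ z ∈ T, z.Δ = D) ∧ T.card = k})
    ⟨0, ∅, by intro x hx; simp at hx, by simp, rfl⟩ (ND_bdd hD)

lemma ND_sum (t : Finset ℤ) (Y : ℝ) (hY : 0 ≤ Y) (h : ∀ D ∈ t, D ≠ 0 ∧ |(D:ℝ)| ≤ Y) :
    ∑ D ∈ t, (ND D : ℝ) ≤ 82000*Y := by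
  have : ∀ D : ℤ, ∃ T : Finset CF, D ≠ 0 → CF.Ineq T ∧ (∀ z ∈ T, z.Δ = D) ∧ T.card = ND D := by
    intro D
    by_cases hD : D = 0
    · exact ⟨∅, fun h => absurd hD h⟩
    · obtain ⟨T, hT⟩ := ND_att hD
      exact ⟨T, fun _ => hT⟩
  choose T hT using this
  have hc : (t.biUnion T).card = ∑ D ∈ t, ND D := by
    rw [Finset.card_biUnion]
    · exact Finset.sum_congr rfl fun D hD => (hT D (h D hD).1).2.2
    · intro x hx y hy hxy
      rw [Function.onFun, Finset.disjoint_left]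
      intro z hz hz'
      apply hxy
      rw [← (hT x (h x hx).1).2.1 z hz, ← (hT y (h y hy).1).2.1 z hz']
  have := CF.davenport (t.biUnion T) (by
      intro x hx y hy e
      rw [Finset.mem_biUnion] at hx hy
      obtain ⟨D, hD, hx⟩ := hx
      obtain ⟨D', hD', hy⟩ := hy
      have e1 := (hT D (h D hD).1).2.1 x hx
      have e2 := (hT D' (h D' hD').1).2.1 y hy
      have e3 := e.Δ_eq
      rw [e1, e2] at e3
      subst e3
      exact (hT _ (h _ hD).1).1 x hx y hy e) Y hY (by
      intro w hw
      rw [Finset.mem_biUnion] at hw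
      obtain ⟨D, hD, hw⟩ := hw
      have e1 := (hT D (h D hD).1).2.1 w hw
      rw [e1]; exact h D hD)
  rw [hc] at this
  exact_mod_cast this

/-- `w` has Hessian `n * (primitive form of discriminant D)` -/
def HasND (n : ℕ) (D : ℤ) (w : CF) : Prop :=
  ∃ A B C : ℤ, w.hA = n*A ∧ w.hB = n*B ∧ w.hC = n*C ∧ D = B^2-4*A*C ∧ ∃ x y z : ℤ, x*A+y*B+z*C = 1

lemma HasND.Δ_eq {n : ℕ} {D : ℤ} {w : CF} (h : HasND n D w) : w.Δ = n^2*D := by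
  obtain ⟨A,B,C,h1,h2,h3,h4,-⟩ := h
  rw [h4]; unfold CF.Δ; rw [h1,h2,h3]; ring

lemma fixedND (n : ℕ) (hn : 0 < n) (D : ℤ) (hD0 : D ≠ 0) (S : Finset CF) (hS : CF.Ineq S)
    (h : ∀ w ∈ S, w.hA ≠ 0 ∧ HasND n D w) :
    (S.card : ℝ) ≤ n.divisors.card^2 * sqd n * ND D := by
  rcases S.eq_empty_or_nonempty with rfl | ⟨w0, hw0⟩
  · simp; positivity
  have hD : (4:ℤ) ∣ D^2-D := by
    obtain ⟨-,A,B,C,-,-,-,h4,-⟩ := h w0 hw0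
    have : D^2 - D = 4*(4*A^2*C^2 - 2*B^2*A*C + A*C) + (B^2-1)*B^2 := by rw [h4]; ring
    rw [this]
    refine dvd_add (dvd_mul_right _ _) ?_
    rcases Int.even_or_odd' B with ⟨c, rfl|rfl⟩
    · exact ⟨((2*c)^2-1)*c^2, by ring⟩
    · exact ⟨(c^2+c)*(2*c+1)^2, by ring⟩
  have hkey : ∀ w : CF, ∃ key : (_ : ℕ) × ℕ, w ∈ S → (key.1 ∈ n.divisors ∧ key.2 < key.1 ∧
      (key.1:ℤ) ∣ (key.2:ℤ)^2+D*key.2+(D^2-D)/4) ∧ ∃ e0 : ℕ, n = e0^2*key.1 ∧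
      ∃ ν α β A, Dt D n (Submodule.span ℤ {((e0*key.1:ℤ):KD D), (e0:KD D)*(key.2+om D)}) w ν α β A := by
    intro w
    by_cases hw : w ∈ S
    · obtain ⟨hA0, A,B,C,h1,h2,h3,h4,hg⟩ := h w hw
      have hA : A ≠ 0 := by rintro rfl; simp at h1; exact hA0 h1
      have hn' : (0:ℤ) < n := by exact_mod_cast hn
      obtain ⟨J,ν,α,β,hDt,hJ⟩ := exDt w n A B C D hn' h1 h2 h3 hA h4 hg
      obtain ⟨e0,m,t,i1,i2,i3,i4,i5,i6,i7⟩ := Jform hn' hD hJ (eJ hDt) (hDt.JJ hD)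
      lift e0 to ℕ using i1.le
      lift m to ℕ using i2.le
      lift t to ℕ using i4
      refine ⟨⟨m,t⟩, fun _ => ⟨⟨?_,?_,?_⟩,e0,?_,ν,α,β,A,?_⟩⟩
      · rw [Nat.mem_divisors]; exact ⟨⟨e0^2, by rw [mul_comm]; exact_mod_cast i3⟩, hn.ne'⟩
      · exact_mod_cast i5
      · exact i6
      · exact_mod_cast i3
      · rw [i7] at hDt; simpa using hDt
    · exact ⟨⟨0,0⟩, fun h => absurd h hw⟩
  choose key hk using hkey
  let R : ℕ → Finset ℕ := fun m => (Finset.range m).filter fun t => (m:ℤ) ∣ (t:ℤ)^2+D*t+(D^2-D)/4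
  have := card_le_fib S key (n.divisors.sigma R) (fun _ => (ND D:ℝ))
    (by
      intro w hw
      have := (hk w hw).1
      rw [Finset.mem_sigma]
      exact ⟨this.1, Finset.mem_filter.2 ⟨Finset.mem_range.2 this.2.1, this.2.2⟩⟩)
    (by
      rintro ⟨m,t⟩ hmt F hF hFk
      have hm : m ∈ n.divisors := (Finset.mem_sigma.1 hmt).1
      have hm0 : 0 < m := Nat.pos_of_mem_divisors hm
      rcases F.eq_empty_or_nonempty with rfl | ⟨w1, hw1⟩
      · simp
      obtain ⟨-, e0, he0, -⟩ := hk w1 (hF hw1)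
      rw [hFk w1 hw1] at he0
      obtain ⟨T, hT, hT2, hT3⟩ := fixedJ (D := D) (n := n)
        (J := Submodule.span ℤ {((e0*m:ℤ):KD D), (e0:KD D)*(t+om D)}) hD (by exact_mod_cast hn.ne') F (hS.mono hF) (by
          intro w hw
          obtain ⟨-, e1, he1, hd⟩ := hk w (hF hw)
          rw [hFk w hw] at he1 hd
          have : e1 = e0 := by
            have h1 : e1^2 = e0^2 := Nat.eq_of_mul_eq_mul_right hm0 (he1.symm.trans he0)
            exact Nat.pow_left_injective (by norm_num : 2 ≠ 0) h1
          rw [this] at hd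
          exact hd)
      rw [← hT3]
      exact_mod_cast le_ND hD0 hT hT2)
  refine this.trans ?_
  rw [Finset.sum_const, nsmul_eq_mul, Finset.card_sigma]
  refine mul_le_mul_of_nonneg_right ?_ (by positivity)
  push_cast
  calc ∑ m ∈ n.divisors, ((R m).card:ℝ) ≤ ∑ m ∈ n.divisors, (n.divisors.card * sqd n : ℝ) := by
        refine Finset.sum_le_sum fun m hm => ?_
        have hm0 : 0 < m := Nat.pos_of_mem_divisors hm
        have hmn := (Nat.mem_divisors.1 hm).1
        refine (rho_bound m hm0 D ((D^2-D)/4) (R m) ?_).trans ?_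
        · intro t ht
          have := Finset.mem_filter.1 ht
          exact ⟨Finset.mem_range.1 this.1, this.2⟩
        · have h1 : m.divisors.card ≤ n.divisors.card :=
            Finset.card_le_card (Nat.divisors_subset_of_dvd hn.ne' hmn)
          have h2 := sqd_mono hn hmn
          have h1' : (m.divisors.card:ℝ) ≤ n.divisors.card := by exact_mod_cast h1
          have h2' : (sqd m:ℝ) ≤ sqd n := by exact_mod_cast h2
          exact mul_le_mul h1' h2' (by positivity) (by positivity)
    _ = _ := by rw [Finset.sum_const, nsmul_eq_mul]; ring

end DW

noncomputable section
namespace DW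

lemma tau_bound (ε : ℝ) (hε : 0 < ε) : ∃ C : ℝ, 1 ≤ C ∧ ∀ n : ℕ, 0 < n →
    (n.divisors.card : ℝ) ≤ C * (n:ℝ)^ε := by
  obtain ⟨P, hP⟩ := exists_nat_ge ((2:ℝ)^(1/ε))
  obtain ⟨B, hB⟩ : ∃ B : ℝ, B = 1 + 1/(ε*Real.log 2) := ⟨_, rfl⟩
  have hl2 : 0 < Real.log 2 := Real.log_pos (by norm_num)
  have hB1 : 1 ≤ B := by rw [hB]; have : 0 < 1/(ε*Real.log 2) := by positivity
                         linarith
  have hBe : 1 ≤ B*(ε*Real.log 2) := by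
    rw [hB, add_mul, one_div, inv_mul_cancel₀ (by positivity)]
    have : 0 < ε*Real.log 2 := by positivity
    linarith
  refine ⟨B^P, one_le_pow₀ hB1, fun n hn => ?_⟩
  have hcard := Nat.card_divisors hn.ne'
  have hfac : (n:ℝ)^ε = ∏ p ∈ n.primeFactors, ((p:ℝ)^ε)^(n.factorization p) := by
    have h1 : n = ∏ p ∈ n.primeFactors, p^(n.factorization p) := by
      conv_lhs => rw [← Nat.prod_factorization_pow_eq_self hn.ne']
      rfl
    conv_lhs => rw [h1]
    push_cast
    rw [← Real.finsetProd_rpow _ _ (fun i _ => by positivity)]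
    refine Finset.prod_congr rfl fun p _ => ?_
    rw [← Real.rpow_natCast, ← Real.rpow_natCast, ← Real.rpow_mul (by positivity), ← Real.rpow_mul (by positivity)]
    congr 1; ring
  rw [hcard, hfac]
  push_cast
  have step : ∀ p ∈ n.primeFactors, ((n.factorization p:ℝ)+1) ≤
      (if p < P then B else 1) * ((p:ℝ)^ε)^(n.factorization p) := by
    intro p hp
    have hp2 : 2 ≤ p := (Nat.prime_of_mem_primeFactors hp).two_le
    have hp2' : (2:ℝ) ≤ p := by exact_mod_cast hp2
    split_ifs with h
    · have h1 : (2:ℝ)^ε ≤ (p:ℝ)^ε := Real.rpow_le_rpow (by norm_num) hp2' hε.le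
      have h2 : 1 + (n.factorization p)*(ε*Real.log 2) ≤ ((2:ℝ)^ε)^(n.factorization p) := by
        rw [Real.rpow_def_of_pos (by norm_num), ← Real.exp_nat_mul]
        have := Real.add_one_le_exp ((n.factorization p : ℝ)*(Real.log 2*ε))
        linarith
      have h3 : ((2:ℝ)^ε)^(n.factorization p) ≤ ((p:ℝ)^ε)^(n.factorization p) :=
        pow_le_pow_left₀ (by positivity) h1 _
      calc ((n.factorization p:ℝ)+1) ≤ B*(1 + (n.factorization p)*(ε*Real.log 2)) := by
            have : (0:ℝ) ≤ (n.factorization p:ℝ) := by positivity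
            nlinarith
        _ ≤ _ := mul_le_mul_of_nonneg_left (h2.trans h3) (by linarith)
    · rw [one_mul]
      have h1 : (2:ℝ) ≤ (p:ℝ)^ε := by
        have : (2:ℝ)^(1/ε) ≤ p := hP.trans (by exact_mod_cast not_lt.1 h)
        calc (2:ℝ) = ((2:ℝ)^(1/ε))^ε := by
              rw [← Real.rpow_mul (by norm_num)]
              rw [one_div, inv_mul_cancel₀ hε.ne', Real.rpow_one]
          _ ≤ _ := Real.rpow_le_rpow (by positivity) this hε.le
      calc ((n.factorization p:ℝ)+1) ≤ 2^(n.factorization p) := by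
            have := Nat.lt_two_pow_self (n := n.factorization p)
            exact_mod_cast this
        _ ≤ _ := pow_le_pow_left₀ (by norm_num) h1 _
  refine (Finset.prod_le_prod (fun p _ => by positivity) step).trans ?_
  rw [Finset.prod_mul_distrib]
  refine mul_le_mul_of_nonneg_right ?_ (Finset.prod_nonneg fun p _ => by positivity)
  rw [Finset.prod_ite, Finset.prod_const, Finset.prod_const_one, mul_one]
  refine pow_le_pow_right₀ hB1 ?_
  calc _ ≤ (Finset.range P).card := Finset.card_le_card (by
        intro p hp
        exact Finset.mem_range.2 (Finset.mem_filter.1 hp).2)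
    _ = P := Finset.card_range P

lemma sqd_qk (q k : ℕ) (hq : Squarefree q) (hk : 0 < k) :
    (sqd (q*k))^2 ≤ k * Nat.gcd q k := by
  have hq0 : 0 < q := Nat.pos_of_ne_zero hq.ne_zero
  obtain ⟨g, hg⟩ : ∃ g, g = sqd (q*k) := ⟨_, rfl⟩
  have hgd : g^2 ∣ q*k := by rw [hg]; exact sqd_sq_dvd
  rw [← hg]
  obtain ⟨d, hd⟩ : ∃ d, d = Nat.gcd q k := ⟨_, rfl⟩
  rw [← hd]
  have hdq : d ∣ q := hd ▸ Nat.gcd_dvd_left q k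
  have hd0 : 0 < d := Nat.pos_of_dvd_of_pos hdq hq0
  obtain ⟨q', hq'⟩ := hdq
  have hnd : ∀ p : ℕ, p.Prime → p ∣ q' → ¬ p ∣ d*k := by
    intro p hp h1 h2
    have h3 : ¬ p ∣ d := by
      intro h3
      have : p*p ∣ q := by rw [hq']; exact Nat.mul_dvd_mul h3 h1
      exact hp.one_lt.ne' (Nat.isUnit_iff.1 (hq p this))
    rcases hp.dvd_mul.1 h2 with h|h
    · exact h3 h
    · apply h3; rw [hd]; exact Nat.dvd_gcd (hq' ▸ dvd_mul_of_dvd_right h1 d) h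
  have hco : Nat.Coprime (g^2) q' := by
    apply Nat.Coprime.pow_left
    apply Nat.Coprime.symm
    apply Nat.coprime_of_dvd
    intro p hp h1 h2
    have h3 : p^2 ∣ (d*k)*q' := by
      refine (pow_dvd_pow_of_dvd h2 2).trans ?_
      rw [show d*k*q' = q*k by rw [hq']; ring]; exact hgd
    have h4 : Nat.Coprime (p^2) (d*k) := Nat.Coprime.pow_left _ ((Nat.Prime.coprime_iff_not_dvd hp).2 (hnd p hp h1))
    have h5 : p*p ∣ q' := by rw [← sq]; exact h4.dvd_of_dvd_mul_left h3
    exact hp.one_lt.ne' (Nat.isUnit_iff.1 (hq p (h5.trans (hq' ▸ dvd_mul_left _ _))))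
  have : g^2 ∣ (k*d)*q' := by
    rw [show k*d*q' = q*k by rw [hq']; ring]; exact hgd
  exact Nat.le_of_dvd (by positivity) (hco.dvd_of_dvd_mul_right this)

lemma arith_sum (ε : ℝ) (hε : 0 < ε) : ∃ C : ℝ, 0 < C ∧ ∀ q : ℕ, Squarefree q → ∀ N : ℕ,
    ∑ k ∈ Finset.Icc 1 N, ((q*k).divisors.card:ℝ)^2 * sqd (q*k) / ((q*k:ℕ):ℝ)^2 ≤
      C * (q:ℝ)^(-2+ε) := by
  obtain ⟨η, hη⟩ : ∃ η, η = min (ε/3) (1/8) := ⟨_, rfl⟩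
  have hη0 : 0 < η := by rw [hη]; positivity
  have hη1 : η ≤ ε/3 := hη ▸ min_le_left _ _
  have hη2 : η ≤ 1/8 := hη ▸ min_le_right _ _
  obtain ⟨T, hT1, hT⟩ := tau_bound η hη0
  have hsum : Summable (fun n : ℕ => (n:ℝ)^(-(5/4):ℝ)) := Real.summable_nat_rpow.2 (by norm_num)
  obtain ⟨Z, hZ⟩ : ∃ Z, Z = ∑' n : ℕ, (n:ℝ)^(-(5/4):ℝ) := ⟨_, rfl⟩
  have hZ0 : 0 ≤ Z := hZ ▸ tsum_nonneg fun n => by positivity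
  refine ⟨T^3*(Z+1), by positivity, fun q hq N => ?_⟩
  have hq0 : 0 < q := Nat.pos_of_ne_zero hq.ne_zero
  have hqR : (1:ℝ) ≤ q := by exact_mod_cast hq0
  -- termwise
  have hterm : ∀ k ∈ Finset.Icc 1 N, ((q*k).divisors.card:ℝ)^2 * sqd (q*k) / ((q*k:ℕ):ℝ)^2 ≤
      T^2*(q:ℝ)^(-2+2*η) * ((k / Nat.gcd q k : ℕ):ℝ)^(-(5/4):ℝ) := by
    intro k hk
    have hk1 : 1 ≤ k := (Finset.mem_Icc.1 hk).1
    obtain ⟨d, hd⟩ : ∃ d, d = Nat.gcd q k := ⟨_, rfl⟩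
    have hdk : d ∣ k := hd ▸ Nat.gcd_dvd_right q k
    have hd0 : 0 < d := Nat.pos_of_dvd_of_pos hdk hk1
    have hs := sqd_qk q k hq hk1
    rw [← hd] at hs ⊢
    obtain ⟨j, hj⟩ := hdk
    have hj0 : 0 < j := by
      rcases Nat.eq_zero_or_pos j with rfl|h
      · simp at hj; omega
      · exact h
    have hkd : k / d = j := by rw [hj]; exact Nat.mul_div_cancel_left j hd0
    rw [hkd]
    have hdR : (1:ℝ) ≤ d := by exact_mod_cast hd0
    have hjR : (1:ℝ) ≤ j := by exact_mod_cast hj0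
    have hkR : (k:ℝ) = d*j := by exact_mod_cast hj
    have hs' : (sqd (q*k):ℝ) ≤ (d:ℝ)*(j:ℝ)^(1/2:ℝ) := by
      have h1 : (sqd (q*k):ℝ)^2 ≤ (d*j)*d := by rw [← hkR]; exact_mod_cast hs
      have h2 : ((d:ℝ)*(j:ℝ)^(1/2:ℝ))^2 = (d*j)*d := by
        rw [mul_pow, ← Real.rpow_natCast ((j:ℝ)^(1/2:ℝ)), ← Real.rpow_mul (by positivity)]
        norm_num; ring
      exact le_of_sq_le_sq (h1.trans h2.symm.le) (by positivity)
    have ht := hT (q*k) (by positivity)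
    have hqk : ((q*k:ℕ):ℝ) = q*(d*j) := by push_cast; rw [hkR]
    rw [hqk] at ht ⊢
    have h3 : ((q*k).divisors.card:ℝ)^2 ≤ T^2*((q:ℝ)*(d*j))^(2*η) := by
      calc _ ≤ (T * ((q:ℝ)*(d*j))^η)^2 := pow_le_pow_left₀ (Nat.cast_nonneg _) ht 2
        _ = _ := by
          rw [mul_pow, ← Real.rpow_natCast (((q:ℝ)*(d*j))^η), ← Real.rpow_mul (by positivity)]
          congr 2; push_cast; ring
    calc ((q*k).divisors.card:ℝ)^2 * (sqd (q*k):ℝ) / ((q:ℝ)*(d*j))^2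
          ≤ (T^2*((q:ℝ)*(d*j))^(2*η)) * ((d:ℝ)*(j:ℝ)^(1/2:ℝ)) / ((q:ℝ)*(d*j))^2 := by
          gcongr
      _ = T^2 * (q:ℝ)^(-2+2*η) * ((d:ℝ)^(-1+2*η) * (j:ℝ)^(-(3/2)+2*η)) := by
          rw [Real.rpow_add (by positivity), Real.rpow_add (by positivity), Real.rpow_add (by positivity),
            Real.mul_rpow (by positivity) (by positivity), Real.mul_rpow (by positivity) (by positivity)]
          have e1 : (q:ℝ)^(-2:ℝ) = ((q:ℝ)^2)⁻¹ := by
            rw [Real.rpow_neg (by positivity)]; norm_num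
          have e2 : (d:ℝ)^(-1:ℝ) = (d:ℝ)⁻¹ := by
            rw [Real.rpow_neg (by positivity)]; norm_num
          have e3 : (j:ℝ)^(-(3/2):ℝ) = (j:ℝ)^(1/2:ℝ) * ((j:ℝ)^2)⁻¹ := by
            rw [← Real.rpow_natCast (j:ℝ) 2, ← Real.rpow_neg (by positivity), ← Real.rpow_add (by positivity)]
            norm_num
          rw [e1,e2,e3]
          generalize (j:ℝ)^(1/2:ℝ) = A
          generalize (j:ℝ)^(2*η) = B
          generalize (d:ℝ)^(2*η) = B'
          generalize (q:ℝ)^(2*η) = B''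
          field_simp
      _ ≤ T^2 * (q:ℝ)^(-2+2*η) * (1 * (j:ℝ)^(-(5/4):ℝ)) := by
          gcongr
          · exact Real.rpow_le_one_of_one_le_of_nonpos hdR (by linarith)
          · linarith
      _ = _ := by ring
  refine (Finset.sum_le_sum hterm).trans ?_
  rw [← Finset.mul_sum]
  have hF : ∑ k ∈ Finset.Icc 1 N, ((k / Nat.gcd q k : ℕ):ℝ)^(-(5/4):ℝ) ≤ T*(q:ℝ)^η * Z := by
    have hinj : Set.InjOn (fun k => (Nat.gcd q k, k / Nat.gcd q k)) (Finset.Icc 1 N : Finset ℕ) := by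
      intro k _ k' _ e
      simp only [Prod.mk.injEq] at e
      rw [← Nat.mul_div_cancel' (Nat.gcd_dvd_right q k), ← Nat.mul_div_cancel' (Nat.gcd_dvd_right q k'), e.2, e.1]
    have e1 : ∑ k ∈ Finset.Icc 1 N, ((k / Nat.gcd q k : ℕ):ℝ)^(-(5/4):ℝ) =
        ∑ x ∈ (Finset.Icc 1 N).image (fun k => (Nat.gcd q k, k / Nat.gcd q k)), ((x.2:ℕ):ℝ)^(-(5/4):ℝ) := by
      rw [Finset.sum_image hinj]
    rw [e1]
    calc _ ≤ ∑ x ∈ q.divisors ×ˢ Finset.Icc 1 N, ((x.2:ℕ):ℝ)^(-(5/4):ℝ) := by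
          refine Finset.sum_le_sum_of_subset_of_nonneg ?_ (fun x _ _ => by positivity)
          intro x hx
          obtain ⟨k, hk, rfl⟩ := Finset.mem_image.1 hx
          have hk' := Finset.mem_Icc.1 hk
          rw [Finset.mem_product]
          refine ⟨Nat.mem_divisors.2 ⟨Nat.gcd_dvd_left _ _, hq0.ne'⟩, Finset.mem_Icc.2 ⟨?_, ?_⟩⟩
          · exact Nat.div_pos (Nat.gcd_le_right _ hk'.1) (Nat.gcd_pos_of_pos_left _ hq0)
          · exact (Nat.div_le_self _ _).trans hk'.2
      _ = q.divisors.card * ∑ j ∈ Finset.Icc 1 N, (j:ℝ)^(-(5/4):ℝ) := by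
          rw [Finset.sum_product]; simp
      _ ≤ (T*(q:ℝ)^η) * Z := by
          have := hsum.sum_le_tsum (Finset.Icc 1 N) (fun i _ => by positivity)
          rw [← hZ] at this
          exact mul_le_mul (hT q hq0) this (Finset.sum_nonneg fun i _ => by positivity) (by positivity)
  calc T^2*(q:ℝ)^(-2+2*η) * _ ≤ T^2*(q:ℝ)^(-2+2*η) * (T*(q:ℝ)^η * Z) := by
        refine mul_le_mul_of_nonneg_left hF (by positivity)
    _ = T^3*Z*(q:ℝ)^(-2+3*η) := by
        have e : (q:ℝ)^(-2+3*η) = (q:ℝ)^(-2+2*η)*(q:ℝ)^η := by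
          rw [← Real.rpow_add (by positivity)]; congr 1; ring
        rw [e]; ring
    _ ≤ T^3*(Z+1)*(q:ℝ)^(-2+ε) := by
        gcongr
        · linarith
        · linarith

lemma exists_HasND (w : CF) (hΔ : w.Δ ≠ 0) (q : ℕ) (hq : CF.dvdH q w) (hq0 : 0 < q) :
    ∃ k : ℕ, 0 < k ∧ ∃ D : ℤ, HasND (q*k) D w := by
  obtain ⟨g, hg⟩ : ∃ g, g = Int.gcd (Int.gcd w.hA w.hB) w.hC := ⟨_, rfl⟩
  have hg0 : 0 < g := by
    rw [hg]
    apply Nat.pos_of_ne_zero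
    intro h
    rw [Int.gcd_eq_zero_iff] at h
    have h2 := h.1
    simp at h2
    apply hΔ; unfold CF.Δ; rw [h2.1, h2.2, h.2]; ring
  have hgA : (g:ℤ) ∣ w.hA := by
    rw [hg]; exact (Int.gcd_dvd_left _ _).trans (Int.gcd_dvd_left _ _)
  have hgB : (g:ℤ) ∣ w.hB := by
    rw [hg]; exact (Int.gcd_dvd_left _ _).trans (Int.gcd_dvd_right _ _)
  have hgC : (g:ℤ) ∣ w.hC := by
    rw [hg]; exact Int.gcd_dvd_right _ _
  have hqg : q ∣ g := by
    rw [hg]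
    have h1 : (q:ℤ) ∣ (Int.gcd w.hA w.hB : ℤ) := Int.dvd_coe_gcd hq.1 hq.2.1
    have h2 : (q:ℤ) ∣ (Int.gcd (Int.gcd w.hA w.hB) w.hC : ℤ) := Int.dvd_coe_gcd h1 hq.2.2
    exact_mod_cast h2
  obtain ⟨k, hk⟩ := hqg
  have hbez : ∃ x y z : ℤ, x*w.hA+y*w.hB+z*w.hC = g := by
    have e1 := Int.gcd_eq_gcd_ab w.hA w.hB
    have e2 := Int.gcd_eq_gcd_ab (Int.gcd w.hA w.hB) w.hC
    refine ⟨Int.gcdA w.hA w.hB * Int.gcdA (Int.gcd w.hA w.hB) w.hC, Int.gcdB w.hA w.hB * Int.gcdA (Int.gcd w.hA w.hB) w.hC, Int.gcdB (Int.gcd w.hA w.hB) w.hC, ?_⟩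
    rw [hg, e2]
    linear_combination (-Int.gcdA (Int.gcd w.hA w.hB) w.hC)*e1
  obtain ⟨A, hA⟩ := hgA
  obtain ⟨B, hB⟩ := hgB
  obtain ⟨C, hC⟩ := hgC
  obtain ⟨x,y,z,hxyz⟩ := hbez
  refine ⟨k, ?_, B^2-4*A*C, A,B,C, ?_⟩
  · rcases Nat.eq_zero_or_pos k with rfl|h
    · simp at hk; omega
    · exact h
  rw [← hk]
  refine ⟨hA,hB,hC,rfl,x,y,z,?_⟩
  have hg0' : (g:ℤ) ≠ 0 := by exact_mod_cast hg0.ne'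
  apply mul_left_cancel₀ hg0'
  rw [hA,hB,hC] at hxyz
  linear_combination hxyz

theorem MC (ε : ℝ) (hε : 0 < ε) : ∃ C : ℝ, 0 < C ∧ ∀ q : ℕ, Squarefree q → ∀ S : Finset CF,
    CF.Ineq S → ∀ X : ℝ, 0 ≤ X → (∀ w ∈ S, w.Δ ≠ 0 ∧ (|w.Δ|:ℝ) ≤ X ∧ CF.dvdH q w) →
    (S.card:ℝ) ≤ C * (q:ℝ)^(-2+ε) * X := by
  obtain ⟨C, hC0, hC⟩ := arith_sum ε hε
  refine ⟨82000*C, by positivity, fun q hq S0 hS0 X hX h0 => ?_⟩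
  have hq0 : 0 < q := Nat.pos_of_ne_zero hq.ne_zero
  -- representatives with hA ≠ 0
  have hrep : ∀ w : CF, ∃ w', w ∈ S0 → (CF.Eqv w w' ∧ w'.hA ≠ 0) := by
    intro w
    by_cases hw : w ∈ S0
    · obtain ⟨w', hw'⟩ := CF.exists_hA_ne w (h0 w hw).1
      exact ⟨w', fun _ => hw'⟩
    · exact ⟨w, fun h => absurd h hw⟩
  choose φ hφ using hrep
  obtain ⟨hS, hinj⟩ := hS0.reps φ (fun x hx => (hφ x hx).1)
  rw [← Finset.card_image_of_injOn hinj]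
  obtain ⟨S, hSdef⟩ : ∃ S, S = S0.image φ := ⟨_, rfl⟩
  rw [← hSdef] at hS ⊢
  have h : ∀ w ∈ S, w.hA ≠ 0 ∧ w.Δ ≠ 0 ∧ (|w.Δ|:ℝ) ≤ X ∧ CF.dvdH q w := by
    intro w hw
    rw [hSdef] at hw
    obtain ⟨x, hx, rfl⟩ := Finset.mem_image.1 hw
    obtain ⟨e1, e2⟩ := hφ x hx
    obtain ⟨i1,i2,i3⟩ := h0 x hx
    rw [e1.Δ_eq]
    exact ⟨e2, i1, i2, (e1.dvdH_iff q).1 i3⟩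
  have hkD : ∀ w : CF, ∃ kD : ℕ × ℤ, w ∈ S → 0 < kD.1 ∧ HasND (q*kD.1) kD.2 w := by
    intro w
    by_cases hw : w ∈ S
    · obtain ⟨k, hk, D, hD⟩ := exists_HasND w (h w hw).2.1 q (h w hw).2.2.2 hq0
      exact ⟨(k,D), fun _ => ⟨hk, hD⟩⟩
    · exact ⟨(0,0), fun h => absurd h hw⟩
  choose κ hκ using hkD
  obtain ⟨N, hN⟩ : ∃ N, N = S.sup (fun w => (κ w).1) := ⟨_, rfl⟩
  have main := card_le_fib S (fun w => (κ w).1) (Finset.Icc 1 N)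
    (fun k => ((q*k).divisors.card:ℝ)^2 * sqd (q*k) / ((q*k:ℕ):ℝ)^2 * (82000*X))
    (by
      intro w hw
      rw [Finset.mem_Icc]
      refine ⟨(hκ w hw).1, ?_⟩
      rw [hN]; exact Finset.le_sup (f := fun w => (κ w).1) hw)
    (by
      intro k hk F hF hFk
      have hk1 : 0 < k := (Finset.mem_Icc.1 hk).1
      have hqk : 0 < q*k := by positivity
      have hqkR : (0:ℝ) < ((q*k:ℕ):ℝ) := by exact_mod_cast hqk
      have hDΔ : ∀ w ∈ F, (κ w).2 ≠ 0 ∧ |((κ w).2:ℝ)| ≤ X/((q*k:ℕ):ℝ)^2 := by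
        intro w hw
        have h1 := (hκ w (hF hw)).2.Δ_eq
        rw [hFk w hw] at h1
        obtain ⟨-,i1,i2,-⟩ := h w (hF hw)
        constructor
        · intro h0; rw [h0] at h1; simp at h1; exact i1 h1
        · rw [le_div_iff₀ (by positivity)]
          rw [h1] at i2
          push_cast at i2 ⊢
          rw [abs_mul, abs_of_nonneg (by positivity : (0:ℝ) ≤ ((q:ℝ)*k)^2)] at i2
          linarith
      have hin := card_le_fib F (fun w => (κ w).2) (F.image fun w => (κ w).2)
        (fun D => ((q*k).divisors.card:ℝ)^2 * sqd (q*k) * ND D)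
        (fun x hx => Finset.mem_image_of_mem _ hx)
        (by
          intro D hD G hG hGD
          obtain ⟨w, hw, rfl⟩ := Finset.mem_image.1 hD
          refine fixedND (q*k) hqk _ (hDΔ w hw).1 G (hS.mono (hG.trans hF)) ?_
          intro w' hw'
          refine ⟨(h w' (hF (hG hw'))).1, ?_⟩
          have := (hκ w' (hF (hG hw'))).2
          rw [hFk w' (hG hw'), hGD w' hw'] at this
          exact this)
      refine hin.trans ?_
      rw [← Finset.mul_sum]
      have hsum := ND_sum (F.image fun w => (κ w).2) (X/((q*k:ℕ):ℝ)^2) (by positivity) (by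
        intro D hD
        obtain ⟨w, hw, rfl⟩ := Finset.mem_image.1 hD
        exact hDΔ w hw)
      calc _ ≤ ((q*k).divisors.card:ℝ)^2 * sqd (q*k) * (82000*(X/((q*k:ℕ):ℝ)^2)) :=
            mul_le_mul_of_nonneg_left hsum (by positivity)
        _ = _ := by ring)
  refine main.trans ?_
  rw [← Finset.sum_mul]
  calc _ ≤ (C * (q:ℝ)^(-2+ε))*(82000*X) := mul_le_mul_of_nonneg_right (hC q hq N) (by positivity)
    _ = _ := by ring
end DW

noncomputable section
namespace DW
namespace CF

/-- scalar multiple -/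
def scl (m : ℤ) (w : CF) : CF := ⟨m*w.a, m*w.b, m*w.c, m*w.d⟩

lemma act_scl (p q r s m : ℤ) (w : CF) : act p q r s (scl m w) = scl m (act p q r s w) := by
  ext <;> simp only [act, scl] <;> ring

lemma scl_inj {m : ℤ} (hm : m ≠ 0) {w w' : CF} (h : scl m w = scl m w') : w = w' := by
  simp only [scl, CF.mk.injEq] at h
  obtain ⟨h1,h2,h3,h4⟩ := h
  ext
  · exact mul_left_cancel₀ hm h1
  · exact mul_left_cancel₀ hm h2
  · exact mul_left_cancel₀ hm h3
  · exact mul_left_cancel₀ hm h4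

lemma Δ_scl (m : ℤ) (w : CF) : (scl m w).Δ = m^4*w.Δ := by
  simp only [scl, Δ, hA, hB, hC]; ring

/-- relation at primes away from `N` -/
def RelN (N : ℤ) (w w' : CF) : Prop := ∃ p q r s : ℤ, ∃ i j l : ℕ, p*s-q*r = N^l ∧
  scl (N^i) (act p q r s w) = scl (N^j) w'

lemma RelN.symm {N : ℤ} {w w' : CF} (h : RelN N w w') : RelN N w' w := by
  obtain ⟨p,q,r,s,i,j,l,h1,h2⟩ := h
  refine ⟨s,-q,-r,p,j,i+3*l,l, by linarith, ?_⟩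
  rw [← act_scl, ← h2, act_scl, act_act]
  have e : act (s*p + -q*r) (s*q + -q*s) (-r*p+p*r) (-r*q+p*s) w = scl (N^(3*l)) w := by
    rw [show N^(3*l) = (p*s-q*r)^3 by rw [h1]; ring]
    ext <;> simp only [act, scl] <;> ring
  rw [e]; ext <;> simp only [scl] <;> ring

lemma Eqv.RelN {w w' : CF} (h : Eqv w w') (N : ℤ) : RelN N w w' := by
  obtain ⟨p,q,r,s,h1,h2⟩ := h
  exact ⟨p,q,r,s,0,0,0, by simpa using h1, by rw [h2]⟩

lemma RelN.dvdW {N m : ℤ} {w w' : CF} (h : RelN N w w') (hm : IsCoprime m N) (hw : dvdW m w) :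
    dvdW m w' := by
  obtain ⟨p,q,r,s,i,j,l,h1,h2⟩ := h
  obtain ⟨x1,x2,x3,x4⟩ := dvdW_act hw p q r s
  have hc : IsCoprime m (N^j) := hm.pow_right
  simp only [scl, CF.mk.injEq] at h2
  obtain ⟨e1,e2,e3,e4⟩ := h2
  exact ⟨hc.dvd_of_dvd_mul_left (e1 ▸ x1.mul_left _), hc.dvd_of_dvd_mul_left (e2 ▸ x2.mul_left _),
    hc.dvd_of_dvd_mul_left (e3 ▸ x3.mul_left _), hc.dvd_of_dvd_mul_left (e4 ▸ x4.mul_left _)⟩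

lemma RelN.dvdH {N m : ℤ} {w w' : CF} (h : RelN N w w') (hm : IsCoprime m N) (hw : dvdH m w) :
    dvdH m w' := by
  obtain ⟨p,q,r,s,i,j,l,h1,h2⟩ := h
  obtain ⟨x1,x2,x3⟩ := dvdH_act hw p q r s
  have hc : IsCoprime m ((N^j)^2) := hm.pow_right.pow_right
  have s1 : ∀ (k : ℤ) (v : CF), (scl k v).hA = k^2*v.hA := fun k v => by simp only [scl, hA]; ring
  have s2 : ∀ (k : ℤ) (v : CF), (scl k v).hB = k^2*v.hB := fun k v => by simp only [scl, hB]; ring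
  have s3 : ∀ (k : ℤ) (v : CF), (scl k v).hC = k^2*v.hC := fun k v => by simp only [scl, hC]; ring
  refine ⟨hc.dvd_of_dvd_mul_left ?_, hc.dvd_of_dvd_mul_left ?_, hc.dvd_of_dvd_mul_left ?_⟩
  · rw [← s1, ← h2, s1]; exact x1.mul_left _
  · rw [← s2, ← h2, s2]; exact x2.mul_left _
  · rw [← s3, ← h2, s3]; exact x3.mul_left _

/-- local bound for the Gauss sum -/
def g (p : ℕ) (w : CF) : ℝ :=
  if CF.dvdW ((p:ℤ)^2) w then 3/(p:ℝ)^2 else if CF.dvdW (p:ℤ) w then 3/(p:ℝ)^3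
  else if CF.dvdH ((p:ℤ)^2) w then 3/(p:ℝ)^3 else if CF.dvdH (p:ℤ) w then 3/(p:ℝ)^5 else 0

lemma g_nonneg (p : ℕ) (w : CF) : 0 ≤ g p w := by
  unfold g; split_ifs <;> positivity

lemma g_congr {p : ℕ} {N : ℤ} (hc : IsCoprime (p:ℤ) N) {w w' : CF} (h : RelN N w w') :
    g p w = g p w' := by
  have hc2 : IsCoprime ((p:ℤ)^2) N := hc.pow_left
  have e1 : CF.dvdW ((p:ℤ)^2) w ↔ CF.dvdW ((p:ℤ)^2) w' := ⟨h.dvdW hc2, h.symm.dvdW hc2⟩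
  have e2 : CF.dvdW (p:ℤ) w ↔ CF.dvdW (p:ℤ) w' := ⟨h.dvdW hc, h.symm.dvdW hc⟩
  have e3 : CF.dvdH ((p:ℤ)^2) w ↔ CF.dvdH ((p:ℤ)^2) w' := ⟨h.dvdH hc2, h.symm.dvdH hc2⟩
  have e4 : CF.dvdH (p:ℤ) w ↔ CF.dvdH (p:ℤ) w' := ⟨h.dvdH hc, h.symm.dvdH hc⟩
  simp only [g, e1, e2, e3, e4]

def GP (P : Finset ℕ) (w : CF) : ℝ := ∏ l ∈ P, g l w

lemma GP_nonneg (P : Finset ℕ) (w : CF) : 0 ≤ GP P w := Finset.prod_nonneg fun _ _ => g_nonneg _ _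

lemma GP_congr {P : Finset ℕ} {N : ℤ} (hc : ∀ l ∈ P, IsCoprime (l:ℤ) N) {w w' : CF} (h : RelN N w w') :
    GP P w = GP P w' := Finset.prod_congr rfl fun l hl => g_congr (hc l hl) h

def Bd (P : Finset ℕ) (r : ℕ) (B : ℝ) : Prop := ∀ S : Finset CF, Ineq S → ∀ X : ℝ, 0 ≤ X →
  (∀ w ∈ S, w.Δ ≠ 0 ∧ (|w.Δ|:ℝ) ≤ X ∧ CF.dvdH r w) → ∑ w ∈ S, GP P w ≤ B*X

lemma RelN.trans_eqv {N : ℤ} {w w' w'' : CF} (h : Eqv w w') (h' : RelN N w' w'') : RelN N w w'' := by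
  obtain ⟨p,q,r,s,h1,rfl⟩ := h
  obtain ⟨p',q',r',s',i,j,l,h2,h3⟩ := h'
  rw [act_act] at h3
  refine ⟨_,_,_,_,i,j,l,?_,h3⟩
  rw [← h2]; linear_combination (p'*s'-q'*r')*h1

lemma Bd.transport {P : Finset ℕ} {r' : ℕ} {B : ℝ} (hB : Bd P r' B) {S : Finset CF} (hS : Ineq S)
    {N : ℤ} (hc : ∀ l ∈ P, IsCoprime (l:ℤ) N) (φ : CF → CF) {X : ℝ} (hX : 0 ≤ X) (k : ℕ) (hN : 0 < N)
    (hφ : ∀ x ∈ S, ∀ y ∈ S, Eqv (φ x) (φ y) → Eqv x y)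
    (hR : ∀ x ∈ S, RelN N x (φ x)) (hΔ : ∀ x ∈ S, x.Δ = N^k*(φ x).Δ)
    (hS2 : ∀ x ∈ S, x.Δ ≠ 0 ∧ (|x.Δ|:ℝ) ≤ X ∧ CF.dvdH r' (φ x)) :
    ∑ w ∈ S, GP P w ≤ B*(X/(N:ℝ)^k) := by
  refine (hS.sum_le φ hφ (GP P) (GP P) fun x hx => (GP_congr hc (hR x hx)).le).trans ?_
  refine hB _ (hS.image φ hφ).1 _ (by positivity) ?_
  intro w hw
  obtain ⟨x, hx, rfl⟩ := Finset.mem_image.1 hw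
  obtain ⟨h1,h2,h3⟩ := hS2 x hx
  refine ⟨?_, ?_, h3⟩
  · intro h; rw [hΔ x hx, h] at h1; simp at h1
  · have hNR : (0:ℝ) < N := by exact_mod_cast hN
    rw [le_div_iff₀ (by positivity)]
    have : ((|x.Δ|:ℤ):ℝ) = (N:ℝ)^k*((|(φ x).Δ|:ℤ):ℝ) := by
      rw [hΔ x hx, abs_mul, abs_of_pos (by positivity : (0:ℤ) < N^k)]; push_cast; ring
    push_cast at this
    rw [this] at h2
    linarith

end CF
end DW
end

noncomputable section
namespace DW
namespace CF

def dv (k : ℤ) (w : CF) : CF := ⟨w.a/k, w.b/k, w.c/k, w.d/k⟩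
lemma scl_dv {k : ℤ} {w : CF} (h : dvdW k w) : scl k (dv k w) = w := by
  obtain ⟨h1,h2,h3,h4⟩ := h
  ext <;> simp only [scl, dv]
  · exact Int.mul_ediv_cancel' h1
  · exact Int.mul_ediv_cancel' h2
  · exact Int.mul_ediv_cancel' h3
  · exact Int.mul_ediv_cancel' h4

lemma step_scl {P : Finset ℕ} {r : ℕ} {B : ℝ} (hB : Bd P r B) {p : ℕ} (hp : p.Prime)
    (hc : ∀ l ∈ P, IsCoprime (l:ℤ) p) (hr : IsCoprime (r:ℤ) p) (e : ℕ)
    {S : Finset CF} (hS : Ineq S) {X : ℝ} (hX : 0 ≤ X)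
    (h : ∀ x ∈ S, x.Δ ≠ 0 ∧ (|x.Δ|:ℝ) ≤ X ∧ CF.dvdH r x) (hd : ∀ x ∈ S, dvdW ((p:ℤ)^e) x) :
    ∑ w ∈ S, GP P w ≤ B*(X/(p:ℝ)^(4*e)) := by
  have hp0 : (0:ℤ) < p := by exact_mod_cast hp.pos
  have hR : ∀ x ∈ S, RelN (p:ℤ) x (dv ((p:ℤ)^e) x) := fun x hx =>
    ⟨1,0,0,1,0,e,0, by norm_num, by rw [scl_dv (hd x hx), act_one]; ext <;> simp [scl]⟩
  have := hB.transport hS hc (dv ((p:ℤ)^e)) hX (4*e) hp0 ?_ hR ?_ ?_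
  · simpa using this
  · rintro x hx y hy ⟨a,b,c,d,h1,h2⟩
    refine ⟨a,b,c,d,h1,?_⟩
    rw [← scl_dv (hd x hx), act_scl, h2, scl_dv (hd y hy)]
  · intro x hx
    conv_lhs => rw [← scl_dv (hd x hx), Δ_scl]
    rw [← pow_mul, mul_comm e]
  · intro x hx
    exact ⟨(h x hx).1, (h x hx).2.1, (hR x hx).dvdH hr (h x hx).2.2⟩

/-- normal form when `p² ∣ H`, `p ∤ w` -/
def NF (p : ℤ) (w : CF) : Prop := p^2 ∣ w.a ∧ p^2 ∣ w.b ∧ p ∣ w.c ∧ ¬ p ∣ w.d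

lemma exists_NF {p : ℤ} (hp : Prime p) {w : CF} (hw : ¬ dvdW p w) (hH : dvdH (p^2) w) :
    ∃ w', Eqv w w' ∧ NF p w' := by
  have key : ∀ v : CF, ¬ p ∣ v.d → dvdH (p^2) v → ∃ w', Eqv v w' ∧ NF p w' := by
    intro v hd hv
    have hco : IsCoprime v.d (p^2) := ((hp.irreducible.coprime_iff_not_dvd.2 hd).symm).pow_right
    obtain ⟨u, u', hu⟩ := hco
    refine ⟨act 1 (-v.c*u) 0 1 v, ⟨1,_,0,1,by ring,rfl⟩, ?_⟩
    have hH' := dvdH_act hv 1 (-v.c*u) 0 1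
    have hd' : (act 1 (-v.c*u) 0 1 v).d = v.d := by simp [act]
    have hc' : p^2 ∣ (act 1 (-v.c*u) 0 1 v).c := ⟨v.c*u', by simp only [act]; linear_combination (-v.c) * hu⟩
    generalize act 1 (-v.c*u) 0 1 v = x at *
    rw [← hd'] at hd
    have hco : IsCoprime (p^2) x.d := ((hp.irreducible.coprime_iff_not_dvd.2 hd)).pow_left
    obtain ⟨x1,x2,x3⟩ := hH'
    have hb : p^2 ∣ x.b := by
      refine hco.dvd_of_dvd_mul_right ?_
      have : x.b*x.d = x.c*x.c - x.hC := by simp only [hC]; ring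
      rw [this]; exact dvd_sub (hc'.mul_left _) x3
    have ha : p^2 ∣ x.a := by
      refine hco.dvd_of_dvd_mul_right ?_
      have : x.a*x.d = x.b*x.c - x.hB := by simp only [hB]; ring
      rw [this]; exact dvd_sub (hc'.mul_left _) x2
    exact ⟨ha, hb, (dvd_pow_self p two_ne_zero).trans hc', hd⟩
  by_cases hd : p ∣ w.d
  · have hp2 : p ∣ p^2 := dvd_pow_self p two_ne_zero
    obtain ⟨x1,x2,x3⟩ := hH
    have hcc : p ∣ w.c := by
      refine hp.dvd_of_dvd_pow (n := 2) ?_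
      have : w.c^2 = w.b*w.d + w.hC := by simp only [hC]; ring
      rw [this]; exact dvd_add (hd.mul_left _) (hp2.trans x3)
    have ha : ¬ p ∣ w.a := by
      intro ha
      refine hw ⟨ha, ?_, hcc, hd⟩
      refine hp.dvd_of_dvd_pow (n := 2) ?_
      have : w.b^2 = w.a*w.c + w.hA := by simp only [hA]; ring
      rw [this]; exact dvd_add (ha.mul_right _) (hp2.trans x1)
    have e : Eqv w (act 0 1 (-1) 0 w) := ⟨0,1,-1,0,by ring,rfl⟩
    obtain ⟨w', h1, h2⟩ := key (act 0 1 (-1) 0 w) (by simpa [act] using ha) (dvdH_act ⟨x1,x2,x3⟩ ..)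
    exact ⟨w', e.trans h1, h2⟩
  · exact key w hd hH

def phiA (p : ℤ) (w : CF) : CF := ⟨w.a/p^2, w.b/p, w.c, p*w.d⟩
def phiB (p : ℤ) (w : CF) : CF := ⟨w.a/p^3, w.b/p^2, w.c/p, w.d⟩

lemma phiA_spec {p : ℤ} {w : CF} (h : NF p w) : scl (p^2) (phiA p w) = act 1 0 0 p w := by
  obtain ⟨⟨a,ha⟩,⟨b,hb⟩,⟨c,hc⟩,hd⟩ := h
  by_cases hp : p = 0
  · subst hp; ext <;> simp [act, scl, phiA] at *; exact ha.symm
  have e1 : w.a/p^2 = a := by rw [ha]; exact Int.mul_ediv_cancel_left _ (pow_ne_zero _ hp)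
  have e2 : w.b/p = p*b := by
    rw [hb, show p^2*b = p*(p*b) by ring]; exact Int.mul_ediv_cancel_left _ hp
  ext <;> simp only [act, scl, phiA, e1, e2]
  · rw [ha]; ring
  · rw [hb]; ring
  · ring
  · ring

lemma phiB_spec {p : ℤ} {w : CF} (h : NF p w) (h3 : p^3 ∣ w.a) : scl (p^3) (phiB p w) = act 1 0 0 p w := by
  obtain ⟨_,⟨b,hb⟩,⟨c,hc⟩,hd⟩ := h
  obtain ⟨a,ha⟩ := h3
  by_cases hp : p = 0
  · subst hp; ext <;> simp [act, scl, phiB] at *; exact ha.symm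
  have e1 : w.a/p^3 = a := by rw [ha]; exact Int.mul_ediv_cancel_left _ (pow_ne_zero _ hp)
  have e2 : w.b/p^2 = b := by rw [hb]; exact Int.mul_ediv_cancel_left _ (pow_ne_zero _ hp)
  have e3 : w.c/p = c := by rw [hc]; exact Int.mul_ediv_cancel_left _ hp
  ext <;> simp only [act, scl, phiB, e1, e2, e3]
  · rw [ha]; ring
  · rw [hb]; ring
  · rw [hc]; ring
  · ring

/-- conjugating by `diag(1,p)` -/
lemma conj_eqv {p k : ℤ} (hp : p ≠ 0) {x y x' y' : CF} (hx : scl k x' = act 1 0 0 p x)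
    (hy : scl k y' = act 1 0 0 p y) {P Q R S : ℤ} (h : P*S-Q*R = 1) (e : act P Q R S x' = y')
    (hR : p ∣ R) : Eqv x y := by
  obtain ⟨R', rfl⟩ := hR
  refine ⟨P, p*Q, R', S, by linarith, ?_⟩
  have : act 1 0 0 p (act P (p*Q) R' S x) = act 1 0 0 p y := by
    rw [← hy, ← e, ← act_scl, hx, act_act, act_act]
    congr 1 <;> ring
  simp only [act, CF.mk.injEq] at this
  obtain ⟨h1,h2,h3,h4⟩ := this
  ext
  · simp only [act]; linear_combination h1
  · simp only [act]; apply mul_left_cancel₀ hp; linear_combination h2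
  · simp only [act]; apply mul_left_cancel₀ (pow_ne_zero 2 hp); linear_combination h3
  · simp only [act]; apply mul_left_cancel₀ (pow_ne_zero 3 hp); linear_combination h4

lemma rel_of_spec {p : ℤ} {j : ℕ} {x x' : CF} (hx : scl (p^j) x' = act 1 0 0 p x) : RelN p x x' :=
  ⟨1,0,0,p,0,j,1, by ring, by rw [hx]; ext <;> simp [scl]⟩

lemma Δ_of_spec {p : ℤ} (hp : p ≠ 0) {j k : ℕ} (hj : 4*j = 6+k) {x x' : CF} (hx : scl (p^j) x' = act 1 0 0 p x) :
    x.Δ = p^k*x'.Δ := by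
  have := congrArg CF.Δ hx
  rw [Δ_scl, Δ_act, ← pow_mul, mul_comm j, hj] at this
  apply mul_left_cancel₀ (pow_ne_zero 6 hp)
  rw [pow_add] at this
  linear_combination -this

end CF
end DW
end

noncomputable section
namespace DW
namespace CF

def nf (p : ℤ) (w : CF) : CF := if h : ∃ w', Eqv w w' ∧ NF p w' then h.choose else w
lemma nf_spec {p : ℤ} (hp : Prime p) {w : CF} (hw : ¬ dvdW p w) (hH : dvdH (p^2) w) :
    Eqv w (nf p w) ∧ NF p (nf p w) := by
  have h := exists_NF hp hw hH
  rw [nf, dif_pos h]; exact h.choose_spec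

lemma step_A {P : Finset ℕ} {r : ℕ} {B : ℝ} {p : ℕ} (hB : Bd P (r*p) B) (hp : p.Prime)
    (hc : ∀ l ∈ P, IsCoprime (l:ℤ) p) (hr : IsCoprime (r:ℤ) p)
    {S : Finset CF} (hS : Ineq S) {X : ℝ} (hX : 0 ≤ X)
    (h : ∀ x ∈ S, x.Δ ≠ 0 ∧ (|x.Δ|:ℝ) ≤ X ∧ CF.dvdH r x)
    (hd : ∀ x ∈ S, Eqv x (nf p x) ∧ NF p (nf p x) ∧ ¬ (p:ℤ)^3 ∣ (nf p x).a) :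
    ∑ w ∈ S, GP P w ≤ B*(X/(p:ℝ)^2) := by
  have hp0 : (0:ℤ) < p := by exact_mod_cast hp.pos
  have hpp : Prime (p:ℤ) := Nat.prime_iff_prime_int.1 hp
  have hspec : ∀ x ∈ S, scl ((p:ℤ)^2) (phiA p (nf p x)) = act 1 0 0 p (nf p x) := fun x hx =>
    phiA_spec (hd x hx).2.1
  have hR : ∀ x ∈ S, RelN (p:ℤ) x (phiA p (nf p x)) := fun x hx =>
    RelN.trans_eqv (hd x hx).1 (rel_of_spec (hspec x hx))
  have hform : ∀ x ∈ S, ¬ (p:ℤ) ∣ (phiA p (nf p x)).a ∧ (p:ℤ) ∣ (phiA p (nf p x)).b ∧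
      (p:ℤ) ∣ (phiA p (nf p x)).c ∧ (p:ℤ) ∣ (phiA p (nf p x)).d := by
    intro x hx
    obtain ⟨-, ⟨⟨a,ha⟩,⟨b,hb⟩,hcc,hdd⟩, h3⟩ := hd x hx
    refine ⟨?_, ?_, hcc, dvd_mul_right _ _⟩
    · simp only [phiA]
      rw [ha, Int.mul_ediv_cancel_left _ (pow_ne_zero _ hp0.ne')]
      rintro ⟨t, rfl⟩
      exact h3 ⟨t, by rw [ha]; ring⟩
    · simp only [phiA]
      rw [hb, show (p:ℤ)^2*b = p*(p*b) by ring, Int.mul_ediv_cancel_left _ hp0.ne']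
      exact dvd_mul_right _ _
  have := hB.transport hS hc (fun x => phiA p (nf p x)) hX 2 hp0 ?_ hR ?_ ?_
  · simpa using this
  · rintro x hx y hy ⟨a,b,c,d,h1,h2⟩
    refine (hd x hx).1.trans (Eqv.trans ?_ (hd y hy).1.symm)
    refine conj_eqv hp0.ne' (hspec x hx) (hspec y hy) h1 h2 ?_
    -- p ∣ c
    have hy4 := (hform y hy).2.2.2
    obtain ⟨f1,f2,f3,f4⟩ := hform x hx
    rw [← h2] at hy4
    generalize phiA p (nf p x) = v at *
    have : (p:ℤ) ∣ v.a*c^3 := by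
      have e : v.a*c^3 = (act a b c d v).d - v.b*(3*c^2*d) - v.c*(3*c*d^2) - v.d*d^3 := by
        simp only [act]; ring
      rw [e]
      exact dvd_sub (dvd_sub (dvd_sub hy4 (f2.mul_right _)) (f3.mul_right _)) (f4.mul_right _)
    exact hpp.dvd_of_dvd_pow ((hpp.dvd_or_dvd this).resolve_left f1)
  · intro x hx
    rw [← (hd x hx).1.Δ_eq]
    exact Δ_of_spec hp0.ne' (by norm_num) (hspec x hx)
  · intro x hx
    refine ⟨(h x hx).1, (h x hx).2.1, ?_⟩
    have g1 := (hR x hx).dvdH hr (h x hx).2.2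
    obtain ⟨f1,f2,f3,f4⟩ := hform x hx
    generalize phiA p (nf p x) = v at *
    have g2 : dvdH (p:ℤ) v := by
      refine ⟨?_, ?_, ?_⟩
      · simp only [hA]; rw [sq]; exact dvd_sub (f2.mul_right _) (f3.mul_left _)
      · simp only [CF.hB]; exact dvd_sub (f2.mul_right _) (f4.mul_left _)
      · simp only [hC]; rw [sq]; exact dvd_sub (f3.mul_right _) (f2.mul_right _)
    push_cast
    exact ⟨hr.mul_dvd g1.1 g2.1, hr.mul_dvd g1.2.1 g2.2.1, hr.mul_dvd g1.2.2 g2.2.2⟩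

instance eqvSetoid : Setoid CF := ⟨Eqv, ⟨Eqv.refl, Eqv.symm, Eqv.trans⟩⟩
def rep (w : CF) : CF := Quotient.out (Quotient.mk eqvSetoid w)
lemma rep_eqv (w : CF) : Eqv (rep w) w := Quotient.exact (Quotient.out_eq (Quotient.mk eqvSetoid w))
lemma rep_eq {w w' : CF} (h : Eqv w w') : rep w = rep w' := by
  unfold rep; rw [Quotient.sound (s := eqvSetoid) h]

def col (p : ℕ) [Fact p.Prime] (w : CF) : Option (ZMod p) :=
  if ((rep_eqv w).choose_spec.choose_spec.choose_spec.choose : ZMod p) = 0 then none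
  else some (((rep_eqv w).choose_spec.choose_spec.choose : ZMod p) /
    ((rep_eqv w).choose_spec.choose_spec.choose_spec.choose : ZMod p))

lemma col_spec (p : ℕ) [Fact p.Prime] {v w : CF} (hr : Eqv v w) (hc : col p v = col p w) :
    ∃ P Q R S : ℤ, P*S-Q*R = 1 ∧ act P Q R S v = w ∧ (p:ℤ) ∣ R := by
  have hrep := rep_eq hr
  unfold col at hc
  have h1 := (rep_eqv v).choose_spec.choose_spec.choose_spec.choose_spec
  have h2 := (rep_eqv w).choose_spec.choose_spec.choose_spec.choose_spec
  generalize (rep_eqv v).choose_spec.choose_spec.choose_spec.choose = S1 at *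
  generalize (rep_eqv v).choose_spec.choose_spec.choose = R1 at *
  generalize (rep_eqv v).choose_spec.choose = Q1 at *
  generalize (rep_eqv v).choose = P1 at *
  generalize (rep_eqv w).choose_spec.choose_spec.choose_spec.choose = S2 at *
  generalize (rep_eqv w).choose_spec.choose_spec.choose = R2 at *
  generalize (rep_eqv w).choose_spec.choose = Q2 at *
  generalize (rep_eqv w).choose = P2 at *
  obtain ⟨d1, a1⟩ := h1
  obtain ⟨d2, a2⟩ := h2
  have hb : act S1 (-Q1) (-R1) P1 v = rep v := by
    conv_lhs => rw [← a1]
    rw [act_act]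
    have e1 : S1*P1 + -Q1*R1 = 1 := by linarith
    have e2 : S1*Q1 + -Q1*S1 = 0 := by ring
    have e3 : -R1*P1+P1*R1 = 0 := by ring
    have e4 : -R1*Q1+P1*S1 = 1 := by linarith
    rw [e1,e2,e3,e4, act_one]
  rw [← hrep, ← hb, act_act] at a2
  refine ⟨_,_,_,_,?_,a2,?_⟩
  · linear_combination (P2*S2-Q2*R2)*d1 + d2
  · rw [← ZMod.intCast_zmod_eq_zero_iff_dvd _ p]
    push_cast
    by_cases z1 : (S1:ZMod p) = 0
    · by_cases z2 : (S2:ZMod p) = 0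
      · rw [z1, z2]; ring
      · rw [if_pos z1, if_neg z2] at hc; cases hc
    · by_cases z2 : (S2:ZMod p) = 0
      · rw [if_pos z2, if_neg z1] at hc; cases hc
      · rw [if_neg z1, if_neg z2] at hc
        have := Option.some.inj hc
        field_simp at this
        linear_combination -this

lemma step_B {P : Finset ℕ} {r : ℕ} {B : ℝ} {p : ℕ} (hB : Bd P r B) (hp : p.Prime)
    (hc : ∀ l ∈ P, IsCoprime (l:ℤ) p) (hr : IsCoprime (r:ℤ) p)
    {S : Finset CF} (hS : Ineq S) {X : ℝ} (hX : 0 ≤ X)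
    (h : ∀ x ∈ S, x.Δ ≠ 0 ∧ (|x.Δ|:ℝ) ≤ X ∧ CF.dvdH r x)
    (hd : ∀ x ∈ S, Eqv x (nf p x) ∧ NF p (nf p x) ∧ (p:ℤ)^3 ∣ (nf p x).a) :
    ∑ w ∈ S, GP P w ≤ (p+1)*(B*(X/(p:ℝ)^6)) := by
  haveI := Fact.mk hp
  have hp0 : (0:ℤ) < p := by exact_mod_cast hp.pos
  have hspec : ∀ x ∈ S, scl ((p:ℤ)^3) (phiB p (nf p x)) = act 1 0 0 p (nf p x) := fun x hx =>
    phiB_spec (hd x hx).2.1 (hd x hx).2.2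
  have hR : ∀ x ∈ S, RelN (p:ℤ) x (phiB p (nf p x)) := fun x hx =>
    RelN.trans_eqv (hd x hx).1 (rel_of_spec (hspec x hx))
  have hfib : ∀ k : Option (ZMod p), ∑ w ∈ S.filter (fun x => col p (phiB p (nf p x)) = k), GP P w ≤
      B*(X/(p:ℝ)^6) := by
    intro k
    have hsub : ∀ x ∈ S.filter (fun x => col p (phiB p (nf p x)) = k), x ∈ S ∧
      col p (phiB p (nf p x)) = k := fun x hx => Finset.mem_filter.1 hx
    have := hB.transport (hS.mono (Finset.filter_subset _ _)) hc (fun x => phiB p (nf p x)) hX 6 hp0 ?_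
      (fun x hx => hR x (hsub x hx).1) ?_ ?_
    · simpa using this
    · rintro x hx y hy e
      obtain ⟨hx, cx⟩ := hsub x hx
      obtain ⟨hy, cy⟩ := hsub y hy
      obtain ⟨a,b,c,d,h1,h2,h3⟩ := col_spec p e (cx.trans cy.symm)
      refine (hd x hx).1.trans (Eqv.trans ?_ (hd y hy).1.symm)
      exact conj_eqv hp0.ne' (hspec x hx) (hspec y hy) h1 h2 h3
    · intro x hx
      obtain ⟨hx, cx⟩ := hsub x hx
      rw [← (hd x hx).1.Δ_eq]
      exact Δ_of_spec hp0.ne' (by norm_num) (hspec x hx)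
    · intro x hx
      obtain ⟨hx, cx⟩ := hsub x hx
      exact ⟨(h x hx).1, (h x hx).2.1, (hR x hx).dvdH hr (h x hx).2.2⟩
  rw [← Finset.sum_fiberwise S (fun x => col p (phiB p (nf p x)))]
  refine (Finset.sum_le_sum fun k _ => hfib k).trans ?_
  rw [Finset.sum_const, Finset.card_univ, Fintype.card_option, ZMod.card]
  simp

end CF
end DW
end

noncomputable section
namespace DW
namespace CF

lemma Bd_step {P : Finset ℕ} {r p : ℕ} {B1 B2 : ℝ} (hB1 : Bd P r B1) (hB2 : Bd P (r*p) B2) (hp : p.Prime)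
    (hpP : p ∉ P) (hc : ∀ l ∈ P, IsCoprime (l:ℤ) p) (hr : IsCoprime (r:ℤ) p) (h1 : 0 ≤ B1) (h2 : 0 ≤ B2) :
    Bd (insert p P) r (12/(p:ℝ)^7*B1 + 6/(p:ℝ)^5*B2) := by
  intro S hS X hX h
  have hpp : Prime (p:ℤ) := Nat.prime_iff_prime_int.1 hp
  have hp1 : (1:ℝ) ≤ p := by exact_mod_cast hp.one_lt.le
  have hGP : ∀ w, GP (insert p P) w = g p w * GP P w := fun w => Finset.prod_insert hpP
  simp only [hGP]
  have hcase : ∀ (T : Finset CF) (m V : ℝ), T ⊆ S → (∀ x ∈ T, g p x = m) → 0 ≤ m →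
      ∑ w ∈ T, GP P w ≤ V → ∑ w ∈ T, g p w * GP P w ≤ m * V := by
    intro T m V hT hm hm0 hV
    rw [Finset.sum_congr rfl fun x hx => by rw [hm x hx], ← Finset.mul_sum]
    exact mul_le_mul_of_nonneg_left hV hm0
  have q1 : ∀ T ⊆ S, (∀ x ∈ T, dvdW ((p:ℤ)^2) x) →
      ∑ w ∈ T, g p w * GP P w ≤ 3/(p:ℝ)^2 * (B1*(X/(p:ℝ)^8)) := fun T hT hx =>
    hcase T _ _ hT (fun x hxT => if_pos (hx x hxT)) (by positivity)
      (step_scl hB1 hp hc hr 2 (hS.mono hT) hX (fun x hx => h x (hT hx)) hx)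
  have q2 : ∀ T ⊆ S, (∀ x ∈ T, ¬ dvdW ((p:ℤ)^2) x ∧ dvdW (p:ℤ) x) →
      ∑ w ∈ T, g p w * GP P w ≤ 3/(p:ℝ)^3 * (B1*(X/(p:ℝ)^4)) := fun T hT hx =>
    hcase T _ _ hT (fun x hxT => by unfold g; rw [if_neg (hx x hxT).1, if_pos (hx x hxT).2]) (by positivity)
      (step_scl hB1 hp hc hr 1 (hS.mono hT) hX (fun x hx => h x (hT hx)) fun x hxT => by
        simpa using (hx x hxT).2)
  have hn2 : ∀ x, ¬ dvdW (p:ℤ) x → ¬ dvdW ((p:ℤ)^2) x := by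
    intro x hx hx2
    have : (p:ℤ) ∣ (p:ℤ)^2 := dvd_pow_self _ two_ne_zero
    exact hx ⟨this.trans hx2.1, this.trans hx2.2.1, this.trans hx2.2.2.1, this.trans hx2.2.2.2⟩
  have g3 : ∀ x, ¬ dvdW (p:ℤ) x → dvdH ((p:ℤ)^2) x → g p x = 3/(p:ℝ)^3 := fun x h1 h2 => by
    unfold g; rw [if_neg (hn2 x h1), if_neg h1, if_pos h2]
  have q3 : ∀ T ⊆ S, (∀ x ∈ T, (¬ dvdW (p:ℤ) x ∧ dvdH ((p:ℤ)^2) x) ∧ ¬ (p:ℤ)^3 ∣ (nf p x).a) →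
      ∑ w ∈ T, g p w * GP P w ≤ 3/(p:ℝ)^3 * (B2*(X/(p:ℝ)^2)) := fun T hT hx =>
    hcase T _ _ hT (fun x hxT => g3 x (hx x hxT).1.1 (hx x hxT).1.2) (by positivity)
      (step_A hB2 hp hc hr (hS.mono hT) hX (fun x hx => h x (hT hx)) fun x hxT => by
        have := nf_spec hpp (hx x hxT).1.1 (hx x hxT).1.2
        exact ⟨this.1, this.2, (hx x hxT).2⟩)
  have q4 : ∀ T ⊆ S, (∀ x ∈ T, (¬ dvdW (p:ℤ) x ∧ dvdH ((p:ℤ)^2) x) ∧ (p:ℤ)^3 ∣ (nf p x).a) →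
      ∑ w ∈ T, g p w * GP P w ≤ 3/(p:ℝ)^3 * ((p+1)*(B1*(X/(p:ℝ)^6))) := fun T hT hx =>
    hcase T _ _ hT (fun x hxT => g3 x (hx x hxT).1.1 (hx x hxT).1.2) (by positivity)
      (step_B hB1 hp hc hr (hS.mono hT) hX (fun x hx => h x (hT hx)) fun x hxT => by
        have := nf_spec hpp (hx x hxT).1.1 (hx x hxT).1.2
        exact ⟨this.1, this.2, (hx x hxT).2⟩)
  have q5 : ∀ T ⊆ S, (∀ x ∈ T, ¬ dvdW (p:ℤ) x ∧ ¬ dvdH ((p:ℤ)^2) x ∧ dvdH (p:ℤ) x) →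
      ∑ w ∈ T, g p w * GP P w ≤ 3/(p:ℝ)^5 * (B2*X) := fun T hT hx =>
    hcase T _ _ hT (fun x hxT => by
      unfold g; rw [if_neg (hn2 x (hx x hxT).1), if_neg (hx x hxT).1, if_neg (hx x hxT).2.1, if_pos (hx x hxT).2.2])
      (by positivity)
      (hB2 T (hS.mono hT) X hX fun x hxT => by
        obtain ⟨a1,a2,a3⟩ := h x (hT hxT)
        have g2 := (hx x hxT).2.2
        refine ⟨a1,a2,?_⟩
        push_cast
        exact ⟨hr.mul_dvd a3.1 g2.1, hr.mul_dvd a3.2.1 g2.2.1, hr.mul_dvd a3.2.2 g2.2.2⟩)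
  have q6 : ∀ T ⊆ S, (∀ x ∈ T, ¬ dvdW (p:ℤ) x ∧ ¬ dvdH ((p:ℤ)^2) x ∧ ¬ dvdH (p:ℤ) x) →
      ∑ w ∈ T, g p w * GP P w ≤ 0 := fun T hT hx => by
    refine le_of_eq (Finset.sum_eq_zero fun x hxT => ?_)
    have : g p x = 0 := by
      unfold g; rw [if_neg (hn2 x (hx x hxT).1), if_neg (hx x hxT).1, if_neg (hx x hxT).2.1, if_neg (hx x hxT).2.2]
    rw [this, zero_mul]
  have split : ∀ (T : Finset CF) (A : CF → Prop) (V1 V2 : ℝ) , (∀ T1 ⊆ T, (∀ x ∈ T1, A x) →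
      ∑ w ∈ T1, g p w * GP P w ≤ V1) → (∀ T1 ⊆ T, (∀ x ∈ T1, ¬ A x) →
      ∑ w ∈ T1, g p w * GP P w ≤ V2) → ∑ w ∈ T, g p w * GP P w ≤ V1 + V2 := by
    intro T A V1 V2 hV1 hV2
    rw [← Finset.sum_filter_add_sum_filter_not T A]
    exact add_le_add (hV1 _ (Finset.filter_subset _ _) fun x hx => (Finset.mem_filter.1 hx).2)
      (hV2 _ (Finset.filter_subset _ _) fun x hx => (Finset.mem_filter.1 hx).2)
  have main : ∑ w ∈ S, g p w * GP P w ≤ (3/(p:ℝ)^2 * (B1*(X/(p:ℝ)^8)) + 3/(p:ℝ)^3 * (B1*(X/(p:ℝ)^4))) +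
      ((3/(p:ℝ)^3 * ((p+1)*(B1*(X/(p:ℝ)^6))) + 3/(p:ℝ)^3 * (B2*(X/(p:ℝ)^2))) +
        (3/(p:ℝ)^5 * (B2*X) + 0)) := by
    refine split S (fun x => dvdW (p:ℤ) x) _ _ ?_ ?_
    · intro T hT a
      refine split T (fun x => dvdW ((p:ℤ)^2) x) _ _ ?_ ?_
      · intro T1 hT1 b; exact q1 T1 (hT1.trans hT) b
      · intro T1 hT1 b; exact q2 T1 (hT1.trans hT) fun x hx => ⟨b x hx, a x (hT1 hx)⟩
    · intro T hT a
      refine split T (fun x => dvdH ((p:ℤ)^2) x) _ _ ?_ ?_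
      · intro T1 hT1 b
        refine split T1 (fun x => (p:ℤ)^3 ∣ (nf p x).a) _ _ ?_ ?_
        · intro T2 hT2 c
          exact q4 T2 ((hT2.trans hT1).trans hT) fun x hx => ⟨⟨a x (hT1 (hT2 hx)), b x (hT2 hx)⟩, c x hx⟩
        · intro T2 hT2 c
          exact q3 T2 ((hT2.trans hT1).trans hT) fun x hx => ⟨⟨a x (hT1 (hT2 hx)), b x (hT2 hx)⟩, c x hx⟩
      · intro T1 hT1 b
        refine split T1 (fun x => dvdH (p:ℤ) x) _ _ ?_ ?_
        · intro T2 hT2 c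
          exact q5 T2 ((hT2.trans hT1).trans hT) fun x hx => ⟨a x (hT1 (hT2 hx)), b x (hT2 hx), c x hx⟩
        · intro T2 hT2 c
          exact q6 T2 ((hT2.trans hT1).trans hT) fun x hx => ⟨a x (hT1 (hT2 hx)), b x (hT2 hx), c x hx⟩
  refine main.trans ?_
  have e1 : 3/(p:ℝ)^2 * (B1*(X/(p:ℝ)^8)) ≤ 3/(p:ℝ)^7*(B1*X) := by
    have : 3/(p:ℝ)^2 * (B1*(X/(p:ℝ)^8)) = 3/(p:ℝ)^10*(B1*X) := by field_simp
    rw [this]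
    gcongr
    norm_num
  have e4 : 3/(p:ℝ)^3 * ((p+1)*(B1*(X/(p:ℝ)^6))) ≤ 6/(p:ℝ)^7*(B1*X) := by
    have : 3/(p:ℝ)^3 * ((p+1)*(B1*(X/(p:ℝ)^6))) = 3*(p+1)/(p:ℝ)^9*(B1*X) := by field_simp
    rw [this]
    refine mul_le_mul_of_nonneg_right ?_ (by positivity)
    rw [div_le_div_iff₀ (by positivity) (by positivity)]
    have : 3*((p:ℝ)+1) ≤ 6*p^2 := by nlinarith
    calc _ ≤ (6*(p:ℝ)^2)*p^7 := mul_le_mul_of_nonneg_right this (by positivity)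
      _ = _ := by ring
  have e2 : 3/(p:ℝ)^3 * (B1*(X/(p:ℝ)^4)) = 3/(p:ℝ)^7*(B1*X) := by field_simp
  have e3 : 3/(p:ℝ)^3 * (B2*(X/(p:ℝ)^2)) = 3/(p:ℝ)^5*(B2*X) := by field_simp
  rw [e2, e3]
  have : (12/(p:ℝ)^7*B1 + 6/(p:ℝ)^5*B2)*X = 3/(p:ℝ)^7*(B1*X) + 3/(p:ℝ)^7*(B1*X) + 6/(p:ℝ)^7*(B1*X)
    + 3/(p:ℝ)^5*(B2*X) + 3/(p:ℝ)^5*(B2*X) := by ring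
  rw [this]
  linarith

lemma Bd_all {η C : ℝ} (hη : 0 < η) (hC : 0 < C) (hbase : ∀ r : ℕ, Squarefree r → Bd ∅ r (C*(r:ℝ)^(-2+η))) :
    ∀ P : Finset ℕ, (∀ p ∈ P, p.Prime) → ∀ r : ℕ, Squarefree r → (∀ p ∈ P, Nat.Coprime r p) →
      Bd P r ((∏ p ∈ P, (18*(p:ℝ)^(-7+η))) * (C*(r:ℝ)^(-2+η))) := by
  intro P
  induction P using Finset.induction_on with
  | empty => intro _ r hr _; simpa using hbase r hr
  | insert p P hp ih =>
    intro hP r hr hc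
    have hpP : p.Prime := hP p (Finset.mem_insert_self _ _)
    have hP' : ∀ l ∈ P, l.Prime := fun l hl => hP l (Finset.mem_insert_of_mem hl)
    have hc' : ∀ l ∈ P, Nat.Coprime r l := fun l hl => hc l (Finset.mem_insert_of_mem hl)
    have hrp : Nat.Coprime r p := hc p (Finset.mem_insert_self _ _)
    have hlp : ∀ l ∈ P, Nat.Coprime l p := fun l hl =>
      (Nat.coprime_primes (hP' l hl) hpP).2 (by rintro rfl; exact hp hl)
    have b1 := ih hP' r hr hc'
    have b2 := ih hP' (r*p) (Nat.squarefree_mul_iff.2 ⟨hrp, hr, hpP.prime.squarefree⟩)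
      (fun l hl => Nat.Coprime.mul_left (hc' l hl) (hlp l hl).symm)
    have hr0 : (0:ℝ) < r := by exact_mod_cast Nat.pos_of_ne_zero hr.ne_zero
    have hp0 : (0:ℝ) < p := by exact_mod_cast hpP.pos
    have hp1 : (1:ℝ) ≤ p := by exact_mod_cast hpP.one_lt.le
    have st := Bd_step b1 b2 hpP hp (fun l hl => Nat.isCoprime_iff_coprime.2 (hlp l hl))
      (Nat.isCoprime_iff_coprime.2 hrp) (by positivity) (by positivity)
    intro S hS X hX h
    refine (st S hS X hX h).trans (mul_le_mul_of_nonneg_right ?_ hX)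
    rw [Finset.prod_insert hp]
    push_cast
    rw [Real.mul_rpow hr0.le hp0.le]
    have hR : 0 ≤ (r:ℝ)^(-2+η) := by positivity
    have hQ : 0 ≤ ∏ p ∈ P, (18*(p:ℝ)^(-7+η)) := Finset.prod_nonneg fun _ _ => by positivity
    generalize (r:ℝ)^(-2+η) = R at *
    generalize ∏ p ∈ P, (18*(p:ℝ)^(-7+η)) = Q at *
    have z7 : (p:ℝ)^(-7+η) = (p:ℝ)^η/(p:ℝ)^7 := by
      rw [Real.rpow_add hp0, Real.rpow_neg hp0.le]; norm_num; ring
    have z2 : (p:ℝ)^(-2+η) = (p:ℝ)^η/(p:ℝ)^2 := by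
      rw [Real.rpow_add hp0, Real.rpow_neg hp0.le]; norm_num; ring
    have z1 : 1 ≤ (p:ℝ)^η := Real.one_le_rpow hp1 hη.le
    rw [z7, z2]
    generalize (p:ℝ)^η = Y at *
    have e : 18*(Y/(p:ℝ)^7)*Q*(C*R) - (12/(p:ℝ)^7*(Q*(C*R)) + 6/(p:ℝ)^5*(Q*(C*(R*(Y/(p:ℝ)^2))))) =
        (Y-1)*(12/(p:ℝ)^7*(Q*(C*R))) := by field_simp; ring
    have : 0 ≤ (Y-1)*(12/(p:ℝ)^7*(Q*(C*R))) := mul_nonneg (by linarith) (by positivity)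
    linarith

/-- weighted count -/
lemma WC (ε : ℝ) (hε : 0 < ε) : ∃ C : ℝ, 0 < C ∧ ∀ q : ℕ, Squarefree q →
    Bd q.primeFactors 1 (C*(q:ℝ)^(-7+ε)) := by
  obtain ⟨C, hC, hMC⟩ := MC (ε/2) (by positivity)
  have hbase : ∀ r : ℕ, Squarefree r → Bd ∅ r (C*(r:ℝ)^(-2+ε/2)) := by
    intro r hr S hS X hX h
    have := hMC r hr S hS X hX h
    simpa [GP] using this
  obtain ⟨T, hT1, hT⟩ := tau_bound (ε/10) (by positivity)
  refine ⟨T^5*C, by positivity, fun q hq => ?_⟩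
  have b := Bd_all (by positivity) hC hbase q.primeFactors (fun p hp => Nat.prime_of_mem_primeFactors hp) 1
    squarefree_one (fun p _ => Nat.coprime_one_left p)
  intro S hS X hX h
  refine (b S hS X hX h).trans (mul_le_mul_of_nonneg_right ?_ hX)
  have hq0 : 0 < q := Nat.pos_of_ne_zero hq.ne_zero
  have e1 : (∏ p ∈ q.primeFactors, (18*(p:ℝ)^(-7+ε/2))) = 18^q.primeFactors.card * (q:ℝ)^(-7+ε/2) := by
    rw [Finset.prod_mul_distrib, Finset.prod_const, Real.finset_prod_rpow _ _ (fun i _ => by positivity)]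
    congr 2
    rw [← Nat.cast_prod, Nat.prod_primeFactors_of_squarefree hq]
  have e2 : (18:ℝ)^q.primeFactors.card ≤ (T*(q:ℝ)^(ε/10))^5 := by
    calc (18:ℝ)^q.primeFactors.card ≤ (2^5)^q.primeFactors.card := by gcongr; norm_num
      _ = (q.divisors.card:ℝ)^5 := by
        rw [Nat.card_divisors hq.ne_zero]
        have : ∀ x ∈ q.primeFactors, q.factorization x + 1 = 2 := fun x hx => by
          have h1 := hq.natFactorization_le_one x
          have h2 := (Nat.prime_of_mem_primeFactors hx).factorization_pos_of_dvd hq.ne_zero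
            (Nat.dvd_of_mem_primeFactors hx)
          omega
        rw [Finset.prod_congr rfl this, Finset.prod_const]
        push_cast
        rw [← pow_mul, ← pow_mul, mul_comm]
      _ ≤ _ := by gcongr; exact hT q hq0
  have e3 : (T*(q:ℝ)^(ε/10))^5 * (q:ℝ)^(-7+ε/2) = T^5 * (q:ℝ)^(-7+ε) := by
    have hqq : (0:ℝ) < q := by exact_mod_cast hq0
    rw [mul_pow, ← Real.rpow_natCast ((q:ℝ)^(ε/10)), ← Real.rpow_mul hqq.le, mul_assoc, ← Real.rpow_add hqq]
    congr 2; push_cast; ring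
  rw [e1]
  simp only [Nat.cast_one, Real.one_rpow, mul_one]
  calc _ ≤ (T*(q:ℝ)^(ε/10))^5 * (q:ℝ)^(-7+ε/2) * C := by gcongr
    _ = _ := by rw [e3]; ring

end CF
end DW
end

noncomputable section
namespace DW

/-- `exp(2 π i k / n)` -/
def ee (n : ℕ) (k : ℤ) : ℂ := Complex.exp (2*Real.pi*Complex.I*(k:ℂ)/(n:ℂ))

lemma ee_add (n : ℕ) (k l : ℤ) : ee n (k+l) = ee n k * ee n l := by
  unfold ee; rw [← Complex.exp_add]; congr 1; push_cast; ring

lemma ee_eq_one_iff {n : ℕ} (hn : 0 < n) (k : ℤ) : ee n k = 1 ↔ (n:ℤ) ∣ k := by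
  have hn' : (n:ℂ) ≠ 0 := by exact_mod_cast hn.ne'
  unfold ee
  rw [Complex.exp_eq_one_iff]
  constructor
  · rintro ⟨m, hm⟩
    refine ⟨m, ?_⟩
    have h2 : (2*Real.pi*Complex.I : ℂ) ≠ 0 := Complex.two_pi_I_ne_zero
    have : (2*Real.pi*Complex.I : ℂ)*(k:ℂ) = (2*Real.pi*Complex.I : ℂ)*((n:ℂ)*m) := by
      field_simp at hm
      linear_combination (2*Real.pi*Complex.I : ℂ)*hm
    have := mul_left_cancel₀ h2 this
    exact_mod_cast this
  · rintro ⟨m, rfl⟩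
    refine ⟨m, ?_⟩
    push_cast; field_simp

lemma ee_norm (n : ℕ) (k : ℤ) : ‖ee n k‖ = 1 := by
  unfold ee
  rw [show (2*Real.pi*Complex.I*(k:ℂ)/(n:ℂ)) = ((2*Real.pi*k/n : ℝ):ℂ)*Complex.I by push_cast; ring]
  exact Complex.norm_exp_ofReal_mul_I _

lemma ee_period {n : ℕ} (hn : 0 < n) {k l : ℤ} (h : (n:ℤ) ∣ k - l) : ee n k = ee n l := by
  rw [show k = l + (k-l) by ring, ee_add, (ee_eq_one_iff hn _).2 h, mul_one]

/-- periodicity -/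
def Per (n : ℕ) (F : ℤ → ℂ) : Prop := ∀ k l : ℤ, (n:ℤ) ∣ k - l → F k = F l

lemma sum_range_emod {n : ℕ} (hn : 0 < n) (F : ℤ → ℂ) (hF : Per n F) (c : ℤ) :
    ∑ k ∈ Finset.range n, F (k + c) = ∑ k ∈ Finset.range n, F k := by
  have hn0 : (n:ℤ) ≠ 0 := by exact_mod_cast hn.ne'
  have hnn : (0:ℤ) < n := by exact_mod_cast hn
  have hcast : ∀ x : ℤ, ((x % n).toNat : ℤ) = x % n := fun x => Int.toNat_of_nonneg (Int.emod_nonneg _ hn0)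
  have hlt : ∀ x : ℤ, (x % n).toNat ∈ Finset.range n := fun x => by
    rw [Finset.mem_range]; zify; rw [hcast]; exact Int.emod_lt_of_pos _ hnn
  refine Finset.sum_nbij' (fun k : ℕ => (((k:ℤ)+c) % n).toNat) (fun k : ℕ => (((k:ℤ)-c) % n).toNat)
    (fun k _ => hlt _) (fun k _ => hlt _) ?_ ?_ ?_
  · intro k hk
    rw [Finset.mem_range] at hk
    zify
    rw [hcast, hcast]
    rw [Int.sub_emod, Int.emod_emod, ← Int.sub_emod, add_sub_cancel_right]
    exact Int.emod_eq_of_lt (by positivity) (by exact_mod_cast hk)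
  · intro k hk
    rw [Finset.mem_range] at hk
    zify
    rw [hcast, hcast]
    rw [Int.add_emod, Int.emod_emod, ← Int.add_emod, sub_add_cancel]
    exact Int.emod_eq_of_lt (by positivity) (by exact_mod_cast hk)
  · intro k hk
    apply hF
    rw [hcast]
    exact ⟨((k:ℤ)+c)/n, by have := Int.emod_add_mul_ediv ((k:ℤ)+c) n; linarith⟩

/-- one-dimensional sums -/
lemma sum1 {m l : ℕ} (hm : 0 < m) (hl : 0 < l) (k : ℤ) :
    ‖∑ y ∈ Finset.range (m*l), (if (m:ℤ) ∣ (y:ℤ) then (1:ℂ) else 0) * ee (m*l) (k*y)‖ ≤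
      if (l:ℤ) ∣ k then (l:ℝ) else 0 := by
  split_ifs with h
  · calc _ ≤ ∑ y ∈ Finset.range (m*l), (if (m:ℤ) ∣ (y:ℤ) then (1:ℝ) else 0) := by
          refine (norm_sum_le _ _).trans (Finset.sum_le_sum fun y _ => ?_)
          rw [norm_mul, ee_norm]; split_ifs <;> simp
      _ ≤ l := by
        rw [← Finset.sum_filter, Finset.sum_const, nsmul_eq_mul, mul_one]
        have : ((Finset.range (m*l)).filter (fun y : ℕ => (m:ℤ) ∣ (y:ℤ))) ⊆ (Finset.range l).image (fun j => m*j) := by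
          intro y hy
          rw [Finset.mem_filter, Finset.mem_range] at hy
          obtain ⟨h1, h2⟩ := hy
          obtain ⟨j, rfl⟩ := Int.natCast_dvd_natCast.1 h2
          exact Finset.mem_image.2 ⟨j, Finset.mem_range.2 (Nat.lt_of_mul_lt_mul_left h1), rfl⟩
        have := (Finset.card_le_card this).trans Finset.card_image_le
        rw [Finset.card_range] at this
        exact_mod_cast this
  · have hn : 0 < m*l := by positivity
    have hper : Per (m*l) (fun y => (if (m:ℤ) ∣ y then (1:ℂ) else 0) * ee (m*l) (k*y)) := by
      intro a b hab
      have hd : (m:ℤ) ∣ a - b := (Dvd.intro _ (by push_cast; rfl)).trans hab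
      have h1 : (m:ℤ) ∣ a ↔ (m:ℤ) ∣ b := by
        constructor
        · intro h; have := dvd_sub h hd; simpa using this
        · intro h; have := dvd_add hd h; simpa using this
      simp only [h1]
      rw [ee_period hn]
      rw [← mul_sub]; exact hab.mul_left _
    have hs := sum_range_emod hn _ hper m
    have e : ∀ y : ℕ, (if (m:ℤ) ∣ (y:ℤ)+m then (1:ℂ) else 0) * ee (m*l) (k*((y:ℤ)+m)) =
        ee (m*l) (k*m) * ((if (m:ℤ) ∣ (y:ℤ) then (1:ℂ) else 0) * ee (m*l) (k*y)) := by
      intro y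
      rw [mul_add, ee_add]
      simp only [dvd_add_self_right]
      ring
    simp only [e] at hs
    rw [← Finset.mul_sum] at hs
    have hne : ee (m*l) (k*m) ≠ 1 := by
      rw [Ne, ee_eq_one_iff hn]
      intro hd
      apply h
      push_cast at hd
      rw [mul_comm k] at hd
      exact (mul_dvd_mul_iff_left (by exact_mod_cast hm.ne')).1 hd
    generalize ∑ y ∈ Finset.range (m*l), (if (m:ℤ) ∣ (y:ℤ) then (1:ℂ) else 0) * ee (m*l) (k*y) = T at *
    have : (ee (m*l) (k*m) - 1)*T = 0 := by linear_combination hs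
    rcases mul_eq_zero.1 this with h|h
    · exact absurd (by linear_combination h) hne
    · rw [h]; simp

def S4 (n : ℕ) (F : ℤ → ℤ → ℤ → ℤ → ℂ) : ℂ :=
  ∑ y1 ∈ Finset.range n, ∑ y2 ∈ Finset.range n, ∑ y3 ∈ Finset.range n, ∑ y4 ∈ Finset.range n,
    F y1 y2 y3 y4

lemma S4_prod (n : ℕ) (f1 f2 f3 f4 : ℤ → ℂ) :
    S4 n (fun a b c d => f1 a * f2 b * f3 c * f4 d) = (∑ y ∈ Finset.range n, f1 y) *
      (∑ y ∈ Finset.range n, f2 y) * (∑ y ∈ Finset.range n, f3 y) * (∑ y ∈ Finset.range n, f4 y) := by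
  unfold S4
  simp only [← Finset.mul_sum, ← Finset.sum_mul]

lemma S4_shift {n : ℕ} (hn : 0 < n) (F : ℤ → ℤ → ℤ → ℤ → ℂ) (h1 : ∀ b c d, Per n (fun a => F a b c d))
    (h2 : ∀ a c d, Per n (fun b => F a b c d)) (h3 : ∀ a b d, Per n (fun c => F a b c d)) (t : ℤ) :
    S4 n F = S4 n (fun a b c d => F (a + (-t*b+t^2*c-t^3*d)) (b+(-2*t*c+3*t^2*d)) (c+(-3*t*d)) d) := by
  unfold S4
  have e3 : ∀ a b : ℤ, ∑ y3 ∈ Finset.range n, ∑ y4 ∈ Finset.range n, F a b y3 y4 =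
      ∑ y3 ∈ Finset.range n, ∑ y4 ∈ Finset.range n, F a b (y3+(-3*t*y4)) y4 := by
    intro a b
    rw [Finset.sum_comm]
    rw [Finset.sum_comm (f := fun (y3 y4 : ℕ) => F a b (y3+(-3*t*y4)) y4)]
    refine Finset.sum_congr rfl fun y4 _ => ?_
    exact (sum_range_emod hn _ (h3 a b y4) _).symm
  simp only [e3]
  have e2 : ∀ a : ℤ, ∑ y2 ∈ Finset.range n, ∑ y3 ∈ Finset.range n, ∑ y4 ∈ Finset.range n, F a y2 (y3+(-3*t*y4)) y4 =
      ∑ y2 ∈ Finset.range n, ∑ y3 ∈ Finset.range n, ∑ y4 ∈ Finset.range n,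
        F a (y2+(-2*t*y3+3*t^2*y4)) (y3+(-3*t*y4)) y4 := by
    intro a
    rw [Finset.sum_comm]
    rw [Finset.sum_comm (f := fun (y2 y3 : ℕ) => ∑ y4 ∈ Finset.range n, F a (y2+(-2*t*y3+3*t^2*y4)) (y3+(-3*t*y4)) y4)]
    refine Finset.sum_congr rfl fun y3 _ => ?_
    rw [Finset.sum_comm]
    rw [Finset.sum_comm (f := fun (y2 y4 : ℕ) => F a (y2+(-2*t*y3+3*t^2*y4)) (y3+(-3*t*y4)) y4)]
    refine Finset.sum_congr rfl fun y4 _ => ?_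
    exact (sum_range_emod hn _ (h2 a _ y4) _).symm
  simp only [e2]
  rw [Finset.sum_comm]
  rw [Finset.sum_comm (f := fun (y1 y2 : ℕ) => ∑ y3 ∈ Finset.range n, ∑ y4 ∈ Finset.range n,
    F (y1 + (-t*y2+t^2*y3-t^3*y4)) (y2+(-2*t*y3+3*t^2*y4)) (y3+(-3*t*y4)) y4)]
  refine Finset.sum_congr rfl fun y2 _ => ?_
  rw [Finset.sum_comm]
  rw [Finset.sum_comm (f := fun (y1 y3 : ℕ) => ∑ y4 ∈ Finset.range n,
    F (y1 + (-t*y2+t^2*y3-t^3*y4)) (y2+(-2*t*y3+3*t^2*y4)) (y3+(-3*t*y4)) y4)]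
  refine Finset.sum_congr rfl fun y3 _ => ?_
  rw [Finset.sum_comm]
  rw [Finset.sum_comm (f := fun (y1 y4 : ℕ) =>
    F (y1 + (-t*y2+t^2*y3-t^3*y4)) (y2+(-2*t*y3+3*t^2*y4)) (y3+(-3*t*y4)) y4)]
  refine Finset.sum_congr rfl fun y4 _ => ?_
  exact (sum_range_emod hn _ (h1 _ _ y4) _).symm

end DW
end

noncomputable section
namespace DW

def AA (p : ℕ) (r : Option ℕ) (y1 y2 y3 y4 : ℤ) : Prop :=
  match r with
  | none => (p:ℤ)^2 ∣ y4 ∧ (p:ℤ) ∣ y3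
  | some t => (p:ℤ)^2 ∣ y1+t*y2+(t:ℤ)^2*y3+(t:ℤ)^3*y4 ∧ (p:ℤ) ∣ y2+2*t*y3+3*(t:ℤ)^2*y4

def PW (p : ℕ) (y1 y2 y3 y4 : ℤ) : Prop := (p:ℤ) ∣ y1 ∧ (p:ℤ) ∣ y2 ∧ (p:ℤ) ∣ y3 ∧ (p:ℤ) ∣ y4

def RR (p : ℕ) : Finset (Option ℕ) := Finset.insertNone (Finset.range p)

lemma not_inUp_of {p : ℕ} {y1 y2 y3 y4 : ℤ} (h : PW p y1 y2 y3 y4 ∨ ∃ r, AA p r y1 y2 y3 y4) :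
    ¬ BCF.inUp p (y1,y2,y3,y4) := by
  rintro ⟨h1, h2⟩
  rcases h with h | ⟨r, h⟩
  · exact h1 h
  · cases r with
    | none =>
      refine h2 !![0,1;-1,0] (Or.inl (by simp [Matrix.det_fin_two])) ?_
      obtain ⟨ha, hb⟩ := h
      constructor
      · simpa [BCF.act, Matrix.det_fin_two] using ha
      · simpa [BCF.act, Matrix.det_fin_two] using hb
    | some t =>
      refine h2 !![1,(t:ℤ);0,1] (Or.inl (by simp [Matrix.det_fin_two])) ?_
      obtain ⟨ha, hb⟩ := h
      constructor
      · convert ha using 1; simp [BCF.act, Matrix.det_fin_two]; ring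
      · convert hb using 1; simp [BCF.act, Matrix.det_fin_two]; ring

lemma exists_AA {p : ℕ} (hp : p.Prime) {y1 y2 y3 y4 : ℤ} {a b c d e : ℤ} (he : a*d-b*c = e) (he' : e = 1 ∨ e = -1)
    (h1 : (p:ℤ)^2 ∣ e*(y1*a^3+y2*a^2*b+y3*a*b^2+y4*b^3))
    (h2 : (p:ℤ) ∣ e*(3*y1*a^2*c+y2*(a^2*d+2*a*c*b)+y3*(2*a*b*d+c*b^2)+3*y4*b^2*d)) :
    ∃ r ∈ RR p, AA p r y1 y2 y3 y4 := by
  have hpp : Prime (p:ℤ) := Nat.prime_iff_prime_int.1 hp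
  have hee : e*e = 1 := by rcases he' with h|h <;> rw [h] <;> norm_num
  have h1 : (p:ℤ)^2 ∣ (y1*a^3+y2*a^2*b+y3*a*b^2+y4*b^3) := by
    have := h1.mul_left e; rwa [← mul_assoc, hee, one_mul] at this
  have h2 : (p:ℤ) ∣ (3*y1*a^2*c+y2*(a^2*d+2*a*c*b)+y3*(2*a*b*d+c*b^2)+3*y4*b^2*d) := by
    have := h2.mul_left e; rwa [← mul_assoc, hee, one_mul] at this
  have hp2 : (p:ℤ) ∣ (p:ℤ)^2 := dvd_pow_self _ two_ne_zero
  have h1' := hp2.trans h1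
  by_cases ha : (p:ℤ) ∣ a
  · refine ⟨none, by simp [RR], ?_⟩
    have hb : ¬ (p:ℤ) ∣ b := by
      intro hb
      have : (p:ℤ) ∣ e := by rw [← he]; exact dvd_sub (ha.mul_right _) (hb.mul_right _)
      have := this.mul_left e
      rw [hee] at this
      exact hpp.not_unit (isUnit_of_dvd_one this)
    have hfu : (p:ℤ) ∣ 3*y1*a^2+2*y2*a*b+y3*b^2 := by
      have : 3*y1*a^2+2*y2*a*b+y3*b^2 = e*(3*d*(y1*a^3+y2*a^2*b+y3*a*b^2+y4*b^3) -
          b*(3*y1*a^2*c+y2*(a^2*d+2*a*c*b)+y3*(2*a*b*d+c*b^2)+3*y4*b^2*d)) := by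
        have : 3*d*(y1*a^3+y2*a^2*b+y3*a*b^2+y4*b^3) -
          b*(3*y1*a^2*c+y2*(a^2*d+2*a*c*b)+y3*(2*a*b*d+c*b^2)+3*y4*b^2*d) =
          e*(3*y1*a^2+2*y2*a*b+y3*b^2) := by rw [← he]; ring
        rw [this, ← mul_assoc, hee, one_mul]
      rw [this]
      exact (dvd_sub (h1'.mul_left _) (h2.mul_left _)).mul_left _
    have h3 : (p:ℤ) ∣ y3 := by
      have : (p:ℤ) ∣ y3*b^2 := by
        have e : y3*b^2 = (3*y1*a^2+2*y2*a*b+y3*b^2) - a*(3*y1*a+2*y2*b) := by ring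
        rw [e]; exact dvd_sub hfu (ha.mul_right _)
      rcases hpp.dvd_or_dvd this with h|h
      · exact h
      · exact absurd (hpp.dvd_of_dvd_pow h) hb
    refine ⟨?_, h3⟩
    have hco : IsCoprime ((p:ℤ)^2) (b^3) := ((hpp.irreducible.coprime_iff_not_dvd.2 hb)).pow
    refine hco.dvd_of_dvd_mul_right ?_
    have e : y4*b^3 = (y1*a^3+y2*a^2*b+y3*a*b^2+y4*b^3) - a^2*(y1*a+y2*b) - (y3*a)*b^2 := by ring
    rw [e]
    refine dvd_sub (dvd_sub h1 ((pow_dvd_pow_of_dvd ha 2).mul_right _)) ?_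
    rw [sq]; exact (mul_dvd_mul h3 ha).mul_right _
  · have hco : IsCoprime a ((p:ℤ)^2) := ((hpp.irreducible.coprime_iff_not_dvd.2 ha)).symm.pow_right
    obtain ⟨u, u', hu⟩ := hco
    -- s = b u satisfies a s ≡ b
    obtain ⟨s, hs⟩ : ∃ s, s = b*u := ⟨_, rfl⟩
    have hs' : (p:ℤ)^2 ∣ a*s - b := ⟨-b*u', by rw [hs]; linear_combination b*hu⟩
    have hfv : (p:ℤ) ∣ y2*a^2+2*y3*a*b+3*y4*b^2 := by
      have : y2*a^2+2*y3*a*b+3*y4*b^2 = e*(a*(3*y1*a^2*c+y2*(a^2*d+2*a*c*b)+y3*(2*a*b*d+c*b^2)+3*y4*b^2*d) -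
          3*c*(y1*a^3+y2*a^2*b+y3*a*b^2+y4*b^3)) := by
        have : a*(3*y1*a^2*c+y2*(a^2*d+2*a*c*b)+y3*(2*a*b*d+c*b^2)+3*y4*b^2*d) -
          3*c*(y1*a^3+y2*a^2*b+y3*a*b^2+y4*b^3) = e*(y2*a^2+2*y3*a*b+3*y4*b^2) := by rw [← he]; ring
        rw [this, ← mul_assoc, hee, one_mul]
      rw [this]
      exact (dvd_sub (h2.mul_left _) (h1'.mul_left _)).mul_left _
    have k1 : (p:ℤ)^2 ∣ y1+s*y2+s^2*y3+s^3*y4 := by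
      have hco : IsCoprime ((p:ℤ)^2) (a^3) := ((hpp.irreducible.coprime_iff_not_dvd.2 ha)).pow
      refine hco.dvd_of_dvd_mul_left ?_
      have e : a^3*(y1+s*y2+s^2*y3+s^3*y4) = (y1*a^3+y2*a^2*b+y3*a*b^2+y4*b^3) +
        (a*s-b)*(a^2*y2+a*y3*(a*s+b)+y4*(a^2*s^2+a*s*b+b^2)) := by ring
      rw [e]; exact dvd_add h1 (hs'.mul_right _)
    have k2 : (p:ℤ) ∣ y2+2*s*y3+3*s^2*y4 := by
      have hco : IsCoprime (p:ℤ) (a^2) := ((hpp.irreducible.coprime_iff_not_dvd.2 ha)).pow_right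
      refine hco.dvd_of_dvd_mul_left ?_
      have e : a^2*(y2+2*s*y3+3*s^2*y4) = (y2*a^2+2*y3*a*b+3*y4*b^2) +
        (a*s-b)*(2*a*y3+3*y4*(a*s+b)) := by ring
      rw [e]; exact dvd_add hfv ((hp2.trans hs').mul_right _)
    have hp0 : (0:ℤ) < p := by exact_mod_cast hp.pos
    have hcast : ((s % p).toNat : ℤ) = s % p := Int.toNat_of_nonneg (Int.emod_nonneg _ hp0.ne')
    refine ⟨some (s % p).toNat, ?_, ?_⟩
    · simp only [RR, Finset.some_mem_insertNone, Finset.mem_range]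
      zify; rw [hcast]; exact Int.emod_lt_of_pos _ hp0
    · obtain ⟨m, hm⟩ : ∃ m, m = s / p := ⟨_, rfl⟩
      have hsm : s % p = s - p*m := by rw [hm]; have := Int.emod_add_mul_ediv s p; linarith
      simp only [AA]
      rw [hcast, hsm]
      constructor
      · have e : y1 + (s-p*m)*y2+(s-p*m)^2*y3+(s-p*m)^3*y4 = (y1+s*y2+s^2*y3+s^3*y4) -
          (p*(y2+2*s*y3+3*s^2*y4))*m + (p:ℤ)^2*(m^2*y3+y4*(3*s*m^2-p*m^3)) := by ring
        rw [e]
        refine dvd_add (dvd_sub k1 (Dvd.dvd.mul_right ?_ _)) (dvd_mul_right _ _)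
        rw [sq]; exact mul_dvd_mul_left _ k2
      · have e : y2 + 2*(s-p*m)*y3+3*(s-p*m)^2*y4 = (y2+2*s*y3+3*s^2*y4) +
          (p:ℤ)*(-2*m*y3+3*y4*(-2*s*m+p*m^2)) := by ring
        rw [e]; exact dvd_add k2 (dvd_mul_right _ _)

lemma not_inUp_iff {p : ℕ} (hp : p.Prime) (y1 y2 y3 y4 : ℤ) :
    ¬ BCF.inUp p (y1,y2,y3,y4) ↔ PW p y1 y2 y3 y4 ∨ ∃ r ∈ RR p, AA p r y1 y2 y3 y4 := by
  constructor
  · intro h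
    by_contra hc
    rw [not_or] at hc
    apply h
    refine ⟨hc.1, fun γ hγ hh => hc.2 ?_⟩
    exact exists_AA hp (Matrix.det_fin_two γ).symm hγ hh.1 hh.2
  · rintro (h | ⟨r, _, h⟩)
    · exact not_inUp_of (Or.inl h)
    · exact not_inUp_of (Or.inr ⟨r, h⟩)

lemma sub_not_dvd {p t s : ℕ} (ht : t < p) (hs : s < p) (hne : t ≠ s) : ¬ (p:ℤ) ∣ (s:ℤ) - t := by
  intro h
  apply hne
  have := (Int.emod_emod_of_dvd (t:ℤ) (dvd_refl (p:ℤ)))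
  have h2 : (t:ℤ) % p = (s:ℤ) % p := (Int.emod_eq_emod_iff_emod_sub_eq_zero.2 (by
    rw [← neg_sub]; exact Int.emod_eq_zero_of_dvd (dvd_neg.2 h)))
  rw [Int.emod_eq_of_lt (by positivity) (by exact_mod_cast ht),
    Int.emod_eq_of_lt (by positivity) (by exact_mod_cast hs)] at h2
  exact_mod_cast h2

/-- the two triples vanish mod `p` -/
lemma AA_unique {p : ℕ} (hp : p.Prime) {y1 y2 y3 y4 : ℤ} {r r' : Option ℕ} (hr : r ∈ RR p) (hr' : r' ∈ RR p)
    (hne : r ≠ r') (h : AA p r y1 y2 y3 y4) (h' : AA p r' y1 y2 y3 y4) : PW p y1 y2 y3 y4 := by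
  have hpp : Prime (p:ℤ) := Nat.prime_iff_prime_int.1 hp
  have hp2 : (p:ℤ) ∣ (p:ℤ)^2 := dvd_pow_self _ two_ne_zero
  have key : ∀ t : ℕ, AA p none y1 y2 y3 y4 → AA p (some t) y1 y2 y3 y4 → PW p y1 y2 y3 y4 := by
    rintro t ⟨a1,a2⟩ ⟨b1,b2⟩
    have a1 := hp2.trans a1
    have b1 := hp2.trans b1
    have c2 : (p:ℤ) ∣ y2 := by
      have e : y2 = (y2+2*t*y3+3*(t:ℤ)^2*y4) - y3*(2*t) - y4*(3*(t:ℤ)^2) := by ring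
      rw [e]; exact dvd_sub (dvd_sub b2 (a2.mul_right _)) (a1.mul_right _)
    refine ⟨?_, c2, a2, a1⟩
    have e : y1 = (y1+t*y2+(t:ℤ)^2*y3+(t:ℤ)^3*y4) - y2*t - y3*(t:ℤ)^2 - y4*(t:ℤ)^3 := by ring
    rw [e]; exact dvd_sub (dvd_sub (dvd_sub b1 (c2.mul_right _)) (a2.mul_right _)) (a1.mul_right _)
  cases r with
  | none =>
    cases r' with
    | none => exact absurd rfl hne
    | some t => exact key t h h'
  | some t =>
    cases r' with
    | none => exact key t h' h
    | some s =>
      simp only [RR, Finset.some_mem_insertNone, Finset.mem_range] at hr hr'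
      have hts := sub_not_dvd hr hr' (fun e => hne (by rw [e]))
      obtain ⟨a1,a2⟩ := h
      obtain ⟨b1,b2⟩ := h'
      have a1 := hp2.trans a1
      have b1 := hp2.trans b1
      obtain ⟨u, hu⟩ : ∃ u : ℤ, u = (s:ℤ)-t := ⟨_, rfl⟩
      rw [← hu] at hts
      have hs : (s:ℤ) = t+u := by rw [hu]; ring
      rw [hs] at b1 b2
      generalize (t:ℤ) = t' at *
      obtain ⟨Y1, hY1⟩ : ∃ Y, Y = y1+t'*y2+t'^2*y3+t'^3*y4 := ⟨_, rfl⟩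
      obtain ⟨Y2, hY2⟩ : ∃ Y, Y = y2+2*t'*y3+3*t'^2*y4 := ⟨_, rfl⟩
      obtain ⟨Y3, hY3⟩ : ∃ Y, Y = y3+3*t'*y4 := ⟨_, rfl⟩
      rw [← hY1] at a1
      rw [← hY2] at a2
      have e1 : y1 + (t'+u)*y2+(t'+u)^2*y3+(t'+u)^3*y4 = Y1 + u*Y2+u^2*(Y3+u*y4) := by
        rw [hY1,hY2,hY3]; ring
      have e2 : y2+2*(t'+u)*y3+3*(t'+u)^2*y4 = Y2 + u*(2*Y3+3*u*y4) := by rw [hY2,hY3]; ring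
      rw [e1] at b1
      rw [e2] at b2
      have c1 : (p:ℤ) ∣ Y3+u*y4 := by
        have : (p:ℤ) ∣ u^2*(Y3+u*y4) := by
          have := dvd_sub b1 (dvd_add a1 (a2.mul_left u)); simpa using this
        exact (hpp.dvd_or_dvd this).resolve_left fun h => hts (hpp.dvd_of_dvd_pow h)
      have c2 : (p:ℤ) ∣ 2*Y3+3*u*y4 := by
        have : (p:ℤ) ∣ u*(2*Y3+3*u*y4) := by
          have := dvd_sub b2 a2; simpa using this
        exact (hpp.dvd_or_dvd this).resolve_left hts
      have c4 : (p:ℤ) ∣ y4 := by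
        have : (p:ℤ) ∣ u*y4 := by
          have e : u*y4 = (2*Y3+3*u*y4) - (Y3+u*y4)*2 := by ring
          rw [e]; exact dvd_sub c2 (c1.mul_right _)
        exact (hpp.dvd_or_dvd this).resolve_left hts
      have c3 : (p:ℤ) ∣ Y3 := by
        have e : Y3 = (Y3+u*y4) - y4*u := by ring
        rw [e]; exact dvd_sub c1 (c4.mul_right _)
      have d3 : (p:ℤ) ∣ y3 := by
        have e : y3 = Y3 - y4*(3*t') := by rw [hY3]; ring
        rw [e]; exact dvd_sub c3 (c4.mul_right _)
      have d2 : (p:ℤ) ∣ y2 := by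
        have e : y2 = Y2 - y3*(2*t') - y4*(3*t'^2) := by rw [hY2]; ring
        rw [e]; exact dvd_sub (dvd_sub a2 (d3.mul_right _)) (c4.mul_right _)
      refine ⟨?_, d2, d3, c4⟩
      have e : y1 = Y1 - y2*t' - y3*t'^2 - y4*t'^3 := by rw [hY1]; ring
      rw [e]; exact dvd_sub (dvd_sub (dvd_sub a1 (d2.mul_right _)) (d3.mul_right _)) (c4.mul_right _)

/-- indicator -/
def ii (P : Prop) : ℂ := if P then 1 else 0

lemma ind_eq {p : ℕ} (hp : p.Prime) (y1 y2 y3 y4 : ℤ) :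
    ii (¬ BCF.inUp p (y1,y2,y3,y4)) = ii (PW p y1 y2 y3 y4) +
      ∑ r ∈ RR p, (ii (AA p r y1 y2 y3 y4) - ii (PW p y1 y2 y3 y4 ∧ AA p r y1 y2 y3 y4)) := by
  have hi := not_inUp_iff hp y1 y2 y3 y4
  by_cases hw : PW p y1 y2 y3 y4
  · simp [hi, hw, ii]
  · have e : ii (¬ BCF.inUp p (y1,y2,y3,y4)) = ii (∃ r ∈ RR p, AA p r y1 y2 y3 y4) := by
      congr 1; exact propext (hi.trans ⟨fun h => h.resolve_left hw, Or.inr⟩)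
    rw [e]
    have z : ∀ r, ii (PW p y1 y2 y3 y4 ∧ AA p r y1 y2 y3 y4) = 0 := fun r => by simp [ii, hw]
    simp only [z, sub_zero]
    have z0 : ii (PW p y1 y2 y3 y4) = 0 := by simp [ii, hw]
    rw [z0, zero_add]
    by_cases hex : ∃ r ∈ RR p, AA p r y1 y2 y3 y4
    · obtain ⟨r, hr, hA⟩ := hex
      rw [Finset.sum_eq_single r]
      · rw [show ii (AA p r y1 y2 y3 y4) = 1 by simp [ii, hA]]
        unfold ii; rw [if_pos ⟨r, hr, hA⟩]
      · intro s hs hne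
        have : ¬ AA p s y1 y2 y3 y4 := fun h => hw (AA_unique hp hs hr hne h hA)
        simp [ii, this]
      · intro h; exact absurd hr h
    · rw [show ii (∃ r ∈ RR p, AA p r y1 y2 y3 y4) = 0 by unfold ii; rw [if_neg hex]]
      refine (Finset.sum_eq_zero fun r hr => ?_).symm
      have : ¬ AA p r y1 y2 y3 y4 := fun h => hex ⟨r, hr, h⟩
      simp [ii, this]

end DW
end

noncomputable section
namespace DW

def lin (w : CF) (y1 y2 y3 y4 : ℤ) : ℤ := w.d*y1 - w.c*y2 + w.b*y3 - w.a*y4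

def AP (p : ℕ) (r : Option ℕ) (w : CF) : Prop :=
  match r with
  | none => (p:ℤ) ∣ w.b ∧ (p:ℤ)^2 ∣ w.c ∧ (p:ℤ)^2 ∣ w.d
  | some t => (p:ℤ) ∣ w.c+t*w.d ∧ (p:ℤ)^2 ∣ w.b+2*t*w.c+(t:ℤ)^2*w.d ∧
      (p:ℤ)^2 ∣ w.a+3*w.b*t+3*w.c*(t:ℤ)^2+w.d*(t:ℤ)^3

def BP (p : ℕ) (r : Option ℕ) (w : CF) : Prop :=
  match r with
  | none => (p:ℤ) ∣ w.b ∧ (p:ℤ) ∣ w.c ∧ (p:ℤ) ∣ w.d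
  | some t => (p:ℤ) ∣ w.c+t*w.d ∧ (p:ℤ) ∣ w.b+2*t*w.c+(t:ℤ)^2*w.d ∧
      (p:ℤ) ∣ w.a+3*w.b*t+3*w.c*(t:ℤ)^2+w.d*(t:ℤ)^3

/-- real indicator -/
def jj (P : Prop) : ℝ := if P then 1 else 0
lemma jj_nonneg (P : Prop) : 0 ≤ jj P := by unfold jj; split_ifs <;> norm_num
lemma jj_le (P : Prop) : jj P ≤ 1 := by unfold jj; split_ifs <;> norm_num
lemma jj_and (P Q : Prop) : jj P * jj Q = jj (P ∧ Q) := by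
  by_cases h : P <;> by_cases h' : Q <;> simp [jj, h, h']
lemma jj_le_of {P Q : Prop} (h : P → Q) : jj P ≤ jj Q := by
  by_cases hP : P
  · simp [jj, hP, h hP]
  · have : jj P = 0 := by simp [jj, hP]
    rw [this]; exact jj_nonneg _
lemma ii_and (P Q : Prop) : ii (P ∧ Q) = ii P * ii Q := by
  by_cases h : P <;> by_cases h' : Q <;> simp [ii, h, h']

lemma J_gen {n m l : ℕ} (hn : n = m*l) (hm : 0 < m) (hl : 0 < l) (k : ℤ) :
    ‖∑ y ∈ Finset.range n, ii ((m:ℤ) ∣ (y:ℤ)) * ee n (k*y)‖ ≤ l * jj ((l:ℤ) ∣ k) := by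
  subst hn
  have e : ∀ y : ℕ, ii ((m:ℤ) ∣ (y:ℤ)) = (if (m:ℤ) ∣ (y:ℤ) then (1:ℂ) else 0) := by
    intro y
    by_cases h : (m:ℤ) ∣ (y:ℤ) <;> simp [ii, h]
  simp only [e]
  refine (sum1 hm hl k).trans ?_
  by_cases h : (l:ℤ) ∣ k <;> simp [jj, h]

variable {p : ℕ}

lemma J0 (hp : p.Prime) (k : ℤ) :
    ‖∑ y ∈ Finset.range (p^2), ii ((p:ℤ)^2 ∣ (y:ℤ)) * ee (p^2) (k*y)‖ ≤ 1 := by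
  have := J_gen (n := p^2) (m := p^2) (l := 1) (by ring) (pow_pos hp.pos 2) one_pos k
  push_cast at this
  refine this.trans ?_
  simp [jj]

lemma J1 (hp : p.Prime) (k : ℤ) :
    ‖∑ y ∈ Finset.range (p^2), ii ((p:ℤ) ∣ (y:ℤ)) * ee (p^2) (k*y)‖ ≤ p * jj ((p:ℤ) ∣ k) :=
  J_gen (n := p^2) (m := p) (l := p) (by ring) hp.pos hp.pos k

lemma J2 (hp : p.Prime) (k : ℤ) :
    ‖∑ y ∈ Finset.range (p^2), ee (p^2) (k*y)‖ ≤ (p:ℝ)^2 * jj ((p:ℤ)^2 ∣ k) := by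
  have := J_gen (n := p^2) (m := 1) (l := p^2) (by ring) one_pos (pow_pos hp.pos 2) k
  simpa [ii] using this

lemma dvd_congr {m a b : ℤ} (h : m ∣ a - b) : m ∣ a ↔ m ∣ b := (dvd_iff_dvd_of_dvd_sub h)

lemma AA_congr {r : Option ℕ} {y1 y2 y3 y4 z1 z2 z3 z4 : ℤ} (h1 : (p:ℤ)^2 ∣ y1 - z1) (h2 : (p:ℤ)^2 ∣ y2 - z2)
    (h3 : (p:ℤ)^2 ∣ y3 - z3) (h4 : (p:ℤ)^2 ∣ y4 - z4) : AA p r y1 y2 y3 y4 = AA p r z1 z2 z3 z4 := by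
  have hp2 : (p:ℤ) ∣ (p:ℤ)^2 := dvd_pow_self _ two_ne_zero
  apply propext
  cases r with
  | none => exact and_congr (dvd_congr h4) (dvd_congr (hp2.trans h3))
  | some t =>
    refine and_congr (dvd_congr ?_) (dvd_congr (hp2.trans ?_))
    · have e : y1+t*y2+(t:ℤ)^2*y3+(t:ℤ)^3*y4 - (z1+t*z2+(t:ℤ)^2*z3+(t:ℤ)^3*z4) =
        (y1-z1) + (y2-z2)*t+(y3-z3)*(t:ℤ)^2+(y4-z4)*(t:ℤ)^3 := by ring
      rw [e]
      exact dvd_add (dvd_add (dvd_add h1 (h2.mul_right _)) (h3.mul_right _)) (h4.mul_right _)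
    · have e : y2+2*t*y3+3*(t:ℤ)^2*y4 - (z2+2*t*z3+3*(t:ℤ)^2*z4) =
        (y2-z2)+(y3-z3)*(2*t)+(y4-z4)*(3*(t:ℤ)^2) := by ring
      rw [e]
      exact dvd_add (dvd_add h2 (h3.mul_right _)) (h4.mul_right _)

lemma PW_congr {y1 y2 y3 y4 z1 z2 z3 z4 : ℤ} (h1 : (p:ℤ)^2 ∣ y1 - z1) (h2 : (p:ℤ)^2 ∣ y2 - z2)
    (h3 : (p:ℤ)^2 ∣ y3 - z3) (h4 : (p:ℤ)^2 ∣ y4 - z4) : PW p y1 y2 y3 y4 = PW p z1 z2 z3 z4 := by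
  have hp2 : (p:ℤ) ∣ (p:ℤ)^2 := dvd_pow_self _ two_ne_zero
  exact propext (and_congr (dvd_congr (hp2.trans h1)) (and_congr (dvd_congr (hp2.trans h2))
    (and_congr (dvd_congr (hp2.trans h3)) (dvd_congr (hp2.trans h4)))))

lemma lin_congr {n : ℕ} (hn : 0 < n) (w : CF) {y1 y2 y3 y4 z1 z2 z3 z4 : ℤ} (h1 : (n:ℤ) ∣ y1 - z1) (h2 : (n:ℤ) ∣ y2 - z2)
    (h3 : (n:ℤ) ∣ y3 - z3) (h4 : (n:ℤ) ∣ y4 - z4) : ee n (lin w y1 y2 y3 y4) = ee n (lin w z1 z2 z3 z4) := by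
  apply ee_period hn
  have e : lin w y1 y2 y3 y4 - lin w z1 z2 z3 z4 = (y1-z1)*w.d - (y2-z2)*w.c+(y3-z3)*w.b-(y4-z4)*w.a := by
    unfold lin; ring
  rw [e]
  exact dvd_sub (dvd_add (dvd_sub (h1.mul_right _) (h2.mul_right _)) (h3.mul_right _)) (h4.mul_right _)

lemma S4_congr {n : ℕ} {F G : ℤ → ℤ → ℤ → ℤ → ℂ} (h : ∀ a b c d, F a b c d = G a b c d) : S4 n F = S4 n G := by
  have : F = G := by funext a b c d; exact h a b c d
  rw [this]

lemma ee_lin (n : ℕ) (w : CF) (a b c d : ℤ) : ee n (lin w a b c d) =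
    ee n (w.d*a) * ee n (-w.c*b) * ee n (w.b*c) * ee n (-w.a*d) := by
  rw [← ee_add, ← ee_add, ← ee_add]; congr 1; unfold lin; ring

lemma norm4 {a b c d : ℂ} {A B C D : ℝ} (ha : ‖a‖ ≤ A) (hb : ‖b‖ ≤ B) (hc : ‖c‖ ≤ C) (hd : ‖d‖ ≤ D) :
    ‖a*b*c*d‖ ≤ A*B*C*D := by
  have hA := (norm_nonneg _).trans ha
  have hB := (norm_nonneg _).trans hb
  have hC := (norm_nonneg _).trans hc
  have hD := (norm_nonneg _).trans hd
  rw [norm_mul, norm_mul, norm_mul]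
  gcongr

lemma bound_PW (hp : p.Prime) (w : CF) : ‖S4 (p^2) (fun a b c d => ii (PW p a b c d) * ee (p^2) (lin w a b c d))‖ ≤
    (p:ℝ)^4 * jj (CF.dvdW p w) := by
  have e : S4 (p^2) (fun a b c d => ii (PW p a b c d) * ee (p^2) (lin w a b c d)) =
      S4 (p^2) (fun a b c d => (ii ((p:ℤ) ∣ a) * ee (p^2) (w.d*a)) * (ii ((p:ℤ) ∣ b) * ee (p^2) (-w.c*b)) *
        (ii ((p:ℤ) ∣ c) * ee (p^2) (w.b*c)) * (ii ((p:ℤ) ∣ d) * ee (p^2) (-w.a*d))) :=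
    S4_congr fun a b c d => by
      rw [ee_lin]; unfold PW; simp only [ii_and]; ring
  rw [e, S4_prod (p^2) (fun a => ii ((p:ℤ) ∣ a) * ee (p^2) (w.d*a)) (fun b => ii ((p:ℤ) ∣ b) * ee (p^2) (-w.c*b))
    (fun c => ii ((p:ℤ) ∣ c) * ee (p^2) (w.b*c)) (fun d => ii ((p:ℤ) ∣ d) * ee (p^2) (-w.a*d))]
  refine (norm4 (J1 hp _) (J1 hp _) (J1 hp _) (J1 hp _)).trans (le_of_eq ?_)
  have : jj (CF.dvdW p w) = jj ((p:ℤ) ∣ w.d) * jj ((p:ℤ) ∣ -w.c) * jj ((p:ℤ) ∣ w.b) * jj ((p:ℤ) ∣ -w.a) := by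
    rw [jj_and, jj_and, jj_and]; congr 1; apply propext; unfold CF.dvdW; rw [dvd_neg, dvd_neg]; tauto
  rw [this]; ring

lemma bound_AA (hp : p.Prime) (w : CF) (r : Option ℕ) :
    ‖S4 (p^2) (fun a b c d => ii (AA p r a b c d) * ee (p^2) (lin w a b c d))‖ ≤
    (p:ℝ)^5 * jj (AP p r w) := by
  have hn : 0 < p^2 := pow_pos hp.pos 2
  cases r with
  | none =>
    have e : S4 (p^2) (fun a b c d => ii (AA p none a b c d) * ee (p^2) (lin w a b c d)) =
      S4 (p^2) (fun a b c d => (ee (p^2) (w.d*a)) * (ee (p^2) (-w.c*b)) *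
        (ii ((p:ℤ) ∣ c) * ee (p^2) (w.b*c)) * (ii ((p:ℤ)^2 ∣ d) * ee (p^2) (-w.a*d))) :=
      S4_congr fun a b c d => by
        rw [ee_lin]; unfold AA; simp only [ii_and]; ring
    rw [e, S4_prod (p^2) (fun a => ee (p^2) (w.d*a)) (fun b => ee (p^2) (-w.c*b))
      (fun c => ii ((p:ℤ) ∣ c) * ee (p^2) (w.b*c)) (fun d => ii ((p:ℤ)^2 ∣ d) * ee (p^2) (-w.a*d))]
    refine (norm4 (J2 hp _) (J2 hp _) (J1 hp _) (J0 hp _)).trans (le_of_eq ?_)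
    have : jj (AP p none w) = jj ((p:ℤ)^2 ∣ w.d) * jj ((p:ℤ)^2 ∣ -w.c) * jj ((p:ℤ) ∣ w.b) := by
      rw [jj_and, jj_and]; congr 1; apply propext; unfold AP; rw [dvd_neg]; tauto
    rw [this]; ring
  | some t =>
    rw [S4_shift hn _ ?_ ?_ ?_ t]
    · have e : S4 (p^2) (fun a b c d => ii (AA p (some t) (a + (-t*b+(t:ℤ)^2*c-(t:ℤ)^3*d)) (b+(-2*t*c+3*(t:ℤ)^2*d)) (c+(-3*t*d)) d) *
          ee (p^2) (lin w (a + (-t*b+(t:ℤ)^2*c-(t:ℤ)^3*d)) (b+(-2*t*c+3*(t:ℤ)^2*d)) (c+(-3*t*d)) d)) =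
        S4 (p^2) (fun a b c d => (ii ((p:ℤ)^2 ∣ a) * ee (p^2) (w.d*a)) * (ii ((p:ℤ) ∣ b) * ee (p^2) (-(w.c+t*w.d)*b)) *
          (ee (p^2) ((w.b+2*t*w.c+(t:ℤ)^2*w.d)*c)) * (ee (p^2) (-(w.a+3*w.b*t+3*w.c*(t:ℤ)^2+w.d*(t:ℤ)^3)*d))) :=
        S4_congr fun a b c d => by
          have e1 : lin w (a + (-t*b+(t:ℤ)^2*c-(t:ℤ)^3*d)) (b+(-2*t*c+3*(t:ℤ)^2*d)) (c+(-3*t*d)) d =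
            w.d*a + -(w.c+t*w.d)*b + (w.b+2*t*w.c+(t:ℤ)^2*w.d)*c +
              -(w.a+3*w.b*t+3*w.c*(t:ℤ)^2+w.d*(t:ℤ)^3)*d := by unfold lin; ring
          have e2 : AA p (some t) (a + (-t*b+(t:ℤ)^2*c-(t:ℤ)^3*d)) (b+(-2*t*c+3*(t:ℤ)^2*d)) (c+(-3*t*d)) d =
            ((p:ℤ)^2 ∣ a ∧ (p:ℤ) ∣ b) := by
            unfold AA; ring_nf
          rw [e1, e2, ee_add, ee_add, ee_add, ii_and]; ring
      rw [e, S4_prod (p^2) (fun a => ii ((p:ℤ)^2 ∣ a) * ee (p^2) (w.d*a))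
        (fun b => ii ((p:ℤ) ∣ b) * ee (p^2) (-(w.c+t*w.d)*b))
        (fun c => ee (p^2) ((w.b+2*t*w.c+(t:ℤ)^2*w.d)*c))
        (fun d => ee (p^2) (-(w.a+3*w.b*t+3*w.c*(t:ℤ)^2+w.d*(t:ℤ)^3)*d))]
      refine (norm4 (J0 hp _) (J1 hp _) (J2 hp _) (J2 hp _)).trans (le_of_eq ?_)
      have : jj (AP p (some t) w) = jj ((p:ℤ) ∣ -(w.c+t*w.d)) * jj ((p:ℤ)^2 ∣ w.b+2*t*w.c+(t:ℤ)^2*w.d) *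
          jj ((p:ℤ)^2 ∣ -(w.a+3*w.b*t+3*w.c*(t:ℤ)^2+w.d*(t:ℤ)^3)) := by
        rw [jj_and, jj_and]; congr 1; apply propext; unfold AP; rw [dvd_neg, dvd_neg]; tauto
      rw [this]; ring
    all_goals
      intro _ _ _ k l hkl
      have hkl' : (p:ℤ)^2 ∣ k - l := by exact_mod_cast hkl
      have z2 : ∀ x : ℤ, (p:ℤ)^2 ∣ x - x := fun x => by simp
      have z2' : ∀ x : ℤ, ((p^2:ℕ):ℤ) ∣ x - x := fun x => by simp
      simp only
    · rw [AA_congr hkl' (z2 _) (z2 _) (z2 _), lin_congr hn w hkl (z2' _) (z2' _) (z2' _)]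
    · rw [AA_congr (z2 _) hkl' (z2 _) (z2 _), lin_congr hn w (z2' _) hkl (z2' _) (z2' _)]
    · rw [AA_congr (z2 _) (z2 _) hkl' (z2 _), lin_congr hn w (z2' _) (z2' _) hkl (z2' _)]

lemma bound_BB (hp : p.Prime) (w : CF) (r : Option ℕ) :
    ‖S4 (p^2) (fun a b c d => ii (PW p a b c d ∧ AA p r a b c d) * ee (p^2) (lin w a b c d))‖ ≤
    (p:ℝ)^3 * jj (BP p r w) := by
  have hn : 0 < p^2 := pow_pos hp.pos 2
  have hp2 : (p:ℤ) ∣ (p:ℤ)^2 := dvd_pow_self _ two_ne_zero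
  cases r with
  | none =>
    have e : S4 (p^2) (fun a b c d => ii (PW p a b c d ∧ AA p none a b c d) * ee (p^2) (lin w a b c d)) =
      S4 (p^2) (fun a b c d => (ii ((p:ℤ) ∣ a) * ee (p^2) (w.d*a)) * (ii ((p:ℤ) ∣ b) * ee (p^2) (-w.c*b)) *
        (ii ((p:ℤ) ∣ c) * ee (p^2) (w.b*c)) * (ii ((p:ℤ)^2 ∣ d) * ee (p^2) (-w.a*d))) :=
      S4_congr fun a b c d => by
        have e2 : (PW p a b c d ∧ AA p none a b c d) = ((p:ℤ) ∣ a ∧ (p:ℤ) ∣ b ∧ (p:ℤ) ∣ c ∧ (p:ℤ)^2 ∣ d) := by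
          apply propext; unfold PW AA
          have := fun h : (p:ℤ)^2 ∣ d => hp2.trans h
          tauto
        rw [ee_lin, e2]; simp only [ii_and]; ring
    rw [e, S4_prod (p^2) (fun a => ii ((p:ℤ) ∣ a) * ee (p^2) (w.d*a)) (fun b => ii ((p:ℤ) ∣ b) * ee (p^2) (-w.c*b))
      (fun c => ii ((p:ℤ) ∣ c) * ee (p^2) (w.b*c)) (fun d => ii ((p:ℤ)^2 ∣ d) * ee (p^2) (-w.a*d))]
    refine (norm4 (J1 hp _) (J1 hp _) (J1 hp _) (J0 hp _)).trans (le_of_eq ?_)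
    have : jj (BP p none w) = jj ((p:ℤ) ∣ w.d) * jj ((p:ℤ) ∣ -w.c) * jj ((p:ℤ) ∣ w.b) := by
      rw [jj_and, jj_and]; congr 1; apply propext; unfold BP; rw [dvd_neg]; tauto
    rw [this]; ring
  | some t =>
    rw [S4_shift hn _ ?_ ?_ ?_ t]
    · have e : S4 (p^2) (fun a b c d => ii (PW p (a + (-t*b+(t:ℤ)^2*c-(t:ℤ)^3*d)) (b+(-2*t*c+3*(t:ℤ)^2*d)) (c+(-3*t*d)) d ∧
            AA p (some t) (a + (-t*b+(t:ℤ)^2*c-(t:ℤ)^3*d)) (b+(-2*t*c+3*(t:ℤ)^2*d)) (c+(-3*t*d)) d) *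
          ee (p^2) (lin w (a + (-t*b+(t:ℤ)^2*c-(t:ℤ)^3*d)) (b+(-2*t*c+3*(t:ℤ)^2*d)) (c+(-3*t*d)) d)) =
        S4 (p^2) (fun a b c d => (ii ((p:ℤ)^2 ∣ a) * ee (p^2) (w.d*a)) * (ii ((p:ℤ) ∣ b) * ee (p^2) (-(w.c+t*w.d)*b)) *
          (ii ((p:ℤ) ∣ c) * ee (p^2) ((w.b+2*t*w.c+(t:ℤ)^2*w.d)*c)) *
          (ii ((p:ℤ) ∣ d) * ee (p^2) (-(w.a+3*w.b*t+3*w.c*(t:ℤ)^2+w.d*(t:ℤ)^3)*d))) :=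
        S4_congr fun a b c d => by
          have e1 : lin w (a + (-t*b+(t:ℤ)^2*c-(t:ℤ)^3*d)) (b+(-2*t*c+3*(t:ℤ)^2*d)) (c+(-3*t*d)) d =
            w.d*a + -(w.c+t*w.d)*b + (w.b+2*t*w.c+(t:ℤ)^2*w.d)*c +
              -(w.a+3*w.b*t+3*w.c*(t:ℤ)^2+w.d*(t:ℤ)^3)*d := by unfold lin; ring
          have e2 : AA p (some t) (a + (-t*b+(t:ℤ)^2*c-(t:ℤ)^3*d)) (b+(-2*t*c+3*(t:ℤ)^2*d)) (c+(-3*t*d)) d =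
            ((p:ℤ)^2 ∣ a ∧ (p:ℤ) ∣ b) := by
            unfold AA; ring_nf
          have e3 : (PW p (a + (-t*b+(t:ℤ)^2*c-(t:ℤ)^3*d)) (b+(-2*t*c+3*(t:ℤ)^2*d)) (c+(-3*t*d)) d ∧
              ((p:ℤ)^2 ∣ a ∧ (p:ℤ) ∣ b)) = ((p:ℤ)^2 ∣ a ∧ (p:ℤ) ∣ b ∧ (p:ℤ) ∣ c ∧ (p:ℤ) ∣ d) := by
            apply propext
            constructor
            · rintro ⟨⟨h1,h2,h3,h4⟩,h5,h6⟩
              refine ⟨h5,h6,?_,h4⟩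
              exact (dvd_add_left (h4.mul_left _)).1 h3
            · rintro ⟨h1,h2,h3,h4⟩
              exact ⟨⟨dvd_add (hp2.trans h1) (dvd_sub (dvd_add (h2.mul_left _) (h3.mul_left _)) (h4.mul_left _)),
                dvd_add h2 (dvd_add (h3.mul_left _) (h4.mul_left _)), dvd_add h3 (h4.mul_left _), h4⟩, h1, h2⟩
          rw [e1, e2, e3, ee_add, ee_add, ee_add]
          simp only [ii_and]; ring
      rw [e, S4_prod (p^2) (fun a => ii ((p:ℤ)^2 ∣ a) * ee (p^2) (w.d*a))
        (fun b => ii ((p:ℤ) ∣ b) * ee (p^2) (-(w.c+t*w.d)*b))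
        (fun c => ii ((p:ℤ) ∣ c) * ee (p^2) ((w.b+2*t*w.c+(t:ℤ)^2*w.d)*c))
        (fun d => ii ((p:ℤ) ∣ d) * ee (p^2) (-(w.a+3*w.b*t+3*w.c*(t:ℤ)^2+w.d*(t:ℤ)^3)*d))]
      refine (norm4 (J0 hp _) (J1 hp _) (J1 hp _) (J1 hp _)).trans (le_of_eq ?_)
      have : jj (BP p (some t) w) = jj ((p:ℤ) ∣ -(w.c+t*w.d)) * jj ((p:ℤ) ∣ w.b+2*t*w.c+(t:ℤ)^2*w.d) *
          jj ((p:ℤ) ∣ -(w.a+3*w.b*t+3*w.c*(t:ℤ)^2+w.d*(t:ℤ)^3)) := by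
        rw [jj_and, jj_and]; congr 1; apply propext; unfold BP; rw [dvd_neg, dvd_neg]; tauto
      rw [this]; ring
    all_goals
      intro _ _ _ k l hkl
      have hkl' : (p:ℤ)^2 ∣ k - l := by exact_mod_cast hkl
      have z2 : ∀ x : ℤ, (p:ℤ)^2 ∣ x - x := fun x => by simp
      have z2' : ∀ x : ℤ, ((p^2:ℕ):ℤ) ∣ x - x := fun x => by simp
      simp only
    · rw [AA_congr hkl' (z2 _) (z2 _) (z2 _), PW_congr hkl' (z2 _) (z2 _) (z2 _), lin_congr hn w hkl (z2' _) (z2' _) (z2' _)]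
    · rw [AA_congr (z2 _) hkl' (z2 _) (z2 _), PW_congr (z2 _) hkl' (z2 _) (z2 _), lin_congr hn w (z2' _) hkl (z2' _) (z2' _)]
    · rw [AA_congr (z2 _) (z2 _) hkl' (z2 _), PW_congr (z2 _) (z2 _) hkl' (z2 _), lin_congr hn w (z2' _) (z2' _) hkl (z2' _)]

end DW
end

noncomputable section
namespace DW

def emb (w : CF) : BCF := (w.a, 3*w.b, 3*w.c, w.d)

lemma PhiHat_eq (q : ℕ) (w : CF) : BCF.PhiHat q (emb w) = ((q:ℂ)^8)⁻¹ *
    S4 (q^2) (fun a b c d => ii (BCF.nonmaxAll q (a,b,c,d)) * ee (q^2) (lin w a b c d)) := by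
  unfold BCF.PhiHat S4
  congr 1
  refine Finset.sum_congr rfl fun y1 _ => Finset.sum_congr rfl fun y2 _ => Finset.sum_congr rfl fun y3 _ =>
    Finset.sum_congr rfl fun y4 _ => ?_
  congr 1
  unfold ee
  have : BCF.pairQ (emb w) ((y1:ℤ),(y2:ℤ),(y3:ℤ),(y4:ℤ)) = (lin w y1 y2 y3 y4 : ℤ) := by
    simp only [BCF.pairQ, emb, lin]; push_cast; ring
  rw [this]
  congr 1
  push_cast
  ring

variable {p : ℕ}

lemma nonmax_prime (hp : p.Prime) (y : BCF) : BCF.nonmaxAll p y = ¬ BCF.inUp p y := by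
  apply propext
  constructor
  · intro h; exact h p hp dvd_rfl
  · intro h l hl hlp
    rw [(Nat.prime_dvd_prime_iff_eq hl hp).1 hlp]; exact h

lemma S4_add (n : ℕ) (F G : ℤ → ℤ → ℤ → ℤ → ℂ) :
    S4 n (fun a b c d => F a b c d + G a b c d) = S4 n F + S4 n G := by
  simp only [S4, Finset.sum_add_distrib]
lemma S4_sub (n : ℕ) (F G : ℤ → ℤ → ℤ → ℤ → ℂ) :
    S4 n (fun a b c d => F a b c d - G a b c d) = S4 n F - S4 n G := by
  simp only [S4, Finset.sum_sub_distrib]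
lemma S4_zero (n : ℕ) : S4 n (fun _ _ _ _ => 0) = 0 := by
  simp [S4]
lemma S4_sum {ι : Type} (n : ℕ) (R : Finset ι) (F : ι → ℤ → ℤ → ℤ → ℤ → ℂ) :
    S4 n (fun a b c d => ∑ r ∈ R, F r a b c d) = ∑ r ∈ R, S4 n (F r) := by
  induction R using Finset.induction_on with
  | empty => simp [S4]
  | insert r R hr ih =>
    rw [Finset.sum_insert hr, ← ih, ← S4_add]
    exact S4_congr fun a b c d => Finset.sum_insert hr

lemma bound_raw (hp : p.Prime) (w : CF) : ‖BCF.PhiHat p (emb w)‖ ≤ ((p:ℝ)^8)⁻¹ *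
    ((p:ℝ)^4*jj (CF.dvdW p w) + ((p:ℝ)^5*(∑ r ∈ RR p, jj (AP p r w)) + (p:ℝ)^3 * (∑ r ∈ RR p, jj (BP p r w)))) := by
  rw [PhiHat_eq, norm_mul, norm_inv, norm_pow, Complex.norm_natCast]
  gcongr
  have e : S4 (p^2) (fun a b c d => ii (BCF.nonmaxAll p (a,b,c,d)) * ee (p^2) (lin w a b c d)) =
      S4 (p^2) (fun a b c d => ii (PW p a b c d) * ee (p^2) (lin w a b c d)) + ∑ r ∈ RR p,
        (S4 (p^2) (fun a b c d => ii (AA p r a b c d) * ee (p^2) (lin w a b c d)) -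
         S4 (p^2) (fun a b c d => ii (PW p a b c d ∧ AA p r a b c d) * ee (p^2) (lin w a b c d))) := by
    simp only [← S4_sub]
    rw [← S4_sum, ← S4_add]
    refine S4_congr fun a b c d => ?_
    rw [nonmax_prime hp, ind_eq hp, add_mul, Finset.sum_mul]
    congr 1
    exact Finset.sum_congr rfl fun r _ => by ring
  rw [e]
  refine (norm_add_le _ _).trans (add_le_add (bound_PW hp w) ?_)
  rw [Finset.mul_sum, Finset.mul_sum, ← Finset.sum_add_distrib]
  refine (norm_sum_le _ _).trans (Finset.sum_le_sum fun r _ => ?_)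
  exact (norm_sub_le _ _).trans (add_le_add (bound_AA hp w r) (bound_BB hp w r))

def DP (p : ℕ) (r : Option ℕ) (w : CF) : Prop :=
  match r with
  | none => (p:ℤ) ∣ w.c ∧ (p:ℤ) ∣ w.d
  | some t => (p:ℤ) ∣ w.b+2*t*w.c+(t:ℤ)^2*w.d ∧ (p:ℤ) ∣ w.a+3*w.b*t+3*w.c*(t:ℤ)^2+w.d*(t:ℤ)^3

lemma D_uniq (hp : p.Prime) {w : CF} {r r' : Option ℕ} (hr : r ∈ RR p) (hr' : r' ∈ RR p) (hne : r ≠ r')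
    (h : DP p r w) (h' : DP p r' w) : CF.dvdW p w := by
  have hpp : Prime (p:ℤ) := Nat.prime_iff_prime_int.1 hp
  have key : ∀ t : ℕ, DP p none w → DP p (some t) w → CF.dvdW p w := by
    rintro t ⟨a1,a2⟩ ⟨b1,b2⟩
    have c2 : (p:ℤ) ∣ w.b := by
      have e : w.b = (w.b+2*t*w.c+(t:ℤ)^2*w.d) - w.c*(2*t) - w.d*(t:ℤ)^2 := by ring
      rw [e]; exact dvd_sub (dvd_sub b1 (a1.mul_right _)) (a2.mul_right _)
    refine ⟨?_, c2, a1, a2⟩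
    have e : w.a = (w.a+3*w.b*t+3*w.c*(t:ℤ)^2+w.d*(t:ℤ)^3) - w.b*(3*t) - w.c*(3*(t:ℤ)^2) - w.d*(t:ℤ)^3 := by ring
    rw [e]; exact dvd_sub (dvd_sub (dvd_sub b2 (c2.mul_right _)) (a1.mul_right _)) (a2.mul_right _)
  cases r with
  | none =>
    cases r' with
    | none => exact absurd rfl hne
    | some t => exact key t h h'
  | some t =>
    cases r' with
    | none => exact key t h' h
    | some s =>
      simp only [RR, Finset.some_mem_insertNone, Finset.mem_range] at hr hr'
      have hts := sub_not_dvd hr hr' (fun e => hne (by rw [e]))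
      obtain ⟨a2,a1⟩ := h
      obtain ⟨b2,b1⟩ := h'
      obtain ⟨u, hu⟩ : ∃ u : ℤ, u = (s:ℤ)-t := ⟨_, rfl⟩
      rw [← hu] at hts
      have hs : (s:ℤ) = t+u := by rw [hu]; ring
      rw [hs] at b1 b2
      generalize (t:ℤ) = t' at *
      obtain ⟨Y1, hY1⟩ : ∃ Y, Y = w.a+3*w.b*t'+3*w.c*t'^2+w.d*t'^3 := ⟨_, rfl⟩
      obtain ⟨Y2, hY2⟩ : ∃ Y, Y = w.b+2*t'*w.c+t'^2*w.d := ⟨_, rfl⟩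
      obtain ⟨Y3, hY3⟩ : ∃ Y, Y = w.c+t'*w.d := ⟨_, rfl⟩
      rw [← hY1] at a1
      rw [← hY2] at a2
      have e1 : w.a+3*w.b*(t'+u)+3*w.c*(t'+u)^2+w.d*(t'+u)^3 = Y1 + Y2*(3*u)+u^2*(3*Y3+u*w.d) := by
        rw [hY1,hY2,hY3]; ring
      have e2 : w.b+2*(t'+u)*w.c+(t'+u)^2*w.d = Y2 + u*(2*Y3+u*w.d) := by rw [hY2,hY3]; ring
      rw [e1] at b1
      rw [e2] at b2
      have c1 : (p:ℤ) ∣ 3*Y3+u*w.d := by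
        have : (p:ℤ) ∣ u^2*(3*Y3+u*w.d) := by
          have := dvd_sub b1 (dvd_add a1 (a2.mul_right (3*u))); simpa using this
        exact (hpp.dvd_or_dvd this).resolve_left fun h => hts (hpp.dvd_of_dvd_pow h)
      have c2 : (p:ℤ) ∣ 2*Y3+u*w.d := by
        have : (p:ℤ) ∣ u*(2*Y3+u*w.d) := by
          have := dvd_sub b2 a2; simpa using this
        exact (hpp.dvd_or_dvd this).resolve_left hts
      have c3 : (p:ℤ) ∣ Y3 := by
        have e : Y3 = (3*Y3+u*w.d) - (2*Y3+u*w.d) := by ring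
        rw [e]; exact dvd_sub c1 c2
      have c4 : (p:ℤ) ∣ w.d := by
        have : (p:ℤ) ∣ u*w.d := by
          have e : u*w.d = (2*Y3+u*w.d) - Y3*2 := by ring
          rw [e]; exact dvd_sub c2 (c3.mul_right _)
        exact (hpp.dvd_or_dvd this).resolve_left hts
      have d3 : (p:ℤ) ∣ w.c := by
        have e : w.c = Y3 - w.d*t' := by rw [hY3]; ring
        rw [e]; exact dvd_sub c3 (c4.mul_right _)
      have d2 : (p:ℤ) ∣ w.b := by
        have e : w.b = Y2 - w.c*(2*t') - w.d*(t'^2) := by rw [hY2]; ring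
        rw [e]; exact dvd_sub (dvd_sub a2 (d3.mul_right _)) (c4.mul_right _)
      refine ⟨?_, d2, d3, c4⟩
      have e : w.a = Y1 - w.b*(3*t') - w.c*(3*t'^2) - w.d*t'^3 := by rw [hY1]; ring
      rw [e]; exact dvd_sub (dvd_sub (dvd_sub a1 (d2.mul_right _)) (d3.mul_right _)) (c4.mul_right _)

lemma BP_DP {r : Option ℕ} {w : CF} (h : BP p r w) : DP p r w := by
  cases r with
  | none => exact ⟨h.2.1, h.2.2⟩
  | some t => exact ⟨h.2.1, h.2.2⟩

lemma AP_BP {r : Option ℕ} {w : CF} (h : AP p r w) : BP p r w := by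
  have hp2 : (p:ℤ) ∣ (p:ℤ)^2 := dvd_pow_self _ two_ne_zero
  cases r with
  | none => exact ⟨h.1, hp2.trans h.2.1, hp2.trans h.2.2⟩
  | some t => exact ⟨h.1, hp2.trans h.2.1, hp2.trans h.2.2⟩

lemma eqv_t (t : ℕ) (w : CF) : CF.Eqv w ⟨w.a+3*w.b*t+3*w.c*(t:ℤ)^2+w.d*(t:ℤ)^3, w.b+2*t*w.c+(t:ℤ)^2*w.d, w.c+t*w.d, w.d⟩ := by
  refine ⟨1,t,0,1, by ring, ?_⟩
  ext <;> simp only [CF.act] <;> ring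

lemma BP_H {r : Option ℕ} {w : CF} (h : BP p r w) : CF.dvdH p w := by
  cases r with
  | none =>
    obtain ⟨h1,h2,h3⟩ := h
    exact ⟨dvd_sub (dvd_pow h1 two_ne_zero) (h2.mul_left _), dvd_sub (h1.mul_right _) (h3.mul_left _),
      dvd_sub (dvd_pow h2 two_ne_zero) (h3.mul_left _)⟩
  | some t =>
    obtain ⟨h1,h2,h3⟩ := h
    rw [(eqv_t t w).dvdH_iff]
    exact ⟨dvd_sub (dvd_pow h2 two_ne_zero) (h1.mul_left _), dvd_sub (h1.mul_left _) (h3.mul_right _),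
      dvd_sub (dvd_pow h1 two_ne_zero) (h2.mul_right _)⟩

lemma AP_H {r : Option ℕ} {w : CF} (h : AP p r w) : CF.dvdH ((p:ℤ)^2) w := by
  cases r with
  | none =>
    obtain ⟨h1,h2,h3⟩ := h
    exact ⟨dvd_sub (pow_dvd_pow_of_dvd h1 2) (h2.mul_left _), dvd_sub (h2.mul_left _) (h3.mul_left _),
      dvd_sub (dvd_pow h2 two_ne_zero) (h3.mul_left _)⟩
  | some t =>
    obtain ⟨h1,h2,h3⟩ := h
    rw [(eqv_t t w).dvdH_iff]
    exact ⟨dvd_sub (dvd_pow h2 two_ne_zero) (h3.mul_right _), dvd_sub (h2.mul_right _) (h3.mul_right _),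
      dvd_sub (pow_dvd_pow_of_dvd h1 2) (h2.mul_right _)⟩

lemma AP_scl (hp : p.Prime) {r : Option ℕ} {w : CF} (h : AP p r (CF.scl p w)) : DP p r w := by
  have hp0 : (p:ℤ) ≠ 0 := by exact_mod_cast hp.ne_zero
  have key : ∀ x : ℤ, (p:ℤ)^2 ∣ p*x → (p:ℤ) ∣ x := fun x hx => by
    rw [sq] at hx; exact (mul_dvd_mul_iff_left hp0).1 hx
  cases r with
  | none => exact ⟨key _ h.2.1, key _ h.2.2⟩
  | some t =>
    obtain ⟨_, h2, h3⟩ := h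
    simp only [CF.scl] at h2 h3
    constructor
    · apply key; convert h2 using 1; ring
    · apply key; convert h3 using 1; ring

lemma sum_jj_le {R : Finset (Option ℕ)} {Q : Option ℕ → Prop} (h : ∀ r ∈ R, ∀ r' ∈ R, Q r → Q r' → r = r') :
    ∑ r ∈ R, jj (Q r) ≤ 1 := by
  by_cases hex : ∃ r ∈ R, Q r
  · obtain ⟨r, hr, hq⟩ := hex
    rw [Finset.sum_eq_single r]
    · exact jj_le _
    · intro s hs hne
      have : ¬ Q s := fun hh => hne (h s hs r hr hh hq)
      simp [jj, this]
    · intro h; exact absurd hr h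
  · rw [Finset.sum_eq_zero]
    · norm_num
    · intro r hr
      have : ¬ Q r := fun hh => hex ⟨r, hr, hh⟩
      simp [jj, this]

lemma sum_jj_card {Q : Option ℕ → Prop} : ∑ r ∈ RR p, jj (Q r) ≤ p+1 := by
  refine (Finset.sum_le_sum fun r _ => jj_le (Q r)).trans ?_
  simp [RR]

lemma sum_jj_zero {Q : Option ℕ → Prop} (h : ∀ r, ¬ Q r) : ∑ r ∈ RR p, jj (Q r) = 0 :=
  Finset.sum_eq_zero fun r _ => by simp [jj, h r]

theorem prime_bound (hp : p.Prime) (w : CF) : ‖BCF.PhiHat p (emb w)‖ ≤ CF.g p w := by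
  refine (bound_raw hp w).trans ?_
  have h2 : (2:ℝ) ≤ p := by exact_mod_cast hp.two_le
  have hpos : (0:ℝ) < p := by linarith
  have hinv : ∀ (T B : ℝ), T ≤ B*(p:ℝ)^8 → ((p:ℝ)^8)⁻¹*T ≤ B := fun T B h => by
    rw [inv_mul_le_iff₀ (by positivity)]; linarith
  apply hinv
  have hSW : jj (CF.dvdW p w) ≤ 1 := jj_le _
  obtain ⟨x, hx⟩ : ∃ x : ℝ, x = p := ⟨_, rfl⟩
  have hp2 : (p:ℤ) ∣ (p:ℤ)^2 := dvd_pow_self _ two_ne_zero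
  have q3 : 2*(p:ℝ)^2 ≤ (p:ℝ)^3 := by nlinarith [sq_nonneg (p:ℝ)]
  have q4 : 2*(p:ℝ)^3 ≤ (p:ℝ)^4 := by nlinarith [pow_pos hpos 3]
  have q5 : 2*(p:ℝ)^4 ≤ (p:ℝ)^5 := by nlinarith [pow_pos hpos 4]
  have q6 : 2*(p:ℝ)^5 ≤ (p:ℝ)^6 := by nlinarith [pow_pos hpos 5]
  have r2 : 3/(p:ℝ)^2*(p:ℝ)^8 = 3*(p:ℝ)^6 := by field_simp
  have r3 : 3/(p:ℝ)^3*(p:ℝ)^8 = 3*(p:ℝ)^5 := by field_simp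
  have r5 : 3/(p:ℝ)^5*(p:ℝ)^8 = 3*(p:ℝ)^3 := by field_simp
  have p2 : (0:ℝ) < (p:ℝ)^2 := by positivity
  have p3 : (0:ℝ) < (p:ℝ)^3 := by positivity
  have p4 : (0:ℝ) < (p:ℝ)^4 := by positivity
  have p5 : (0:ℝ) < (p:ℝ)^5 := by positivity
  unfold CF.g
  split_ifs with c1 c2 c3 c4
  · have b1 := mul_le_mul_of_nonneg_left (sum_jj_card (p := p) (Q := fun r => AP p r w)) p5.le
    have b2 := mul_le_mul_of_nonneg_left (sum_jj_card (p := p) (Q := fun r => BP p r w)) p3.le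
    have b3 := mul_le_mul_of_nonneg_left hSW p4.le
    rw [r2]
    nlinarith
  · have b1 := mul_le_mul_of_nonneg_left (sum_jj_le (R := RR p) (Q := fun r => AP p r w) (by
      intro r hr r' hr' h h'
      by_contra hne
      have e := CF.scl_dv c2
      rw [← e] at h h'
      have := D_uniq hp hr hr' hne (AP_scl hp h) (AP_scl hp h')
      apply c1
      rw [← e]
      obtain ⟨x1,x2,x3,x4⟩ := this
      rw [sq]
      exact ⟨mul_dvd_mul_left _ x1, mul_dvd_mul_left _ x2, mul_dvd_mul_left _ x3, mul_dvd_mul_left _ x4⟩)) p5.le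
    have b2 := mul_le_mul_of_nonneg_left (sum_jj_card (p := p) (Q := fun r => BP p r w)) p3.le
    have b3 := mul_le_mul_of_nonneg_left hSW p4.le
    rw [r3]
    nlinarith
  all_goals
    have hW0 : jj (CF.dvdW p w) = 0 := by simp [jj, c2]
    rw [hW0]
    have b2 := mul_le_mul_of_nonneg_left (sum_jj_le (R := RR p) (Q := fun r => BP p r w) (by
      intro r hr r' hr' h h'
      by_contra hne
      exact c2 (D_uniq hp hr hr' hne (BP_DP h) (BP_DP h')))) p3.le
  · have b1 := mul_le_mul_of_nonneg_left (sum_jj_le (R := RR p) (Q := fun r => AP p r w) (by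
      intro r hr r' hr' h h'
      by_contra hne
      exact c2 (D_uniq hp hr hr' hne (BP_DP (AP_BP h)) (BP_DP (AP_BP h'))))) p5.le
    rw [r3]
    nlinarith
  · rw [sum_jj_zero (Q := fun r => AP p r w) (fun r h => c3 (AP_H h)), r5]
    linarith
  · rw [sum_jj_zero (Q := fun r => AP p r w) (fun r h => c3 (AP_H h)),
      sum_jj_zero (Q := fun r => BP p r w) (fun r h => c4 (BP_H h))]
    simp

end DW
end

noncomputable section
namespace DW

lemma crt_sum {n m : ℕ} (hn : 0 < n) (hm : 0 < m) (hc : Nat.Coprime n m) {F G : ℤ → ℂ} (hF : Per n F) (hG : Per m G) :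
    ∑ k ∈ Finset.range (n*m), F k * G k = (∑ k ∈ Finset.range n, F k) * (∑ k ∈ Finset.range m, G k) := by
  rw [Finset.sum_mul_sum, ← Finset.sum_product']
  have hd : ∀ (l k : ℕ), (l:ℤ) ∣ (k:ℤ) - ((k % l : ℕ):ℤ) := fun l k => by
    refine ⟨((k / l : ℕ):ℤ), ?_⟩
    have : ((k % l + l*(k/l) : ℕ):ℤ) = k := by rw [Nat.mod_add_div]
    push_cast at this ⊢
    linarith
  refine Finset.sum_nbij (fun k => (k % n, k % m)) ?_ ?_ ?_ ?_
  · intro k _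
    simp [Nat.mod_lt _ hn, Nat.mod_lt _ hm]
  · intro k hk l hl h
    simp only [Prod.mk.injEq] at h
    have := (Nat.modEq_and_modEq_iff_modEq_mul hc).1 ⟨h.1, h.2⟩
    simp only [Finset.coe_range, Set.mem_Iio] at hk hl
    exact Nat.ModEq.eq_of_lt_of_lt this hk hl
  · rintro ⟨a, b⟩ hab
    simp only [Finset.coe_product, Finset.coe_range, Set.mem_prod, Set.mem_Iio] at hab
    refine ⟨(Nat.chineseRemainder hc a b : ℕ), ?_, ?_⟩
    · simpa using Nat.chineseRemainder_lt_mul hc a b hn.ne' hm.ne'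
    · have h := (Nat.chineseRemainder hc a b).2
      simp only [Prod.mk.injEq]
      exact ⟨Eq.trans h.1 (Nat.mod_eq_of_lt hab.1), Eq.trans h.2 (Nat.mod_eq_of_lt hab.2)⟩
  · intro k _
    simp only
    rw [hF _ _ (hd n k), hG _ _ (hd m k)]

def Per4 (n : ℕ) (F : ℤ → ℤ → ℤ → ℤ → ℂ) : Prop := ∀ a b c d a' b' c' d' : ℤ, (n:ℤ) ∣ a - a' → (n:ℤ) ∣ b - b' →
  (n:ℤ) ∣ c - c' → (n:ℤ) ∣ d - d' → F a b c d = F a' b' c' d'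

lemma S4_crt {n m : ℕ} (hn : 0 < n) (hm : 0 < m) (hc : Nat.Coprime n m) {F G : ℤ → ℤ → ℤ → ℤ → ℂ}
    (hF : Per4 n F) (hG : Per4 m G) : S4 (n*m) (fun a b c d => F a b c d * G a b c d) = S4 n F * S4 m G := by
  have z : ∀ (n : ℕ) (x : ℤ), (n:ℤ) ∣ x - x := fun n x => by simp
  unfold S4
  have e4 : ∀ a b c : ℤ, ∑ d ∈ Finset.range (n*m), F a b c d * G a b c d =
      (∑ d ∈ Finset.range n, F a b c d) * (∑ d ∈ Finset.range m, G a b c d) := fun a b c =>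
    crt_sum hn hm hc (fun k l h => hF _ _ _ _ _ _ _ _ (z _ _) (z _ _) (z _ _) h)
      (fun k l h => hG _ _ _ _ _ _ _ _ (z _ _) (z _ _) (z _ _) h)
  have e3 : ∀ a b : ℤ, ∑ c ∈ Finset.range (n*m), (∑ d ∈ Finset.range n, F a b c d) * (∑ d ∈ Finset.range m, G a b c d) =
      (∑ c ∈ Finset.range n, ∑ d ∈ Finset.range n, F a b c d) *
        (∑ c ∈ Finset.range m, ∑ d ∈ Finset.range m, G a b c d) := fun a b =>
    crt_sum (F := fun c => ∑ d ∈ Finset.range n, F a b c d) (G := fun c => ∑ d ∈ Finset.range m, G a b c d) hn hm hc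
      (fun k l h => Finset.sum_congr rfl fun _ _ => hF _ _ _ _ _ _ _ _ (z _ _) (z _ _) h (z _ _))
      (fun k l h => Finset.sum_congr rfl fun _ _ => hG _ _ _ _ _ _ _ _ (z _ _) (z _ _) h (z _ _))
  have e2 : ∀ a : ℤ, ∑ b ∈ Finset.range (n*m), (∑ c ∈ Finset.range n, ∑ d ∈ Finset.range n, F a b c d) *
        (∑ c ∈ Finset.range m, ∑ d ∈ Finset.range m, G a b c d) =
      (∑ b ∈ Finset.range n, ∑ c ∈ Finset.range n, ∑ d ∈ Finset.range n, F a b c d) *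
        (∑ b ∈ Finset.range m, ∑ c ∈ Finset.range m, ∑ d ∈ Finset.range m, G a b c d) := fun a =>
    crt_sum (F := fun b => ∑ c ∈ Finset.range n, ∑ d ∈ Finset.range n, F a b c d)
      (G := fun b => ∑ c ∈ Finset.range m, ∑ d ∈ Finset.range m, G a b c d) hn hm hc
      (fun k l h => Finset.sum_congr rfl fun _ _ => Finset.sum_congr rfl fun _ _ =>
        hF _ _ _ _ _ _ _ _ (z _ _) h (z _ _) (z _ _))
      (fun k l h => Finset.sum_congr rfl fun _ _ => Finset.sum_congr rfl fun _ _ =>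
        hG _ _ _ _ _ _ _ _ (z _ _) h (z _ _) (z _ _))
  simp only [e4, e3, e2]
  exact crt_sum (F := fun a => ∑ b ∈ Finset.range n, ∑ c ∈ Finset.range n, ∑ d ∈ Finset.range n, F a b c d)
      (G := fun a => ∑ b ∈ Finset.range m, ∑ c ∈ Finset.range m, ∑ d ∈ Finset.range m, G a b c d) hn hm hc
      (fun k l h => Finset.sum_congr rfl fun _ _ => Finset.sum_congr rfl fun _ _ => Finset.sum_congr rfl fun _ _ =>
        hF _ _ _ _ _ _ _ _ h (z _ _) (z _ _) (z _ _))
      (fun k l h => Finset.sum_congr rfl fun _ _ => Finset.sum_congr rfl fun _ _ => Finset.sum_congr rfl fun _ _ =>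
        hG _ _ _ _ _ _ _ _ h (z _ _) (z _ _) (z _ _))

lemma nonmax_congr {q : ℕ} {a b c d a' b' c' d' : ℤ} (h1 : ((q^2:ℕ):ℤ) ∣ a - a') (h2 : ((q^2:ℕ):ℤ) ∣ b - b')
    (h3 : ((q^2:ℕ):ℤ) ∣ c - c') (h4 : ((q^2:ℕ):ℤ) ∣ d - d') :
    BCF.nonmaxAll q (a,b,c,d) = BCF.nonmaxAll q (a',b',c',d') := by
  apply propext
  unfold BCF.nonmaxAll
  refine forall_congr' fun p => forall_congr' fun hp => forall_congr' fun hpq => ?_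
  have hd : (p:ℤ)^2 ∣ ((q^2:ℕ):ℤ) := by
    push_cast; exact pow_dvd_pow_of_dvd (Int.natCast_dvd_natCast.2 hpq) 2
  rw [not_inUp_iff hp, not_inUp_iff hp]
  rw [PW_congr (hd.trans h1) (hd.trans h2) (hd.trans h3) (hd.trans h4)]
  simp only [AA_congr (hd.trans h1) (hd.trans h2) (hd.trans h3) (hd.trans h4)]

lemma nonmax_mul (q1 q2 : ℕ) (y : BCF) :
    BCF.nonmaxAll (q1*q2) y = (BCF.nonmaxAll q1 y ∧ BCF.nonmaxAll q2 y) := by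
  apply propext
  constructor
  · intro h
    exact ⟨fun p hp hd => h p hp (hd.mul_right _), fun p hp hd => h p hp (hd.mul_left _)⟩
  · rintro ⟨h1, h2⟩ p hp hd
    rcases (Nat.Prime.dvd_mul hp).1 hd with h | h
    · exact h1 p hp h
    · exact h2 p hp h

lemma lin_scl (s : ℤ) (w : CF) (a b c d : ℤ) : lin (CF.scl s w) a b c d = s * lin w a b c d := by
  simp only [lin, CF.scl]; ring

lemma ee_mul {n m : ℕ} (hn : 0 < n) (hm : 0 < m) {s t : ℤ} (h : s*m+t*n = 1) (k : ℤ) :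
    ee (n*m) k = ee n (s*k) * ee m (t*k) := by
  unfold ee
  rw [← Complex.exp_add]
  congr 1
  have hn' : (n:ℂ) ≠ 0 := by exact_mod_cast hn.ne'
  have hm' : (m:ℂ) ≠ 0 := by exact_mod_cast hm.ne'
  have h' : (s:ℂ)*m+t*n = 1 := by exact_mod_cast h
  push_cast
  field_simp
  linear_combination -(k:ℂ)*h'

lemma per4_main {q : ℕ} (hq : 0 < q) (w : CF) : Per4 (q^2)
    (fun a b c d => ii (BCF.nonmaxAll q (a,b,c,d)) * ee (q^2) (lin w a b c d)) := by
  intro a b c d a' b' c' d' h1 h2 h3 h4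
  simp only
  rw [nonmax_congr h1 h2 h3 h4, lin_congr (pow_pos hq 2) w h1 h2 h3 h4]

lemma PhiHat_mul {q1 q2 : ℕ} (h1 : 0 < q1) (h2 : 0 < q2) (hc : Nat.Coprime q1 q2) {s t : ℤ}
    (h : s*((q2^2:ℕ):ℤ)+t*((q1^2:ℕ):ℤ) = 1) (w : CF) : BCF.PhiHat (q1*q2) (emb w) =
    BCF.PhiHat q1 (emb (CF.scl s w)) * BCF.PhiHat q2 (emb (CF.scl t w)) := by
  rw [PhiHat_eq, PhiHat_eq, PhiHat_eq]
  have e := S4_crt (pow_pos h1 2) (pow_pos h2 2) (Nat.Coprime.pow 2 2 hc) (per4_main h1 (CF.scl s w)) (per4_main h2 (CF.scl t w))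
  rw [mul_mul_mul_comm, ← e]
  congr 1
  · push_cast; rw [mul_pow, mul_inv]
  · rw [mul_pow]
    refine S4_congr fun a b c d => ?_
    rw [nonmax_mul, ii_and, lin_scl, lin_scl, ee_mul (pow_pos h1 2) (pow_pos h2 2) h]
    ring

lemma relN_scl (s : ℤ) (w : CF) : CF.RelN s w (CF.scl s w) := by
  refine ⟨1,0,0,1,1,0,0, by simp, ?_⟩
  rw [CF.act_one]; ext <;> simp [CF.scl]

lemma PhiHat_one (w : CF) : ‖BCF.PhiHat 1 (emb w)‖ ≤ 1 := by
  rw [PhiHat_eq]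
  simp only [S4, Nat.cast_one, one_pow, Finset.range_one, Finset.sum_singleton, norm_mul, ee_norm, inv_one, norm_one, one_mul, mul_one]
  unfold ii; split_ifs <;> simp

theorem PhiHat_le_GP (P : Finset ℕ) (hP : ∀ l ∈ P, l.Prime) : ∀ w : CF,
    ‖BCF.PhiHat (∏ l ∈ P, l) (emb w)‖ ≤ CF.GP P w := by
  induction P using Finset.induction_on with
  | empty => intro w; simpa [CF.GP] using PhiHat_one w
  | insert p P hpP ih =>
    intro w
    have hp : p.Prime := hP p (Finset.mem_insert_self _ _)
    have hP' : ∀ l ∈ P, l.Prime := fun l hl => hP l (Finset.mem_insert_of_mem hl)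
    rw [Finset.prod_insert hpP]
    have hc : Nat.Coprime p (∏ l ∈ P, l) := Nat.Coprime.prod_right fun l hl =>
      (Nat.coprime_primes hp (hP' l hl)).2 fun e => hpP (e ▸ hl)
    have h2 : 0 < ∏ l ∈ P, l := Finset.prod_pos fun l hl => (hP' l hl).pos
    have hci : IsCoprime (((∏ l ∈ P, l)^2 : ℕ):ℤ) ((p^2:ℕ):ℤ) := Nat.isCoprime_iff_coprime.2 (Nat.Coprime.pow 2 2 hc).symm
    obtain ⟨s, t, hst⟩ := hci
    rw [PhiHat_mul hp.pos h2 hc hst, norm_mul]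
    have e : CF.GP (insert p P) w = CF.g p w * CF.GP P w := by
      unfold CF.GP; rw [Finset.prod_insert hpP]
    rw [e]
    have cs : IsCoprime (p:ℤ) s := by
      refine ⟨t*p, ((∏ l ∈ P, l)^2 : ℕ), ?_⟩
      push_cast at hst ⊢; linear_combination hst
    have ct : ∀ l ∈ P, IsCoprime (l:ℤ) t := by
      intro l hl
      obtain ⟨m, hm⟩ := Finset.dvd_prod_of_mem (fun l => l) hl
      rw [hm] at hst
      refine ⟨s*l*m^2, p^2, ?_⟩
      push_cast at hst ⊢; linear_combination hst
    rw [CF.g_congr cs (relN_scl s w), CF.GP_congr ct (relN_scl t w)]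
    exact mul_le_mul (prime_bound hp _) (ih hP' _) (norm_nonneg _) (CF.g_nonneg _ _)

theorem PhiHat_le {q : ℕ} (hq : Squarefree q) (w : CF) : ‖BCF.PhiHat q (emb w)‖ ≤ CF.GP q.primeFactors w := by
  have := PhiHat_le_GP q.primeFactors (fun l hl => Nat.prime_of_mem_primeFactors hl) w
  rwa [Nat.prod_primeFactors_of_squarefree hq] at this

end DW
end

noncomputable section
namespace DW

lemma dyadic_gen {ι : Type} (S : Finset ι) (f μ : ι → ℝ) (M δ A ρ : ℝ) (L U : ℕ → ℝ) (k : ι → ℕ)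
    (hf : ∀ i ∈ S, 0 ≤ f i) (hM : 0 ≤ M) (hA0 : 0 ≤ A) (hρ0 : 0 ≤ ρ) (hρ1 : ρ < 1) (hδ : 0 ≤ δ) (hL : ∀ n, 0 < L n) (hU : ∀ n, 0 < U n)
    (hLU : ∀ n, U n * (L n)^(-δ) = A*ρ^n)
    (hk : ∀ i ∈ S, L (k i) ≤ μ i ∧ μ i ≤ U (k i))
    (h : ∀ T : ℝ, 0 < T → ∑ i ∈ S.filter (fun i => μ i ≤ T), f i ≤ M*T) :
    ∑ i ∈ S, f i * (μ i)^(-δ) ≤ M*A*(1-ρ)⁻¹ := by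
  rw [← Finset.sum_fiberwise_of_maps_to (t := S.image k) (g := k) (fun i hi => Finset.mem_image_of_mem k hi)]
  have h1 : ∀ n ∈ S.image k, ∑ i ∈ S.filter (fun i => k i = n), f i * (μ i)^(-δ) ≤ (M*A)*ρ^n := by
    intro n _
    calc _ ≤ ∑ i ∈ S.filter (fun i => k i = n), f i * (L n)^(-δ) := by
          refine Finset.sum_le_sum fun i hi => ?_
          rw [Finset.mem_filter] at hi
          refine mul_le_mul_of_nonneg_left ?_ (hf i hi.1)
          refine Real.rpow_le_rpow_of_nonpos (hL n) ?_ (by linarith)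
          rw [← hi.2]; exact (hk i hi.1).1
      _ = (∑ i ∈ S.filter (fun i => k i = n), f i) * (L n)^(-δ) := by rw [Finset.sum_mul]
      _ ≤ (M*U n) * (L n)^(-δ) := by
          refine mul_le_mul_of_nonneg_right ?_ (Real.rpow_nonneg (hL n).le _)
          refine le_trans ?_ (h (U n) (hU n))
          refine Finset.sum_le_sum_of_subset_of_nonneg ?_ ?_
          · intro i hi
            rw [Finset.mem_filter] at hi ⊢
            exact ⟨hi.1, by rw [← hi.2]; exact (hk i hi.1).2⟩
          · intro i hi _
            exact hf i (Finset.mem_filter.1 hi).1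
      _ = (M*A)*ρ^n := by rw [mul_assoc, hLU, mul_assoc]
  refine (Finset.sum_le_sum h1).trans ?_
  rw [← Finset.mul_sum]
  refine mul_le_mul_of_nonneg_left ?_ (by positivity)
  rw [← tsum_geometric_of_lt_one hρ0 hρ1]
  exact (summable_geometric_of_lt_one hρ0 hρ1).sum_le_tsum _ (fun n _ => pow_nonneg hρ0 n)

lemma dyadic_tail {ι : Type} (S : Finset ι) (f μ : ι → ℝ) (M δ z : ℝ) (hf : ∀ i ∈ S, 0 ≤ f i) (hM : 0 ≤ M)
    (hδ : 1 < δ) (hz : 0 < z) (hμ : ∀ i ∈ S, z < μ i)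
    (h : ∀ T : ℝ, 0 < T → ∑ i ∈ S.filter (fun i => μ i ≤ T), f i ≤ M*T) :
    ∑ i ∈ S, f i * (μ i)^(-δ) ≤ (2*(1-2*(2:ℝ)^(-δ))⁻¹)*M*z^(1-δ) := by
  have hk : ∀ i : ι, ∃ n : ℕ, i ∈ S → (2:ℝ)^n*z ≤ μ i ∧ μ i ≤ 2*2^n*z := by
    intro i
    by_cases hi : i ∈ S
    · obtain ⟨n, h1, h2⟩ := exists_nat_pow_near (x := μ i / z) (y := (2:ℝ))
        ((one_le_div hz).2 (hμ i hi).le) (by norm_num)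
      refine ⟨n, fun _ => ⟨(le_div_iff₀ hz).1 h1, ?_⟩⟩
      have := (div_le_iff₀ hz).1 h2.le
      rw [pow_succ] at this; linarith
    · exact ⟨0, fun h => absurd h hi⟩
  choose k hk using hk
  have h2 : 2*(2:ℝ)^(-δ) < 1 := by
    have : (2:ℝ)^(-δ) < (2:ℝ)^(-1:ℝ) := Real.rpow_lt_rpow_of_exponent_lt (by norm_num) (by linarith)
    rw [Real.rpow_neg_one] at this
    linarith
  have hz1 : z^(1-δ) = z*z^(-δ) := by
    rw [sub_eq_add_neg, Real.rpow_add hz, Real.rpow_one]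
  have := dyadic_gen S f μ M δ (2*z^(1-δ)) (2*(2:ℝ)^(-δ)) (fun n => 2^n*z) (fun n => 2*2^n*z) k hf hM
    (by positivity) (by positivity) h2 (by linarith) (fun n => by positivity) (fun n => by positivity) ?_ hk h
  · refine this.trans (le_of_eq ?_); ring
  · intro n
    rw [hz1, Real.mul_rpow (by positivity) hz.le, ← Real.rpow_natCast, ← Real.rpow_mul (by norm_num),
      mul_comm (n:ℝ), Real.rpow_mul (by norm_num), Real.rpow_natCast, Real.rpow_natCast, mul_pow]
    ring

lemma dyadic_head {ι : Type} (S : Finset ι) (f μ : ι → ℝ) (M δ z : ℝ) (hf : ∀ i ∈ S, 0 ≤ f i) (hM : 0 ≤ M)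
    (hδ0 : 0 < δ) (hδ : δ < 1) (hz : 0 < z) (hμ : ∀ i ∈ S, 0 < μ i ∧ μ i < z)
    (h : ∀ T : ℝ, 0 < T → ∑ i ∈ S.filter (fun i => μ i ≤ T), f i ≤ M*T) :
    ∑ i ∈ S, f i * (μ i)^(-δ) ≤ ((2:ℝ)^δ*(1-2⁻¹*(2:ℝ)^δ)⁻¹)*M*z^(1-δ) := by
  have hk : ∀ i : ι, ∃ n : ℕ, i ∈ S → (2:ℝ)⁻¹^(n+1)*z ≤ μ i ∧ μ i ≤ (2:ℝ)⁻¹^n*z := by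
    intro i
    by_cases hi : i ∈ S
    · obtain ⟨h0, hlt⟩ := hμ i hi
      obtain ⟨n, h1, h2⟩ := exists_nat_pow_near (x := z / μ i) (y := (2:ℝ))
        ((one_le_div h0).2 hlt.le) (by norm_num)
      refine ⟨n, fun _ => ⟨?_, ?_⟩⟩
      · rw [inv_pow, inv_mul_le_iff₀ (by positivity)]
        exact (div_le_iff₀ h0).1 h2.le
      · rw [inv_pow, le_inv_mul_iff₀ (by positivity)]
        exact (le_div_iff₀ h0).1 h1
    · exact ⟨0, fun h => absurd h hi⟩
  choose k hk using hk
  have h2 : 2⁻¹*(2:ℝ)^δ < 1 := by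
    have : (2:ℝ)^δ < (2:ℝ)^(1:ℝ) := Real.rpow_lt_rpow_of_exponent_lt (by norm_num) (by linarith)
    rw [Real.rpow_one] at this
    linarith
  have hz1 : z^(1-δ) = z*z^(-δ) := by
    rw [sub_eq_add_neg, Real.rpow_add hz, Real.rpow_one]
  have := dyadic_gen S f μ M δ ((2:ℝ)^δ*z^(1-δ)) (2⁻¹*(2:ℝ)^δ) (fun n => (2:ℝ)⁻¹^(n+1)*z) (fun n => (2:ℝ)⁻¹^n*z) k hf hM
    (by positivity) (by positivity) h2 (by linarith) (fun n => by positivity) (fun n => by positivity) ?_ hk h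
  · refine this.trans (le_of_eq ?_); ring
  · intro n
    have hi : (2:ℝ)⁻¹^(-δ) = (2:ℝ)^δ := by
      rw [Real.inv_rpow (by norm_num), Real.rpow_neg (by norm_num), inv_inv]
    rw [hz1, Real.mul_rpow (by positivity) hz.le, ← Real.rpow_natCast _ (n+1), ← Real.rpow_mul (by norm_num),
      mul_comm ((n+1:ℕ):ℝ), Real.rpow_mul (by norm_num), Real.rpow_natCast, hi, mul_pow, pow_succ]
    ring

def prj (x : BCF) : CF := ⟨x.1, x.2.1/3, x.2.2.1/3, x.2.2.2⟩

lemma emb_prj {x : BCF} (h : BCF.inDual x) : emb (prj x) = x := by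
  obtain ⟨a,b,c,d⟩ := x
  obtain ⟨h1,h2⟩ := h
  simp only [emb, prj]
  rw [Int.mul_ediv_cancel' h1, Int.mul_ediv_cancel' h2]

lemma disc_emb (w : CF) : BCF.disc (emb w) = -27*w.Δ := by
  simp only [BCF.disc, emb, CF.Δ, CF.hA, CF.hB, CF.hC]; ring

lemma SLeq_of_Eqv {w w' : CF} (h : CF.Eqv w w') : BCF.SLeq (emb w) (emb w') := by
  obtain ⟨p,q,r,s,hd,rfl⟩ := h
  refine ⟨!![p,q;r,s], by rw [Matrix.det_fin_two_of]; linarith, ?_⟩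
  have hdet : Matrix.det !![p,q;r,s] = 1 := by rw [Matrix.det_fin_two_of]; linarith
  simp only [BCF.act, hdet, emb, CF.act, Prod.mk.injEq]
  have e00 : (!![p,q;r,s] : Matrix (Fin 2) (Fin 2) ℤ) 0 0 = p := rfl
  have e01 : (!![p,q;r,s] : Matrix (Fin 2) (Fin 2) ℤ) 0 1 = q := rfl
  have e10 : (!![p,q;r,s] : Matrix (Fin 2) (Fin 2) ℤ) 1 0 = r := rfl
  have e11 : (!![p,q;r,s] : Matrix (Fin 2) (Fin 2) ℤ) 1 1 = s := rfl
  rw [e00, e01, e10, e11]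
  refine ⟨?_,?_,?_,?_⟩ <;> ring

/-- linear count -/
lemma lin_count {C ε : ℝ} (hC : 0 < C) {q : ℕ} (hq : Squarefree q)
    (hB : CF.Bd q.primeFactors 1 (C*(q:ℝ)^(-7+ε))) (S : Finset BCF)
    (hd : ∀ x ∈ S, BCF.inDual x ∧ BCF.disc x ≠ 0)
    (hS : ∀ x ∈ S, ∀ y ∈ S, x ≠ y → ¬ BCF.SLeq x y) (T : ℝ) (hT : 0 < T) :
    ∑ x ∈ S.filter (fun x => (|BCF.disc x| : ℝ) / (q:ℝ)^8 ≤ T), ‖BCF.PhiHat q x‖ / (BCF.stabCard x : ℝ) ≤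
      (C*(q:ℝ)^((1:ℝ)+ε))*T := by
  have hq0 : (0:ℝ) < q := by exact_mod_cast Nat.pos_of_ne_zero hq.ne_zero
  set S' := S.filter (fun x => (|BCF.disc x| : ℝ) / (q:ℝ)^8 ≤ T) with hS'
  have hm : ∀ x ∈ S', x ∈ S ∧ (|BCF.disc x| : ℝ) / (q:ℝ)^8 ≤ T := fun x hx => Finset.mem_filter.1 hx
  have hinj : ∀ x ∈ S', ∀ y ∈ S', prj x = prj y → x = y := by
    intro x hx y hy h
    rw [← emb_prj (hd x (hm x hx).1).1, ← emb_prj (hd y (hm y hy).1).1, h]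
  calc _ ≤ ∑ x ∈ S', CF.GP q.primeFactors (prj x) := by
        refine Finset.sum_le_sum fun x hx => ?_
        have h1 := PhiHat_le hq (prj x)
        rw [emb_prj (hd x (hm x hx).1).1] at h1
        refine le_trans ?_ h1
        rcases Nat.eq_zero_or_pos (BCF.stabCard x) with h | h
        · rw [h]; simp
        · exact div_le_self (norm_nonneg _) (by exact_mod_cast h)
    _ = ∑ w ∈ S'.image prj, CF.GP q.primeFactors w := (Finset.sum_image hinj).symm
    _ ≤ (C*(q:ℝ)^(-7+ε))*(T*(q:ℝ)^8) := by
        refine hB _ ?_ _ (by positivity) ?_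
        · intro w hw w' hw' h
          obtain ⟨x, hx, rfl⟩ := Finset.mem_image.1 hw
          obtain ⟨y, hy, rfl⟩ := Finset.mem_image.1 hw'
          by_contra hne
          have h2 := SLeq_of_Eqv h
          rw [emb_prj (hd x (hm x hx).1).1, emb_prj (hd y (hm y hy).1).1] at h2
          exact hS x (hm x hx).1 y (hm y hy).1 (fun e => hne (by rw [e])) h2
        · intro w hw
          obtain ⟨x, hx, rfl⟩ := Finset.mem_image.1 hw
          have e := disc_emb (prj x)
          rw [emb_prj (hd x (hm x hx).1).1] at e
          have h0 := (hd x (hm x hx).1).2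
          have h1 := (hm x hx).2
          rw [div_le_iff₀ (by positivity)] at h1
          refine ⟨?_, ?_, ?_⟩
          · intro h; rw [h] at e; exact h0 (by simpa using e)
          · refine le_trans ?_ h1
            rw [e]
            push_cast
            rw [abs_mul]
            have : |(-27:ℝ)| = 27 := by norm_num
            rw [this]
            linarith [abs_nonneg (((prj x).Δ:ℤ):ℝ)]
          · simp [CF.dvdH]
    _ = _ := by
        have : (q:ℝ)^((1:ℝ)+ε) = (q:ℝ)^(-7+ε)*(q:ℝ)^8 := by
          rw [← Real.rpow_natCast _ 8, ← Real.rpow_add hq0]; congr 1; push_cast; ring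
        rw [this]; ring

theorem final :
    (∀ δ ε : ℝ, 1 < δ → 0 < ε → ∃ C : ℝ,
      ∀ q : ℕ, Squarefree q → ∀ z : ℝ, 0 < z →
      ∀ S : Finset BCF,
        (∀ x ∈ S, BCF.inDual x ∧ (q : ℝ) ^ 8 * z < (|BCF.disc x| : ℝ)) →
        (∀ x ∈ S, ∀ y ∈ S, x ≠ y → ¬ BCF.SLeq x y) →
        ∑ x ∈ S, ‖BCF.PhiHat q x‖ / (BCF.stabCard x : ℝ) * ((|BCF.disc x| : ℝ) / (q : ℝ) ^ 8) ^ (-δ)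
          ≤ C * (q : ℝ) ^ ((1:ℝ) + ε) * z ^ (1 - δ)) ∧
    (∀ δ ε : ℝ, 0 < δ → δ < 1 → 0 < ε → ∃ C : ℝ,
      ∀ q : ℕ, Squarefree q → ∀ z : ℝ, 0 < z →
      ∀ S : Finset BCF,
        (∀ x ∈ S, BCF.inDual x ∧ BCF.disc x ≠ 0 ∧ (|BCF.disc x| : ℝ) < (q : ℝ) ^ 8 * z) →
        (∀ x ∈ S, ∀ y ∈ S, x ≠ y → ¬ BCF.SLeq x y) →
        ∑ x ∈ S, ‖BCF.PhiHat q x‖ / (BCF.stabCard x : ℝ) * ((|BCF.disc x| : ℝ) / (q : ℝ) ^ 8) ^ (-δ)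
          ≤ C * (q : ℝ) ^ ((1:ℝ) + ε) * z ^ (1 - δ)) := by
  constructor
  · intro δ ε hδ hε
    obtain ⟨C, hC, hW⟩ := CF.WC ε hε
    refine ⟨(2*(1-2*(2:ℝ)^(-δ))⁻¹)*C, fun q hq z hz S hS hSL => ?_⟩
    have hq0 : (0:ℝ) < q := by exact_mod_cast Nat.pos_of_ne_zero hq.ne_zero
    have hd : ∀ x ∈ S, BCF.inDual x ∧ BCF.disc x ≠ 0 := fun x hx => ⟨(hS x hx).1, fun h => by
      have := (hS x hx).2
      rw [h] at this
      have h3 : 0 < (q:ℝ)^8*z := by positivity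
      simp at this
      linarith⟩
    have := dyadic_tail S (fun x => ‖BCF.PhiHat q x‖ / (BCF.stabCard x : ℝ))
      (fun x => (|BCF.disc x| : ℝ) / (q : ℝ) ^ 8) (C*(q:ℝ)^((1:ℝ)+ε)) δ z (fun x _ => by positivity) (by positivity) hδ hz
      (fun x hx => by
        rw [lt_div_iff₀ (by positivity)]
        have := (hS x hx).2
        linarith) (fun T hT => lin_count hC hq (hW q hq) S hd hSL T hT)
    refine this.trans (le_of_eq ?_); ring
  · intro δ ε hδ0 hδ hε
    obtain ⟨C, hC, hW⟩ := CF.WC ε hε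
    refine ⟨((2:ℝ)^δ*(1-2⁻¹*(2:ℝ)^δ)⁻¹)*C, fun q hq z hz S hS hSL => ?_⟩
    have hq0 : (0:ℝ) < q := by exact_mod_cast Nat.pos_of_ne_zero hq.ne_zero
    have hd : ∀ x ∈ S, BCF.inDual x ∧ BCF.disc x ≠ 0 := fun x hx => ⟨(hS x hx).1, (hS x hx).2.1⟩
    have := dyadic_head S (fun x => ‖BCF.PhiHat q x‖ / (BCF.stabCard x : ℝ))
      (fun x => (|BCF.disc x| : ℝ) / (q : ℝ) ^ 8) (C*(q:ℝ)^((1:ℝ)+ε)) δ z (fun x _ => by positivity) (by positivity) hδ0 hδ hz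
      (fun x hx => by
        refine ⟨?_, ?_⟩
        · have : ((BCF.disc x:ℤ):ℝ) ≠ 0 := by exact_mod_cast (hS x hx).2.1
          have := abs_pos.2 this
          positivity
        · rw [div_lt_iff₀ (by positivity)]
          have := (hS x hx).2.2
          linarith) (fun T hT => lin_count hC hq (hW q hq) S hd hSL T hT)
    refine this.trans (le_of_eq ?_); ring

end DW
end

open BCF in
/-- Proposition 3.2: weighted partial sums of the dual coefficients. The first part
bounds the tail `μ_n > z` for `δ > 1`; the second bounds the head `μ_n < z` for
`0 < δ < 1` (here `μ(x) = |Disc(x)|/q⁸`). -/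
theorem dual_weighted_bounds :
    (∀ δ ε : ℝ, 1 < δ → 0 < ε → ∃ C : ℝ,
      ∀ q : ℕ, Squarefree q → ∀ z : ℝ, 0 < z →
      ∀ S : Finset BCF,
        (∀ x ∈ S, inDual x ∧ (q : ℝ) ^ 8 * z < (|disc x| : ℝ)) →
        (∀ x ∈ S, ∀ y ∈ S, x ≠ y → ¬ SLeq x y) →
        ∑ x ∈ S, ‖PhiHat q x‖ / (stabCard x : ℝ) * ((|disc x| : ℝ) / (q : ℝ) ^ 8) ^ (-δ)
          ≤ C * (q : ℝ) ^ ((1:ℝ) + ε) * z ^ (1 - δ)) ∧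
    (∀ δ ε : ℝ, 0 < δ → δ < 1 → 0 < ε → ∃ C : ℝ,
      ∀ q : ℕ, Squarefree q → ∀ z : ℝ, 0 < z →
      ∀ S : Finset BCF,
        (∀ x ∈ S, inDual x ∧ disc x ≠ 0 ∧ (|disc x| : ℝ) < (q : ℝ) ^ 8 * z) →
        (∀ x ∈ S, ∀ y ∈ S, x ≠ y → ¬ SLeq x y) →
        ∑ x ∈ S, ‖PhiHat q x‖ / (stabCard x : ℝ) * ((|disc x| : ℝ) / (q : ℝ) ^ 8) ^ (-δ)
          ≤ C * (q : ℝ) ^ ((1:ℝ) + ε) * z ^ (1 - δ)) := by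
  exact DW.final
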